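/- For every a∈ℕ there exist a constant C>0 and a'∈ℕ such that for every Schwartz SO(3)-invariant function F on ℝ³×ℝ³ there exists f ∈ 𝒮(ℝ³) satisfying f(λ(2l+1)+r², λ², λr) = ∫ F·conj(φ_{λ,l,r}) for all λ>0, l∈ℕ, r∈ℝ, and f(R²,0,0) = ∫ F·φ_{0,R} for all R≥0, together with the seminorm bound ‖f‖_a ≤ C·‖F‖_{a'}. (Continuity of the Gelfand transform from 𝒮(N_{3,2})^{SO(3)} into 𝒮(Σ).) -/

import Mathlib

open MeasureTheory Complex Matrix

noncomputable section

abbrev V3 := Fin 3 → ℝ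
abbrev Mat3 := Matrix (Fin 3) (Fin 3) ℝ

instance : MeasurableSpace Mat3 := (inferInstance : MeasurableSpace (Fin 3 → Fin 3 → ℝ))

/-- The set of special orthogonal 3×3 real matrices. -/
def SO3 : Set Mat3 := {A | A * A.transpose = 1 ∧ A.det = 1}

/-- `SO(3)`-invariance of a function on `ℝ³ × ℝ³` (simultaneous action on both factors). -/
def Inv3 (F : V3 × V3 → ℂ) : Prop :=
  ∀ k ∈ SO3, ∀ x y : V3, F (k.mulVec x, k.mulVec y) = F (x, y)

/-- `μ` is the Haar probability measure of `SO(3)`, viewed as a measure on the space of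
matrices: a left-invariant Borel probability measure concentrated on `SO3`.  (On the
compact metrizable group `SO(3)` such a measure is unique.) -/
def IsHaarSO3 (μ : Measure Mat3) : Prop :=
  IsProbabilityMeasure μ ∧ μ SO3ᶜ = 0 ∧ ∀ k ∈ SO3, μ.map (fun A => k * A) = μ

/-- The Laguerre function of order 0: `𝓛_l(u) = (1/l!) e^{u/2} (d/du)^l (u^l e^{-u})`. -/
def lag (l : ℕ) (u : ℝ) : ℝ :=
  (l.factorial : ℝ)⁻¹ * Real.exp (u / 2) * deriv^[l] (fun v : ℝ => v ^ l * Real.exp (-v)) u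

/-- The regular bounded spherical functions `φ_{λ,l,r}` of `(SO(3) ⋉ N_{3,2}, SO(3))`:
`φ_{λ,l,r}(x,y) = ∫_{SO(3)} e^{-iλ(ky)₃} 𝓛_l((λ/2)((kx)₁² + (kx)₂²)) e^{-ir(kx)₃} dk`. -/
def sph (μ : Measure Mat3) (lam : ℝ) (l : ℕ) (r : ℝ) (x y : V3) : ℂ :=
  ∫ k, Complex.exp (-(Complex.I * lam * ((k.mulVec y) 2))) *
      (lag l (lam / 2 * (((k.mulVec x) 0) ^ 2 + ((k.mulVec x) 1) ^ 2)) : ℝ) *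
      Complex.exp (-(Complex.I * r * ((k.mulVec x) 2))) ∂μ

/-- The Euclidean norm on `ℝ³`. -/
def nrm3 (x : V3) : ℝ := Real.sqrt (x 0 ^ 2 + x 1 ^ 2 + x 2 ^ 2)

/-- The singular bounded spherical functions `φ_{0,R}(x,y) = sin(R|x|)/(R|x|)`,
interpreted as `1` when `R|x| = 0`. -/
def sph0 (R : ℝ) (x : V3) : ℝ :=
  if R * nrm3 x = 0 then 1 else Real.sin (R * nrm3 x) / (R * nrm3 x)

/-- The Schwartz seminorm `‖f‖_a`, controlling `(1+|x|)^k |∂^n f(x)|` for all `k, n ≤ a`. -/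
def SN {E : Type*} [NormedAddCommGroup E] [NormedSpace ℝ E] (a : ℕ)
    (f : SchwartzMap E ℂ) : ℝ :=
  ((Finset.Iic (a, a)).sup (schwartzSeminormFamily ℝ E ℂ)) f


section Aux
open scoped SchwartzMap ContDiff LineDeriv Topology

section LemQ
set_option linter.unusedSectionVars false
variable {E E' : Type} [NormedAddCommGroup E] [NormedSpace ℝ E]
  [NormedAddCommGroup E'] [NormedSpace ℝ E']

def SBu {X : Type} (q : 𝓢(E', ℂ) → X → ℝ) : Prop :=
  ∃ (s : Finset (ℕ × ℕ)) (C : ℝ), 0 ≤ C ∧ ∀ A e, q A e ≤ C * s.sup (schwartzSeminormFamily ℝ E' ℂ) A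

lemma SBu.mono {X : Type} {q q' : 𝓢(E', ℂ) → X → ℝ} (h : SBu q) (hq : ∀ A e, q' A e ≤ q A e) :
    SBu q' := by
  obtain ⟨s, C, hC, h⟩ := h
  exact ⟨s, C, hC, fun A e => (hq A e).trans (h A e)⟩

lemma SBu.zero {X : Type} : SBu (fun (_ : 𝓢(E', ℂ)) (_ : X) => 0) :=
  ⟨∅, 0, le_rfl, fun A e => by simp⟩

lemma SBu.add {X : Type} {q q' : 𝓢(E', ℂ) → X → ℝ} (h : SBu q) (h' : SBu q') :
    SBu (fun A e => q A e + q' A e) := by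
  obtain ⟨s, C, hC, h⟩ := h
  obtain ⟨s', C', hC', h'⟩ := h'
  refine ⟨s ∪ s', C + C', by positivity, fun A e => ?_⟩
  have h1 : s.sup (schwartzSeminormFamily ℝ E' ℂ) A ≤ (s ∪ s').sup (schwartzSeminormFamily ℝ E' ℂ) A :=
    Seminorm.le_def.1 (Finset.sup_mono Finset.subset_union_left) A
  have h2 : s'.sup (schwartzSeminormFamily ℝ E' ℂ) A ≤ (s ∪ s').sup (schwartzSeminormFamily ℝ E' ℂ) A :=
    Seminorm.le_def.1 (Finset.sup_mono Finset.subset_union_right) A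
  calc _ ≤ _ := add_le_add (h A e) (h' A e)
    _ ≤ _ := by rw [add_mul]; gcongr

lemma SBu.sum {X : Type} {ι : Type} (t : Finset ι) {q : ι → 𝓢(E', ℂ) → X → ℝ} (h : ∀ i, SBu (q i)) :
    SBu (fun A e => ∑ i ∈ t, q i A e) := by
  classical
  induction t using Finset.induction_on with
  | empty => simpa using SBu.zero
  | insert a s ha ih => simpa [Finset.sum_insert ha] using (h a).add ih

lemma SBu.const_mul {X : Type} {q : 𝓢(E', ℂ) → X → ℝ} (h : SBu q) {c : ℝ} (hc : 0 ≤ c) :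
    SBu (fun A e => c * q A e) := by
  obtain ⟨s, C, hC, h⟩ := h
  exact ⟨s, c * C, by positivity, fun A e => by rw [mul_assoc]; exact mul_le_mul_of_nonneg_left (h A e) hc⟩

lemma SBu.comp {E'' : Type} [NormedAddCommGroup E''] [NormedSpace ℝ E''] {X : Type}
    {q : 𝓢(E', ℂ) → X → ℝ} (h : SBu q) (D : 𝓢(E'', ℂ) →L[ℝ] 𝓢(E', ℂ)) :
    SBu (fun A e => q (D A) e) := by
  obtain ⟨s, C, hC, h⟩ := h
  have hcont : Continuous ((s.sup (schwartzSeminormFamily ℝ E' ℂ)).comp D.toLinearMap) := by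
    have : Continuous (fun A => s.sup (schwartzSeminormFamily ℝ E' ℂ) A) := by
      exact (schwartz_withSeminorms ℝ E' ℂ).finset_sups.continuous_seminorm s
    exact this.comp D.continuous
  obtain ⟨s', C', _, h'⟩ := Seminorm.bound_of_continuous (schwartz_withSeminorms ℝ E'' ℂ) _ hcont
  refine ⟨s', C * C', by positivity, fun A e => (h _ e).trans ?_⟩
  rw [mul_assoc]; gcongr
  exact Seminorm.le_def.1 h' A

variable {ι κ : Type} [Fintype ι] [Fintype κ]
  (T : 𝓢(E', ℂ) → E → ℂ)
  (D : ι → 𝓢(E', ℂ) →L[ℝ] 𝓢(E', ℂ)) (ell : ι → E →L[ℝ] ℝ)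
  (X : κ → 𝓢(E', ℂ) →L[ℝ] 𝓢(E', ℂ))

lemma lemQ_zero (hB : SBu (fun A e => ‖T A e‖))
    (hX : ∀ A e, ‖e‖ * ‖T A e‖ ≤ ∑ j, ‖T (X j A) e‖) (k : ℕ) :
    SBu (fun A e => ‖e‖ ^ k * ‖T A e‖) := by
  induction k with
  | zero => simpa using hB
  | succ k ih =>
    refine (SBu.sum Finset.univ (q := fun j A e => ‖e‖ ^ k * ‖T (X j A) e‖)
      fun j => ih.comp (X j)).mono fun A e => ?_
    rw [pow_succ, mul_assoc, ← Finset.mul_sum]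
    gcongr; exact hX A e

lemma lemQ_bound (hB : SBu (fun A e => ‖T A e‖))
    (hD : ∀ A e, HasFDerivAt (T A) (∑ i, (ell i).smulRight (T (D i A) e)) e)
    (hX : ∀ A e, ‖e‖ * ‖T A e‖ ≤ ∑ j, ‖T (X j A) e‖) (n : ℕ) : (∀ A, ContDiff ℝ n (T A)) ∧ ∀ k,
    SBu (fun A e => ‖e‖ ^ k * ‖iteratedFDeriv ℝ n (T A) e‖) := by
  induction n with
  | zero =>
    refine ⟨fun A => ?_, fun k => ?_⟩
    · have : Continuous (T A) := continuous_iff_continuousAt.2 fun e => (hD A e).continuousAt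
      simpa [contDiff_zero] using this
    · simpa using lemQ_zero T X hB hX k
  | succ n ih =>
    let L : ι → ℂ →L[ℝ] (E →L[ℝ] ℂ) := fun i => ContinuousLinearMap.smulRightL ℝ E ℂ (ell i)
    have hf : ∀ A, fderiv ℝ (T A) = fun e => ∑ i, (fun e => (L i) (T (D i A) e)) e := by
      intro A; ext1 e; rw [(hD A e).fderiv]; rfl
    have hc : ∀ A i, ContDiff ℝ n (fun e => (L i) (T (D i A) e)) := fun A i =>
      (L i).contDiff.comp (ih.1 (D i A))
    refine ⟨fun A => ?_, fun k => ?_⟩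
    · push_cast
      rw [contDiff_succ_iff_fderiv]
      refine ⟨fun e => (hD A e).differentiableAt, by simp, ?_⟩
      rw [hf]
      exact ContDiff.sum fun i _ => hc A i
    · refine (SBu.sum Finset.univ (q := fun i A e => ‖L i‖ * (‖e‖ ^ k * ‖iteratedFDeriv ℝ n (T (D i A)) e‖))
        fun j => ((ih.2 k).comp (D j)).const_mul (by positivity)).mono fun A e => ?_
      rw [← norm_iteratedFDeriv_fderiv, hf, iteratedFDeriv_fun_sum_apply (fun i _ => (hc A i).contDiffAt)]
      rw [show ∑ i, ‖L i‖ * (‖e‖ ^ k * ‖iteratedFDeriv ℝ n (T (D i A)) e‖) =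
        ‖e‖ ^ k * ∑ i, ‖L i‖ * ‖iteratedFDeriv ℝ n (T (D i A)) e‖ by
          rw [Finset.mul_sum]; exact Finset.sum_congr rfl fun i _ => by ring]
      gcongr
      refine (norm_sum_le _ _).trans (Finset.sum_le_sum fun i _ => ?_)
      exact (L i).norm_iteratedFDeriv_comp_left (ih.1 (D i A)).contDiffAt le_rfl

lemma lemQ (hadd : ∀ A B e, T (A + B) e = T A e + T B e)
    (hsmul : ∀ (c : ℝ) A e, T (c • A) e = c • T A e)
    (hB : SBu (fun A e => ‖T A e‖))
    (hD : ∀ A e, HasFDerivAt (T A) (∑ i, (ell i).smulRight (T (D i A) e)) e)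
    (hX : ∀ A e, ‖e‖ * ‖T A e‖ ≤ ∑ j, ‖T (X j A) e‖) :
    ∃ L : 𝓢(E', ℂ) →L[ℝ] 𝓢(E, ℂ), ∀ A e, L A e = T A e := by
  refine ⟨SchwartzMap.mkCLM T hadd (fun a f x => by simpa using hsmul a f x)
    (fun A => contDiff_infty.2 fun n => (lemQ_bound T D ell X hB hD hX n).1 A)
    (fun n => ?_), fun A e => rfl⟩
  exact (lemQ_bound T D ell X hB hD hX n.2).2 n.1
end LemQ

lemma hasFDerivAt_param {E X : Type} [NormedAddCommGroup E] [NormedSpace ℝ E] [MeasurableSpace X] (ν : Measure X)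
    {τ : Type} [Fintype τ] (P : τ → E →L[ℝ] ℝ) (B : τ → E → X → ℂ) (F : E → X → ℂ) (e : E)
    (hF : ∀ x, Integrable (F x) ν) (hB : ∀ t, Integrable (B t e) ν) (bd : X → ℝ) (hbd : Integrable bd ν)
    (hb : ∀ t, ∃ C, ∀ x ∈ Metric.ball e 1, ∀ v, ‖B t x v‖ ≤ C * bd v)
    (hd : ∀ v x, HasFDerivAt (fun x => F x v) (∑ t, (P t).smulRight (B t x v)) x) :
    HasFDerivAt (fun x => ∫ v, F x v ∂ν) (∑ t, (P t).smulRight (∫ v, B t e v ∂ν)) e := by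
  have hsm : ∀ (P : E →L[ℝ] ℝ) (g : X → ℂ), Integrable g ν → Integrable (fun v => P.smulRight (g v)) ν :=
    fun P g hg => ((ContinuousLinearMap.smulRightL ℝ E ℂ P).integrable_comp hg)
  have hsm' : ∀ (P : E →L[ℝ] ℝ) (g : X → ℂ), Integrable g ν → ∫ v, P.smulRight (g v) ∂ν = P.smulRight (∫ v, g v ∂ν) :=
    fun P g hg => ((ContinuousLinearMap.smulRightL ℝ E ℂ P).integral_comp_comm hg)
  choose C hC using hb
  have hint : Integrable (fun v => ∑ t, (P t).smulRight (B t e v)) ν :=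
    integrable_finsetSum (f := fun t v => (P t).smulRight (B t e v)) Finset.univ fun i _ => hsm (P i) (B i e) (hB i)
  have main := hasFDerivAt_integral_of_dominated_of_fderiv_le (𝕜 := ℝ) (μ := ν) (x₀ := e)
    (s := Metric.ball e 1) (F' := fun x v => ∑ t, (P t).smulRight (B t x v)) (F := F)
    (bound := fun v => (∑ i, ‖P i‖ * C i) * bd v)
    (Metric.ball_mem_nhds e one_pos)
    (Filter.Eventually.of_forall fun x => (hF x).aestronglyMeasurable) (hF e)
    hint.aestronglyMeasurable
    (Filter.Eventually.of_forall fun v x hx => ?_)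
    (hbd.const_mul _)
    (Filter.Eventually.of_forall fun v x hx => hd v x)
  · refine main.congr_fderiv ?_
    rw [integral_finsetSum (f := fun t v => (P t).smulRight (B t e v)) Finset.univ (fun i _ => hsm (P i) (B i e) (hB i))]
    exact Finset.sum_congr rfl fun i _ => hsm' (P i) (B i e) (hB i)
  · rw [Finset.sum_mul]
    refine (norm_sum_le _ _).trans (Finset.sum_le_sum fun i _ => ?_)
    rw [ContinuousLinearMap.norm_smulRight_apply, mul_assoc]
    gcongr
    exact hC i x hx v

section BL
set_option linter.unusedSectionVars false

lemma htg_fderiv {E F : Type} [NormedAddCommGroup E] [NormedSpace ℝ E]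
    [NormedAddCommGroup F] [NormedSpace ℝ F] {f : E → F} (hf : f.HasTemperateGrowth) :
    (fderiv ℝ f).HasTemperateGrowth := by
  refine ⟨hf.1.fderiv_right (by simp), fun n => ?_⟩
  obtain ⟨k, C, h⟩ := hf.2 (n + 1)
  exact ⟨k, C, fun x => by rw [norm_iteratedFDeriv_fderiv]; exact h x⟩

lemma htg_fderiv_apply {E F : Type} [NormedAddCommGroup E] [NormedSpace ℝ E]
    [NormedAddCommGroup F] [NormedSpace ℝ F] {f : E → F} (hf : f.HasTemperateGrowth) (v : E) :
    (fun x => fderiv ℝ f x v).HasTemperateGrowth :=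
  (ContinuousLinearMap.apply ℝ F v).hasTemperateGrowth.comp (htg_fderiv hf)

def mulS {E : Type} [NormedAddCommGroup E] [NormedSpace ℝ E] {g : E → ℂ}
    (hg : g.HasTemperateGrowth) : 𝓢(E, ℂ) →L[ℝ] 𝓢(E, ℂ) :=
  SchwartzMap.bilinLeftCLM (ContinuousLinearMap.mul ℝ ℂ) hg

@[simp] lemma mulS_apply {E : Type} [NormedAddCommGroup E] [NormedSpace ℝ E] {g : E → ℂ}
    (hg : g.HasTemperateGrowth) (A : 𝓢(E, ℂ)) (x : E) : mulS hg A x = A x * g x := rfl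

def dirS {E : Type} [NormedAddCommGroup E] [NormedSpace ℝ E] (m : E) :
    𝓢(E, ℂ) →L[ℝ] 𝓢(E, ℂ) := LineDeriv.lineDerivOpCLM ℝ 𝓢(E, ℂ) m

@[simp] lemma dirS_apply {E : Type} [NormedAddCommGroup E] [NormedSpace ℝ E] (m : E)
    (A : 𝓢(E, ℂ)) (x : E) : dirS m A x = fderiv ℝ A x m := by
  simp [dirS, SchwartzMap.lineDerivOp_apply_eq_fderiv]

variable {V W : Type} [NormedAddCommGroup V] [InnerProductSpace ℝ V] [FiniteDimensional ℝ V]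
  [MeasurableSpace V] [BorelSpace V] [NormedAddCommGroup W] [NormedSpace ℝ W]
  (μ : Measure V) [μ.IsAddHaarMeasure]

def wt (v : V) : ℝ := (1 + ‖v‖) ^ (- (μ.integrablePower : ℝ))

lemma SBu_decay : SBu (fun (A : 𝓢(V × W, ℂ)) (p : V × W) => (1 + ‖p.1‖) ^ (μ.integrablePower) * ‖A p‖) := by
  refine ⟨Finset.Iic (μ.integrablePower, 0), 2 ^ μ.integrablePower, by positivity, fun A p => ?_⟩
  have := SchwartzMap.one_add_le_sup_seminorm_apply (𝕜 := ℝ) (m := (μ.integrablePower, 0)) le_rfl le_rfl A p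
  refine le_trans ?_ this
  rw [norm_iteratedFDeriv_zero]
  exact mul_le_mul_of_nonneg_right (pow_le_pow_left₀ (by positivity) (by linarith [norm_fst_le p]) _)
    (norm_nonneg _)

lemma SBu_decay' : ∃ (s : Finset (ℕ × ℕ)) (C : ℝ), 0 ≤ C ∧ ∀ (A : 𝓢(V × W, ℂ)) v w,
    ‖A (v, w)‖ ≤ (C * s.sup (schwartzSeminormFamily ℝ (V × W) ℂ) A) * wt μ v := by
  obtain ⟨s, C, hC, h⟩ := SBu_decay (V := V) (W := W) μ
  refine ⟨s, C, hC, fun A v w => ?_⟩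
  have := h A (v, w)
  simp only [wt, Real.rpow_neg (show 0 ≤ 1 + ‖v‖ by positivity), Real.rpow_natCast]
  rw [← div_eq_mul_inv, le_div_iff₀ (by positivity), mul_comm]
  exact this

lemma slice_bound (A : 𝓢(V × W, ℂ)) : ∃ C, 0 ≤ C ∧ ∀ v w, ‖A (v, w)‖ ≤ C * wt μ v := by
  obtain ⟨s, C, hC, h⟩ := SBu_decay' (V := V) (W := W) μ
  exact ⟨_, by positivity, h A⟩

lemma wt_int : Integrable (wt μ) μ   := Measure.integrable_pow_neg_integrablePower μ

def ph (th : V × W → V) (n : V) (p : V × W) : ℂ := Complex.exp (-(I * (inner ℝ n (th p) : ℝ)))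

lemma ph_norm (th : V × W → V) (n : V) (p : V × W) : ‖ph th n p‖ = 1 := by
  rw [ph, Complex.norm_exp]; simp

lemma ph_cont {th : V × W → V} (hth : Continuous th) (n : V) : Continuous (ph th n) := by
  unfold ph; fun_prop

lemma slice_int {th : V × W → V} (hth : Continuous th) (A : 𝓢(V × W, ℂ)) (n : V) (w : W) :
    Integrable (fun v => A (v, w) * ph th n (v, w)) μ := by
  obtain ⟨C, hC, h⟩ := slice_bound μ A
  refine ((wt_int μ).const_mul C).mono' ?_ (Filter.Eventually.of_forall fun v => ?_)
  · have := A.continuous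
    have := ph_cont hth n
    exact Continuous.aestronglyMeasurable (by fun_prop)
  · rw [norm_mul, ph_norm, mul_one]; exact h v w

def Sop (th : V × W → V) (A : 𝓢(V × W, ℂ)) (e : V × W) : ℂ :=
  ∫ v, A (v, e.2) * ph th e.1 (v, e.2) ∂μ

lemma Sop_bound (th : V × W → V) : SBu (fun A e => ‖Sop μ th A e‖) := by
  obtain ⟨s, C, hC, h⟩ := SBu_decay' (V := V) (W := W) μ
  refine ⟨s, C * ∫ v, wt μ v ∂μ, ?_, fun A e => ?_⟩
  · exact mul_nonneg hC (integral_nonneg fun v => by simp only [wt]; positivity)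
  · calc _ ≤ ∫ v, (C * s.sup (schwartzSeminormFamily ℝ (V × W) ℂ) A) * wt μ v ∂μ := by
          refine norm_integral_le_of_norm_le ((wt_int μ).const_mul _) (Filter.Eventually.of_forall fun v => ?_)
          rw [norm_mul, ph_norm, mul_one]; exact h A v e.2
      _ = _ := by rw [integral_const_mul]; ring

lemma ph_hasFDerivAt {th : V × W → V} (hth : ContDiff ℝ ∞ th) (n : V) (v : V) (w : W) :
    HasFDerivAt (fun e : V × W => ph th e.1 (v, e.2))
      (ph th n (v, w) • (-I) • (ofRealCLM ∘L ((innerSL ℝ).flip (th (v, w)) ∘L ContinuousLinearMap.fst ℝ V W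
        + innerSL ℝ n ∘L (fderiv ℝ th (v, w)) ∘L ContinuousLinearMap.inr ℝ V W ∘L ContinuousLinearMap.snd ℝ V W))) (n, w) := by
  have h1 : HasFDerivAt th (fderiv ℝ th (v, w)) (v, w) :=
    (hth.differentiable (by simp) _).hasFDerivAt
  have h2 : HasFDerivAt (fun e : V × W => (v, e.2))
      (ContinuousLinearMap.inr ℝ V W ∘L ContinuousLinearMap.snd ℝ V W) (n, w) := by
    have := (hasFDerivAt_const v (n, w)).prodMk (hasFDerivAt_snd (𝕜 := ℝ) (p := (n, w)))
    refine this.congr_fderiv ?_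
    ext <;> simp
  have h3 : HasFDerivAt (fun e : V × W => th (v, e.2)) (fderiv ℝ th (v, w) ∘L
      (ContinuousLinearMap.inr ℝ V W ∘L ContinuousLinearMap.snd ℝ V W)) (n, w) :=
    HasFDerivAt.comp (n, w) h1 h2
  have h4 := (hasFDerivAt_fst (𝕜 := ℝ) (p := (n, w))).inner ℝ h3
  have h5 := ((ofRealCLM.hasFDerivAt.comp (n, w) h4).const_mul (-I)).cexp
  have : (fun e : V × W => ph th e.1 (v, e.2)) = fun e => cexp (-I * (ofRealCLM ∘ fun e : V × W => inner ℝ e.1 (th (v, e.2))) e) := by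
    ext e; simp [ph]
  rw [this]
  refine h5.congr_fderiv ?_
  ext e
  · have h6 : (innerSL ℝ (th (v, w))) e = inner ℝ e (th (v, w)) := real_inner_comm _ _
    simp [ph, h6]; ring
  · simp [ph]


variable {ι κ : Type} [Fintype ι] [Fintype κ] (b : OrthonormalBasis ι ℝ V) (c : Module.Basis κ ℝ W)

lemma htg_inner {th : V × W → V} (hth : th.HasTemperateGrowth) (u : V) :
    (fun p => -I * ((inner ℝ u (th p) : ℝ) : ℂ)).HasTemperateGrowth := by
  have h1 : (fun p => ((inner ℝ u (th p) : ℝ) : ℂ)).HasTemperateGrowth :=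
    (ofRealCLM ∘L innerSL ℝ u).hasTemperateGrowth.comp hth
  exact (Function.HasTemperateGrowth.const (-I)).mul h1

lemma htg_ofReal {E : Type} [NormedAddCommGroup E] [NormedSpace ℝ E] {g : E → ℝ} (h : g.HasTemperateGrowth) :
    (fun p => (g p : ℂ)).HasTemperateGrowth := ofRealCLM.hasTemperateGrowth.comp h

def Xop {om : ι → V × W → ℝ} (hom : ∀ i, (om i).HasTemperateGrowth) (k : ι) :
    𝓢(V × W, ℂ) →L[ℝ] 𝓢(V × W, ℂ) :=
  mulS (Function.HasTemperateGrowth.const (-I)) ∘L dirS (b k, 0) ∘L mulS (htg_ofReal (hom k))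

lemma Sop_ibp {th : V × W → V} (hth : th.HasTemperateGrowth) {om : ι → V × W → ℝ}
    (hom : ∀ i, (om i).HasTemperateGrowth)
    (h : ∀ i p, om i p • fderiv ℝ th p (b i, 0) = b i) (k : ι) (A : 𝓢(V × W, ℂ)) (e : V × W) :
    ((inner ℝ e.1 (b k) : ℝ) : ℂ) * Sop μ th A e = Sop μ th (Xop b hom k A) e := by
  obtain ⟨n, w⟩ := e
  have hcont := hth.1.continuous
  let A' := mulS (htg_ofReal (hom k)) A
  let q : V → V × W := fun v => (v, w)
  have hq : ∀ v, HasFDerivAt q (ContinuousLinearMap.inl ℝ V W) v := fun v => by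
    refine ((hasFDerivAt_id v).prodMk (hasFDerivAt_const w v)).congr_fderiv ?_
    ext <;> simp
  have hf : ∀ v, HasFDerivAt (fun v => A' (v, w)) (fderiv ℝ A' (v, w) ∘L ContinuousLinearMap.inl ℝ V W) v :=
    fun v => HasFDerivAt.comp v (A'.differentiableAt.hasFDerivAt) (hq v)
  have hg : ∀ v, HasFDerivAt (fun v => ph th n (v, w))
      (ph th n (v, w) • (-I) • (ofRealCLM ∘L innerSL ℝ n ∘L (fderiv ℝ th (v, w)) ∘L
        ContinuousLinearMap.inl ℝ V W)) v := fun v => by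
    have h1 : HasFDerivAt th (fderiv ℝ th (v, w)) (v, w) :=
      (hth.1.differentiable (by simp) _).hasFDerivAt
    have h3 : HasFDerivAt (fun v => th (v, w)) (fderiv ℝ th (v, w) ∘L
        (ContinuousLinearMap.inl ℝ V W)) v := HasFDerivAt.comp v h1 (hq v)
    have h4 := (innerSL ℝ n).hasFDerivAt.comp v h3
    have h5 := ((ofRealCLM.hasFDerivAt.comp v h4).const_mul (-I)).cexp
    have : (fun v => ph th n (v, w)) = fun v => cexp (-I * (ofRealCLM ∘ ((innerSL ℝ n) ∘ fun v : V => (th (v, w)))) v) := by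
      ext e; simp [ph]
    rw [this]
    refine h5.congr_fderiv ?_
    ext e
    simp [ph]
  have key : ∀ v, A' (v, w) * (ph th n (v, w) • (-I) • (ofRealCLM ∘L innerSL ℝ n ∘L (fderiv ℝ th (v, w)) ∘L
        ContinuousLinearMap.inl ℝ V W)) (b k) = -I * ((inner ℝ n (b k) : ℝ) : ℂ) * (A (v, w) * ph th n (v, w)) := by
    intro v
    have := congrArg (fun z => ((inner ℝ n z : ℝ) : ℂ)) (h k (v, w))
    simp only [inner_smul_right, ofReal_mul] at this
    simp only [A', mulS_apply, ← this]
    simp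
    ring
  have ibp := integral_bilinear_hasFDerivAt_right_eq_neg_left_of_integrable (μ := μ)
    (B := ContinuousLinearMap.mul ℝ ℂ) (v := b k) (f := fun v => A' (v, w)) (g := fun v => ph th n (v, w))
    (f' := fun v => fderiv ℝ A' (v, w) ∘L ContinuousLinearMap.inl ℝ V W)
    (g' := fun v => (ph th n (v, w) • (-I) • (ofRealCLM ∘L innerSL ℝ n ∘L (fderiv ℝ th (v, w)) ∘L
        ContinuousLinearMap.inl ℝ V W)))
    (by simpa using slice_int μ hcont (dirS (b k, 0) A') n w)
    (by simp only [ContinuousLinearMap.mul_apply', key]; exact (slice_int μ hcont A n w).const_mul _)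
    (by simpa using slice_int μ hcont A' n w) (fun x _ => hf x) (fun x _ => hg x)
  simp only [ContinuousLinearMap.mul_apply', key] at ibp
  rw [integral_const_mul] at ibp
  have e1 : Sop μ th (Xop b hom k A) (n, w) = -I * ∫ v, (fderiv ℝ A' (v, w) ∘L ContinuousLinearMap.inl ℝ V W) (b k) * ph th n (v, w) ∂μ := by
    rw [← integral_const_mul, Sop]
    congr 1; ext v
    simp [Xop, A']; ring
  rw [e1, ← neg_eq_iff_eq_neg.2 ibp]
  simp only [Sop]
  linear_combination ((∫ v, A (v, w) * ph th n (v, w) ∂μ) * (inner ℝ n (b k) : ℝ)) * I_mul_I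

def Mop {th : V × W → V} (hth : th.HasTemperateGrowth) (u : V) :
    𝓢(V × W, ℂ) →L[ℝ] 𝓢(V × W, ℂ) := mulS (htg_inner hth u)

variable [FiniteDimensional ℝ W]

lemma integrand_hasFDerivAt {th : V × W → V} (hth : th.HasTemperateGrowth) (A : 𝓢(V × W, ℂ)) (v : V) (e : V × W) :
    HasFDerivAt (fun e : V × W => A (v, e.2) * ph th e.1 (v, e.2))
     (∑ i, ((innerSL ℝ (b i)) ∘L ContinuousLinearMap.fst ℝ V W).smulRight
        (Mop hth (b i) A (v, e.2) * ph th e.1 (v, e.2))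
      + ∑ j, ((LinearMap.toContinuousLinearMap (c.coord j)) ∘L ContinuousLinearMap.snd ℝ V W).smulRight
        (dirS (0, c j) A (v, e.2) * ph th e.1 (v, e.2) + ∑ k, ((inner ℝ e.1 (b k) : ℝ) : ℂ) *
          (Mop (htg_fderiv_apply hth (0, c j)) (b k) A (v, e.2) * ph th e.1 (v, e.2)))) e := by
  obtain ⟨n, w⟩ := e
  have h2 : HasFDerivAt (fun e : V × W => (v, e.2))
      (ContinuousLinearMap.inr ℝ V W ∘L ContinuousLinearMap.snd ℝ V W) (n, w) := by
    have := (hasFDerivAt_const v (n, w)).prodMk (hasFDerivAt_snd (𝕜 := ℝ) (p := (n, w)))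
    refine this.congr_fderiv ?_
    ext <;> simp
  have h3 : HasFDerivAt (fun e : V × W => A (v, e.2)) (fderiv ℝ A (v, w) ∘L
      (ContinuousLinearMap.inr ℝ V W ∘L ContinuousLinearMap.snd ℝ V W)) (n, w) :=
    HasFDerivAt.comp (n, w) (A.differentiableAt.hasFDerivAt) h2
  refine (h3.mul (ph_hasFDerivAt hth.1 n v w)).congr_fderiv ?_
  have hsum : ∀ x y : V, ((inner ℝ x y : ℝ) : ℂ) = ∑ i, ((inner ℝ x (b i) : ℝ) : ℂ) * ((inner ℝ (b i) y : ℝ) : ℂ) := by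
    intro x y
    rw [← b.sum_inner_mul_inner x y]; push_cast; rfl
  refine ContinuousLinearMap.prod_ext ?_ ?_
  · ext u
    have h6 : (innerSL ℝ (th (v, w))) u = inner ℝ u (th (v, w)) := real_inner_comm _ _
    have h7 : ((0 : V), (0 : W)) = 0 := rfl
    simp [Mop, h6, h7]
    rw [hsum u, Finset.mul_sum, Finset.mul_sum, Finset.mul_sum]
    refine Finset.sum_congr rfl fun i _ => ?_
    rw [real_inner_comm]
    ring
  · apply ContinuousLinearMap.coe_injective
    refine c.ext fun j => ?_
    classical
    simp only [Mop, mulS_apply, dirS_apply]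
    have hj : ∀ g : κ → ℂ, (∑ x, ((c.coord x (c j) : ℝ) : ℂ) * g x) = g j := fun g => by
      rw [Finset.sum_eq_single j]
      · simp [Finsupp.single_apply]
      · intro x _ hx
        simp [Finsupp.single_apply, hx.symm]
      · simp
    have hj' := hj (fun x => ((fderiv ℝ ⇑A (v, w)) (0, c x) * ph th n (v, w)) + -(∑ x_1,
              ((inner ℝ n (b x_1) : ℝ) : ℂ) *
                (A (v, w) * (I * ((inner ℝ (b x_1) ((fderiv ℝ th (v, w)) (0, c x)) : ℝ) : ℂ)) * ph th n (v, w))))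
    simp only [mul_add, mul_neg] at hj'
    simp [-Module.Basis.coord_apply]
    rw [hj']
    rw [hsum n, Finset.mul_sum, Finset.mul_sum, Finset.mul_sum, mul_comm (ph _ _ _) (fderiv _ _ _ _), add_comm]
    congr 2
    refine Finset.sum_congr rfl fun i _ => ?_
    ring


lemma Sop_hasFDerivAt {th : V × W → V} (hth : th.HasTemperateGrowth) {om : ι → V × W → ℝ}
    (hom : ∀ i, (om i).HasTemperateGrowth)
    (h : ∀ i p, om i p • fderiv ℝ th p (b i, 0) = b i) (A : 𝓢(V × W, ℂ)) (e : V × W) :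
    HasFDerivAt (Sop μ th A)
     (∑ i, ((innerSL ℝ (b i)) ∘L ContinuousLinearMap.fst ℝ V W).smulRight
        (Sop μ th (Mop hth (b i) A) e)
      + ∑ j, ((LinearMap.toContinuousLinearMap (c.coord j)) ∘L ContinuousLinearMap.snd ℝ V W).smulRight
        (Sop μ th (dirS (0, c j) A + ∑ k, 
          Xop b hom k (Mop (htg_fderiv_apply hth (0, c j)) (b k) A)) e)) e := by
  have hcont := hth.1.continuous
  let P1 : ι → (V × W →L[ℝ] ℝ) := fun i => (innerSL ℝ (b i)) ∘L ContinuousLinearMap.fst ℝ V W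
  let P2 : κ → (V × W →L[ℝ] ℝ) := fun j => (LinearMap.toContinuousLinearMap (c.coord j)) ∘L ContinuousLinearMap.snd ℝ V W
  let A1 : ι → 𝓢(V × W, ℂ) := fun i => Mop hth (b i) A
  let A2 : κ → 𝓢(V × W, ℂ) := fun j => dirS (0, c j) A
  let A3 : κ → ι → 𝓢(V × W, ℂ) := fun j k => Mop (htg_fderiv_apply hth (0, c j)) (b k) A
  have hint1 := fun i => slice_int μ hcont (A1 i) e.1 e.2
  have hint2 := fun j => slice_int μ hcont (A2 j) e.1 e.2
  have hint3 := fun j k => slice_int μ hcont (A3 j k) e.1 e.2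
  have hint4 : ∀ j, Integrable (fun v => A2 j (v, e.2) * ph th e.1 (v, e.2) + ∑ k, ((inner ℝ e.1 (b k) : ℝ) : ℂ) *
          (A3 j k (v, e.2) * ph th e.1 (v, e.2))) μ := fun j =>
    (hint2 j).add (integrable_finsetSum _ fun k _ => (hint3 j k).const_mul _)
  have main := hasFDerivAt_param μ (τ := ι ⊕ κ) (Sum.elim P1 P2)
    (Sum.elim (fun i e v => A1 i (v, e.2) * ph th e.1 (v, e.2))
      (fun j e v => (A2 j (v, e.2) * ph th e.1 (v, e.2) + ∑ k, ((inner ℝ e.1 (b k) : ℝ) : ℂ) *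
          (A3 j k (v, e.2) * ph th e.1 (v, e.2)))))
    (fun e v => A (v, e.2) * ph th e.1 (v, e.2)) e (fun x => slice_int μ hcont A x.1 x.2)
    (by rintro (i | j); exacts [hint1 i, hint4 j]) (wt μ) (wt_int μ) ?_
    (fun v x => by
      refine (integrand_hasFDerivAt b c hth A v x).congr_fderiv ?_
      rw [Fintype.sum_sum_type]
      rfl)
  · refine main.congr_fderiv ?_
    rw [Fintype.sum_sum_type]
    congr 1
    refine Finset.sum_congr rfl fun j _ => ?_
    simp only [Sum.elim_inr]
    congr 1
    rw [integral_add (hint2 j) (integrable_finsetSum _ fun k _ => (hint3 j k).const_mul _),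
        integral_finsetSum _ fun k _ => (hint3 j k).const_mul _]
    simp_rw [integral_const_mul]
    have e1 : ∀ k, ((inner ℝ e.1 (b k) : ℝ) : ℂ) * ∫ v, A3 j k (v, e.2) * ph th e.1 (v, e.2) ∂μ
        = ∫ v, Xop b hom k (A3 j k) (v, e.2) * ph th e.1 (v, e.2) ∂μ := fun k =>
          Sop_ibp μ b hth hom h k (A3 j k) e
    simp_rw [e1]
    rw [Sop, ← integral_finsetSum _ (fun k _ => slice_int μ hcont (Xop b hom k (A3 j k)) e.1 e.2),
        ← integral_add (hint2 j) (integrable_finsetSum _ fun k _ => slice_int μ hcont (Xop b hom k (A3 j k)) e.1 e.2)]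
    congr 1; ext v
    simp only [_root_.add_apply, _root_.sum_apply, add_mul, Finset.sum_mul]
    rfl
  · have hx1 : ∀ x ∈ Metric.ball e 1, ‖x.1‖ ≤ ‖e‖ + 1 := by
      intro x hx
      have h5 := norm_fst_le x
      have h6 : ‖x - e‖ < 1 := by simpa [dist_eq_norm] using hx
      have h7 := norm_sub_norm_le x e
      linarith
    rintro (i | j)
    · obtain ⟨C1, hC1, h1⟩ := slice_bound μ (A1 i)
      refine ⟨C1, fun x hx v => ?_⟩
      simp only [Sum.elim_inl]
      rw [norm_mul, ph_norm, mul_one]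
      exact h1 v x.2
    · obtain ⟨C2, hC2, h2⟩ := slice_bound μ (A2 j)
      choose C3 hC3 h3 using fun k => slice_bound μ (A3 j k)
      refine ⟨C2 + ∑ k, (‖e‖ + 1) * C3 k, fun x hx v => ?_⟩
      have hwt : 0 ≤ wt μ v := by unfold wt; positivity
      simp only [Sum.elim_inr]
      rw [add_mul, Finset.sum_mul]
      refine (norm_add_le _ _).trans (add_le_add ?_ ?_)
      · rw [norm_mul, ph_norm, mul_one]; exact h2 v x.2
      · refine (norm_sum_le _ _).trans (Finset.sum_le_sum fun k _ => ?_)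
        rw [norm_mul, norm_mul, ph_norm, mul_one, mul_assoc]
        gcongr
        · rw [Complex.norm_real]
          refine (norm_inner_le_norm _ _).trans ?_
          simpa using hx1 x hx
        · exact h3 k v x.2

theorem BL (b : OrthonormalBasis ι ℝ V) {th : V × W → V} (hth : th.HasTemperateGrowth) {om : ι → V × W → ℝ}
    (hom : ∀ i, (om i).HasTemperateGrowth)
    (h : ∀ i p, om i p • fderiv ℝ th p (b i, 0) = b i) :
    ∃ L : 𝓢(V × W, ℂ) →L[ℝ] 𝓢(V × W, ℂ), ∀ A n w, L A (n, w) =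
      ∫ v, A (v, w) * Complex.exp (-(I * (inner ℝ n (th (v, w)) : ℝ))) ∂μ := by
  have hcont := hth.1.continuous
  let c := Module.finBasis ℝ W
  have hw : ∀ j, (fun p : V × W => (((‖c j‖ * c.coord j p.2 : ℝ)) : ℂ)).HasTemperateGrowth := fun j =>
    (ofRealCLM ∘L (‖c j‖ • (LinearMap.toContinuousLinearMap (c.coord j) ∘L
      ContinuousLinearMap.snd ℝ V W))).hasTemperateGrowth
  obtain ⟨L, hL⟩ := lemQ (ι := ι ⊕ Fin (Module.finrank ℝ W)) (κ := ι ⊕ Fin (Module.finrank ℝ W)) (Sop μ th)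
    (Sum.elim (fun i => Mop hth (b i)) (fun j => dirS (0, c j) + ∑ k, 
          Xop b hom k ∘L (Mop (htg_fderiv_apply hth (0, c j)) (b k))))
    (Sum.elim (fun i => (innerSL ℝ (b i)) ∘L ContinuousLinearMap.fst ℝ V W)
      (fun j => (LinearMap.toContinuousLinearMap (c.coord j)) ∘L ContinuousLinearMap.snd ℝ V W))
    (Sum.elim (fun i => Xop b hom i) (fun j => mulS (hw j)))
    (fun A B e => by
      simp only [Sop]
      rw [← integral_add (slice_int μ hcont A e.1 e.2) (slice_int μ hcont B e.1 e.2)]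
      congr 1; ext v; simp [add_mul])
    (fun r A e => by
      simp only [Sop]
      rw [← integral_smul]
      congr 1; ext v; simp [mul_assoc])
    (Sop_bound μ th)
    (fun A e => by
      refine (Sop_hasFDerivAt μ b c hth hom h A e).congr_fderiv ?_
      rw [Fintype.sum_sum_type]
      simp)
    (fun A e => by
      rw [Fintype.sum_sum_type]
      simp only [Sum.elim_inl, Sum.elim_inr]
      simp only [← Sop_ibp μ b hth hom h]
      have e1 : ∀ j, Sop μ th (mulS (hw j) A) e = (((‖c j‖ * c.coord j e.2 : ℝ)) : ℂ) * Sop μ th A e := by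
        intro j
        rw [Sop, Sop, ← integral_const_mul]
        congr 1; ext v; simp; ring
      simp only [e1, norm_mul, ← Finset.sum_mul]
      rw [← add_mul]
      gcongr
      refine (Prod.norm_def e).trans_le ((max_le_add_of_nonneg (norm_nonneg _) (norm_nonneg _)).trans (add_le_add ?_ ?_))
      · conv_lhs => rw [← b.sum_repr' e.1]
        refine (norm_sum_le _ _).trans (Finset.sum_le_sum fun i _ => ?_)
        simp [norm_smul, real_inner_comm]
      · conv_lhs => rw [← c.sum_repr e.2]
        refine (norm_sum_le _ _).trans (Finset.sum_le_sum fun i _ => ?_)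
        simp [norm_smul, mul_comm])
  exact ⟨L, fun A n w => hL A (n, w)⟩

end BL

lemma htg1 {F : Type} [NormedAddCommGroup F] [NormedSpace ℝ F] {f : ℝ → F} (h : ContDiff ℝ ∞ f)
    (hb : ∀ n, ∃ (k : ℕ) (C : ℝ), ∀ x, ‖iteratedDeriv n f x‖ ≤ C * (1 + ‖x‖) ^ k) :
    f.HasTemperateGrowth :=
  ⟨h, fun n => by simpa only [norm_iteratedFDeriv_eq_norm_iteratedDeriv] using hb n⟩

lemma htg1_bound {F : Type} [NormedAddCommGroup F] [NormedSpace ℝ F] {f : ℝ → F} (h : f.HasTemperateGrowth) (n : ℕ) :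
    ∃ (k : ℕ) (C : ℝ), ∀ x, ‖iteratedDeriv n f x‖ ≤ C * (1 + ‖x‖) ^ k := by
  simpa only [norm_iteratedFDeriv_eq_norm_iteratedDeriv] using h.2 n

/-- half-line criterion -/
lemma htg1_half {f : ℝ → ℝ} (h : ContDiff ℝ ∞ f) (c : ℝ) (h0 : ∀ x, x ≤ -1 → f x = c)
    (hb : ∀ n, ∃ (k : ℕ) (C : ℝ), ∀ x, 0 ≤ x → ‖iteratedDeriv n f x‖ ≤ C * (1 + ‖x‖) ^ k) :
    f.HasTemperateGrowth := by
  refine htg1 h fun n => ?_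
  obtain ⟨k, C, hC⟩ := hb n
  have hcont : Continuous (iteratedDeriv n f) := h.continuous_iteratedDeriv n (mod_cast le_top)
  obtain ⟨M, hM⟩ := (isCompact_Icc (a := (-2:ℝ)) (b := 0)).exists_bound_of_continuousOn hcont.continuousOn
  have hl : ∀ x < -1, ‖iteratedDeriv n f x‖ ≤ |c| := by
    intro x hx
    have he : f =ᶠ[𝓝 x] fun _ => c := by
      filter_upwards [Iio_mem_nhds hx] with y hy using h0 y (le_of_lt hy)
    rw [he.iteratedDeriv_eq n, iteratedDeriv_const]
    split_ifs <;> simp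
  refine ⟨k, |C| + |M| + |c|, fun x => ?_⟩
  have h1 : 1 ≤ (1 + ‖x‖) ^ k := one_le_pow₀ (by simp)
  rcases lt_or_ge x (-1) with hx | hx
  · refine (hl x hx).trans ?_
    have := abs_nonneg C
    have := abs_nonneg M
    have := abs_nonneg c
    nlinarith
  · rcases lt_or_ge x 0 with hx' | hx'
    · refine (hM x ⟨by linarith, hx'.le⟩).trans ?_
      have := abs_nonneg C
      have := le_abs_self M
      have := abs_nonneg c
      have := abs_nonneg M
      nlinarith
    · refine (hC x hx').trans ?_
      have := le_abs_self C
      have := abs_nonneg c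
      have := abs_nonneg M
      gcongr
      linarith

lemma htg_cexp : (fun x : ℝ => Complex.exp (I * x)).HasTemperateGrowth := by
  have hder : ∀ n, iteratedDeriv n (fun x : ℝ => Complex.exp (I * x)) = fun x : ℝ => I ^ n * Complex.exp (I * x) := by
    intro n
    induction n with
    | zero => simp
    | succ n ih =>
      rw [iteratedDeriv_succ, ih]
      ext x
      have h1 : HasDerivAt (fun x : ℝ => I * (x:ℂ)) (I * 1) x :=
        (Complex.ofRealCLM.hasDerivAt (x := x)).const_mul I
      have := (h1.cexp.const_mul (I ^ n)).deriv
      rw [this]; ring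
  refine htg1 ((contDiff_const.mul Complex.ofRealCLM.contDiff).cexp) fun n => ⟨0, 1, fun x => ?_⟩
  rw [hder]
  simp [Complex.norm_exp]

lemma htg_phase {E : Type} [NormedAddCommGroup E] [NormedSpace ℝ E] {g : E → ℝ} (hg : g.HasTemperateGrowth) :
    (fun x => Complex.exp (I * (g x : ℝ))).HasTemperateGrowth :=
  htg_cexp.comp hg

lemma htg_rpow {E : Type} [NormedAddCommGroup E] [NormedSpace ℝ E] {f : E → ℝ} (hf : f.HasTemperateGrowth)
    (h : ∀ x, 1 / 2 ≤ f x) : (fun x => (f x) ^ (-(1/2) : ℝ)).HasTemperateGrowth := by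
  set t := {y : ℝ | 1 / 4 < y}
  have ht : Set.range f ⊆ t := by
    rintro - ⟨y, rfl⟩
    exact lt_of_lt_of_le (by norm_num) (h y)
  have hdiff : ContDiffOn ℝ ∞ (fun x ↦ x ^ (-(1/2) : ℝ)) t :=
    contDiffOn_fun_id.rpow_const_of_ne fun x hx ↦ (lt_trans (by norm_num) hx).ne'
  have hunique : UniqueDiffOn ℝ t := (isOpen_lt' (1 / 4)).uniqueDiffOn
  apply Function.HasTemperateGrowth.comp' ht hunique hdiff _ hf
  intro N
  refine ⟨0, ∑ k ∈ Finset.range (N + 1), ‖Polynomial.eval (-(1/2) : ℝ) (descPochhammer ℝ k)‖ * (1/4) ^ (-(1/2) - (k:ℝ)), by positivity, ?_⟩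
  intro n hn x hx
  have hx0 : (1:ℝ)/4 < x := hx
  have : ContDiffAt ℝ n (fun x ↦ x ^ (-(1/2) : ℝ)) x :=
    Real.contDiffAt_rpow_const <| Or.inl (lt_trans (by norm_num) hx).ne'
  rw [norm_iteratedFDerivWithin_eq_norm_iteratedDerivWithin,
    iteratedDerivWithin_eq_iteratedDeriv hunique this hx, iteratedDeriv_eq_iterate,
    Real.iter_deriv_rpow_const, norm_mul, pow_zero, mul_one]
  have hmem : n ∈ Finset.range (N + 1) := by grind
  refine le_trans ?_ (Finset.single_le_sum (f := fun k : ℕ => ‖Polynomial.eval (-(1/2) : ℝ) (descPochhammer ℝ k)‖ * (1/4) ^ (-(1/2) - (k:ℝ))) (fun _ _ ↦ by positivity) hmem)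
  refine mul_le_mul_of_nonneg_left ?_ (norm_nonneg _)
  rw [Real.norm_of_nonneg (by positivity)]
  exact Real.rpow_le_rpow_of_nonpos (by norm_num) hx0.le (by linarith [(Nat.cast_nonneg n : (0:ℝ) ≤ n)])

def chi (w : ℝ) : ℝ := Real.smoothTransition (2 * w + 1)

lemma chi_contDiff : ContDiff ℝ ∞ chi := by
  unfold chi
  exact Real.smoothTransition.contDiff.comp (by fun_prop)

lemma chi_one {w : ℝ} (h : 0 ≤ w) : chi w = 1 := Real.smoothTransition.one_of_one_le (by linarith)
lemma chi_zero {w : ℝ} (h : w ≤ -(1/2)) : chi w = 0 := Real.smoothTransition.zero_of_nonpos (by linarith)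

lemma htg_mul_chi {h : ℝ → ℝ} (hh : ContDiff ℝ ∞ h)
    (hb : ∀ n, ∃ (k : ℕ) (C : ℝ), ∀ x, 0 < x → ‖iteratedDeriv n h x‖ ≤ C * (1 + ‖x‖) ^ k) :
    (fun w => h w * chi w).HasTemperateGrowth := by
  have hc : ContDiff ℝ ∞ (fun w => h w * chi w) := hh.mul chi_contDiff
  refine htg1_half hc 0 (fun x hx => by simp [chi_zero (show x ≤ -(1/2) by linarith)]) fun n => ?_
  obtain ⟨k, C, hC⟩ := hb n
  have hcont : Continuous (iteratedDeriv n (fun w => h w * chi w)) := hc.continuous_iteratedDeriv n (mod_cast le_top)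
  refine ⟨k, C, fun x hx => ?_⟩
  have key : ∀ x, 0 < x → ‖iteratedDeriv n (fun w => h w * chi w) x‖ ≤ C * (1 + ‖x‖) ^ k := by
    intro x hx
    have he : (fun w => h w * chi w) =ᶠ[𝓝 x] h := by
      filter_upwards [Ioi_mem_nhds hx] with y hy
      rw [chi_one (le_of_lt hy), mul_one]
    rw [he.iteratedDeriv_eq n]
    exact hC x hx
  have : closure (Set.Ioi (0:ℝ)) ⊆ {x | ‖iteratedDeriv n (fun w => h w * chi w) x‖ ≤ C * (1 + ‖x‖) ^ k} :=
    closure_minimal (fun x hx => key x hx) (isClosed_le (by fun_prop) (by fun_prop))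
  rw [closure_Ioi] at this
  exact this hx

def kap (w : ℝ) : ℝ := 1 + w * chi w
lemma kap_htg : kap.HasTemperateGrowth := by
  have h1 : (fun w : ℝ => w * chi w).HasTemperateGrowth :=
    htg_mul_chi (h := fun w => w) contDiff_id fun n => by
      obtain ⟨k, C, h⟩ := htg1_bound (Function.HasTemperateGrowth.id' (E := ℝ)) n
      exact ⟨k, C, fun x _ => h x⟩
  exact (Function.HasTemperateGrowth.const (1:ℝ)).add h1
lemma kap_pos {w : ℝ} (h : 0 ≤ w) : kap w = 1 + w := by simp [kap, chi_one h]
lemma kap_ge (w : ℝ) : 1 / 2 ≤ kap w := by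
  have h0 : 0 ≤ chi w := Real.smoothTransition.nonneg _
  have h1 : chi w ≤ 1 := Real.smoothTransition.le_one _
  rcases le_or_gt w (-(1/2)) with h | h
  · simp [kap, chi_zero h]; norm_num
  · rcases le_or_gt 0 w with h' | h'
    · rw [kap_pos h']; linarith
    · unfold kap; nlinarith

def pp (w : ℝ) : ℝ := (kap w) ^ (-(1/2) : ℝ)
lemma pp_htg : pp.HasTemperateGrowth := htg_rpow kap_htg kap_ge
lemma pp_pos (w : ℝ) : 0 < pp w := Real.rpow_pos_of_pos (lt_of_lt_of_le (by norm_num) (kap_ge w)) _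
lemma pp_sq (w : ℝ) : pp w ^ 2 * kap w = 1 := by
  have h : 0 < kap w := lt_of_lt_of_le (by norm_num) (kap_ge w)
  rw [pp, ← Real.rpow_natCast, ← Real.rpow_mul h.le]
  norm_num
  rw [Real.rpow_neg_one]
  field_simp
def mm (w : ℝ) : ℝ := pp w ^ 2
lemma mm_htg : mm.HasTemperateGrowth := pp_htg.pow 2
lemma mm_kap (w : ℝ) : mm w * kap w = 1 := pp_sq w

/-! The averaging operator. -/
def Aop (k : ℕ) (h : ℝ → ℝ) (w : ℝ) : ℝ := ∫ s in (0:ℝ)..1, s ^ k * h (w * s ^ 2)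

lemma Aop_bound {k : ℕ} {h : ℝ → ℝ} {w M : ℝ} (hM : ∀ s ∈ Set.Icc (0:ℝ) 1, |h (w * s ^ 2)| ≤ M) : |Aop k h w| ≤ M := by
  have := intervalIntegral.norm_integral_le_of_norm_le_const (a := 0) (b := 1) (C := M)
    (f := fun s : ℝ => s ^ k * h (w * s ^ 2)) (fun s hs => by
      rw [Set.uIoc_of_le zero_le_one] at hs
      rw [norm_mul, Real.norm_eq_abs, Real.norm_eq_abs]
      have h1 : |s ^ k| ≤ 1 := by rw [abs_of_nonneg (pow_nonneg hs.1.le _)]; exact pow_le_one₀ hs.1.le hs.2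
      have h2 := hM s ⟨hs.1.le, hs.2⟩
      have h3 := abs_nonneg (h (w * s ^ 2))
      calc _ ≤ 1 * |h (w * s ^ 2)| := by gcongr
        _ ≤ M := by linarith)
  simpa [Aop] using this

lemma Aop_continuous {k : ℕ} {h : ℝ → ℝ} (hh : Continuous h) : Continuous (Aop k h) := by
  unfold Aop
  exact intervalIntegral.continuous_parametric_intervalIntegral_of_continuous' (by fun_prop) 0 1

lemma Aop_hasDerivAt {k : ℕ} {h : ℝ → ℝ} (hh : ContDiff ℝ 1 h) (w : ℝ) :
    HasDerivAt (Aop k h) (Aop (k + 2) (deriv h) w) w := by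
  have hc : Continuous (deriv h) := hh.continuous_deriv le_rfl
  have hd : Differentiable ℝ h := hh.differentiable one_ne_zero
  obtain ⟨M, hM⟩ := (isCompact_Icc (a := (-(|w|+1):ℝ)) (b := |w|+1)).exists_bound_of_continuousOn hc.continuousOn
  refine (intervalIntegral.hasDerivAt_integral_of_dominated_loc_of_deriv_le (μ := volume) (a := 0) (b := 1)
    (F := fun w s => s ^ k * h (w * s ^ 2)) (F' := fun w s => s ^ (k + 2) * deriv h (w * s ^ 2)) (x₀ := w)
    (s := Metric.ball w 1) (bound := fun _ => M) (Metric.ball_mem_nhds w one_pos) ?_ ?_ ?_ ?_ ?_ ?_).2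
  · exact Filter.Eventually.of_forall fun x => (by fun_prop : Continuous fun s : ℝ => s ^ k * h (x * s ^ 2)).aestronglyMeasurable
  · exact (by fun_prop : Continuous fun s : ℝ => s ^ k * h (w * s ^ 2)).intervalIntegrable _ _
  · exact (by fun_prop : Continuous fun s : ℝ => s ^ (k + 2) * deriv h (w * s ^ 2)).aestronglyMeasurable
  · refine Filter.Eventually.of_forall fun s hs x hx => ?_
    rw [Set.uIoc_of_le zero_le_one] at hs
    rw [Metric.mem_ball, Real.dist_eq] at hx
    have hs2 : s ^ 2 ≤ 1 := pow_le_one₀ hs.1.le hs.2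
    have hx1 : |x * s ^ 2| ≤ |w| + 1 := by
      rw [abs_mul, abs_of_nonneg (sq_nonneg s)]
      have : |x| ≤ |w| + 1 := by
        have := abs_sub_abs_le_abs_sub x w
        linarith
      have := abs_nonneg x
      have := sq_nonneg s
      nlinarith
    have h2 := hM (x * s ^ 2) ⟨by linarith [neg_abs_le (x * s ^ 2)], by linarith [le_abs_self (x * s ^ 2)]⟩
    rw [norm_mul]
    have h1 : ‖s ^ (k+2)‖ ≤ 1 := by
      rw [Real.norm_of_nonneg (pow_nonneg hs.1.le _)]; exact pow_le_one₀ hs.1.le hs.2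
    calc _ ≤ 1 * ‖deriv h (x * s ^ 2)‖ := by gcongr
      _ ≤ M := by linarith
  · exact intervalIntegrable_const
  · refine Filter.Eventually.of_forall fun s hs x hx => ?_
    have h1 : HasDerivAt (fun x : ℝ => x * s ^ 2) (1 * s ^ 2) x := (hasDerivAt_id x).mul_const _
    have := (((hd (x * s ^ 2)).hasDerivAt).comp x h1).const_mul (s ^ k)
    refine this.congr_deriv ?_; ring

lemma Aop_contDiff (n : ℕ) : ∀ {k : ℕ} {h : ℝ → ℝ}, ContDiff ℝ n h → ContDiff ℝ n (Aop k h) := by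
  induction n with
  | zero => intro k h hh; exact contDiff_zero.2 (Aop_continuous hh.continuous)
  | succ n ih =>
    intro k h hh
    have h1 : ContDiff ℝ 1 h := hh.of_le (by norm_cast; omega)
    refine (contDiff_succ_iff_deriv (n := n)).2 ⟨fun w => (Aop_hasDerivAt h1 w).differentiableAt, by simp, ?_⟩
    have : deriv (Aop k h) = Aop (k + 2) (deriv h) := funext fun w => (Aop_hasDerivAt h1 w).deriv
    rw [this]
    exact ih ((contDiff_succ_iff_deriv (n := n)).1 hh).2.2

lemma Aop_iteratedDeriv {k : ℕ} {h : ℝ → ℝ} (hh : ContDiff ℝ ∞ h) (n : ℕ) :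
    iteratedDeriv n (Aop k h) = Aop (k + 2 * n) (iteratedDeriv n h) := by
  induction n with
  | zero => simp
  | succ n ih =>
    rw [iteratedDeriv_succ, ih, iteratedDeriv_succ]
    have h1 : ContDiff ℝ 1 (iteratedDeriv n h) := by
      rw [iteratedDeriv_eq_iterate]
      exact ContDiff.iterate_deriv' 1 n (hh.of_le (mod_cast le_top))
    exact funext fun w => (Aop_hasDerivAt h1 w).deriv

lemma Aop_htg {k : ℕ} {h : ℝ → ℝ} (hh : h.HasTemperateGrowth) : (Aop k h).HasTemperateGrowth := by
  refine htg1 (contDiff_infty.2 fun n => Aop_contDiff n (hh.1.of_le (mod_cast le_top))) fun n => ?_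
  obtain ⟨j, C, hC⟩ := htg1_bound hh n
  refine ⟨j, C, fun x => ?_⟩
  rw [Aop_iteratedDeriv hh.1]
  have hC0 : 0 ≤ C := by
    have := (norm_nonneg _).trans (hC 0)
    simpa using this
  refine Aop_bound fun s hs => (hC _).trans ?_
  gcongr
  rw [norm_mul, norm_pow]
  have : ‖s‖ ^ 2 ≤ 1 := pow_le_one₀ (norm_nonneg _) (by rw [Real.norm_of_nonneg hs.1]; exact hs.2)
  nlinarith [norm_nonneg x]

/-! cos of the square root -/
def CC (z : ℝ) : ℝ := if 0 ≤ z then Real.cos (Real.sqrt z) else Real.cosh (Real.sqrt (-z))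

lemma CC_cont : Continuous CC := by
  unfold CC
  refine Continuous.if_le (by fun_prop) (by fun_prop) continuous_const continuous_id ?_
  intro x hx
  have hx' : x = 0 := hx.symm
  subst hx'; simp

lemma CC_sq {x : ℝ} (hx : 0 ≤ x) : CC (x ^ 2) = Real.cos x := by
  simp [CC, sq_nonneg, Real.sqrt_sq hx]
lemma CC_neg_sq {x : ℝ} (hx : 0 ≤ x) : CC (- x ^ 2) = Real.cosh x := by
  rcases hx.eq_or_lt with rfl | h
  · simp [CC]
  · have : ¬ (0 ≤ - x ^ 2) := by have := pow_pos h 2; linarith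
    simp only [CC, this, if_false, neg_neg, Real.sqrt_sq hx]

lemma CC_hasDerivAt (z : ℝ) : HasDerivAt CC (-(1/2) * Aop 0 CC z) z := by
  have hc : Continuous (fun z => -(1/2) * Aop 0 CC z) := continuous_const.mul (Aop_continuous CC_cont)
  have key : ∀ y ≠ (0:ℝ), HasDerivAt CC (-(1/2) * Aop 0 CC y) y := by
    intro y hy
    rcases lt_or_gt_of_ne hy with h | h
    · set a := Real.sqrt (-y)
      have ha : 0 < a := Real.sqrt_pos.2 (by linarith)
      have hay : y = - a ^ 2 := by rw [Real.sq_sqrt (by linarith)]; ring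
      have e1 : Aop 0 CC y = Real.sinh a / a := by
        unfold Aop
        have : ∫ s in (0:ℝ)..1, s ^ 0 * CC (y * s ^ 2) = ∫ s in (0:ℝ)..1, Real.cosh (a * s) := by
          refine intervalIntegral.integral_congr fun s hs => ?_
          rw [Set.uIcc_of_le zero_le_one] at hs
          have : y * s ^ 2 = - (a * s) ^ 2 := by rw [hay]; ring
          simp only [this, CC_neg_sq (mul_nonneg ha.le hs.1), pow_zero, one_mul]
        rw [this]
        have hd : ∀ s ∈ Set.uIcc (0:ℝ) 1, HasDerivAt (fun s => Real.sinh (a * s) / a) (Real.cosh (a * s)) s := by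
          intro s _
          have h1 : HasDerivAt (fun s : ℝ => a * s) (a * 1) s := (hasDerivAt_id s).const_mul a
          refine ((h1.sinh).div_const a).congr_deriv ?_
          field_simp
        rw [intervalIntegral.integral_eq_sub_of_hasDerivAt hd ((by fun_prop : Continuous fun s => Real.cosh (a * s)).intervalIntegrable _ _)]
        simp
      have he : CC =ᶠ[𝓝 y] fun z => Real.cosh (Real.sqrt (-z)) := by
        filter_upwards [Iio_mem_nhds h] with z hz
        simp [CC, not_le.2 (Set.mem_Iio.1 hz)]
      refine HasDerivAt.congr_of_eventuallyEq ?_ he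
      have h2 := (((hasDerivAt_id y).neg).sqrt (by simpa using hy)).cosh
      refine h2.congr_deriv ?_
      rw [e1]
      change Real.sinh a * (-1 / (2 * a)) = _
      field_simp
    · set a := Real.sqrt y
      have ha : 0 < a := Real.sqrt_pos.2 h
      have hay : y = a ^ 2 := by rw [Real.sq_sqrt h.le]
      have e1 : Aop 0 CC y = Real.sin a / a := by
        unfold Aop
        have : ∫ s in (0:ℝ)..1, s ^ 0 * CC (y * s ^ 2) = ∫ s in (0:ℝ)..1, Real.cos (a * s) := by
          refine intervalIntegral.integral_congr fun s hs => ?_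
          rw [Set.uIcc_of_le zero_le_one] at hs
          have : y * s ^ 2 = (a * s) ^ 2 := by rw [hay]; ring
          simp only [this, CC_sq (mul_nonneg ha.le hs.1), pow_zero, one_mul]
        rw [this]
        have hd : ∀ s ∈ Set.uIcc (0:ℝ) 1, HasDerivAt (fun s => Real.sin (a * s) / a) (Real.cos (a * s)) s := by
          intro s _
          have h1 : HasDerivAt (fun s : ℝ => a * s) (a * 1) s := (hasDerivAt_id s).const_mul a
          refine ((h1.sin).div_const a).congr_deriv ?_
          field_simp
        rw [intervalIntegral.integral_eq_sub_of_hasDerivAt hd ((by fun_prop : Continuous fun s => Real.cos (a * s)).intervalIntegrable _ _)]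
        simp
      have he : CC =ᶠ[𝓝 y] fun z => Real.cos (Real.sqrt z) := by
        filter_upwards [Ioi_mem_nhds h] with z hz
        simp [CC, le_of_lt (Set.mem_Ioi.1 hz)]
      refine HasDerivAt.congr_of_eventuallyEq ?_ he
      have h2 := ((hasDerivAt_id y).sqrt (by simpa using hy)).cos
      refine h2.congr_deriv ?_
      rw [e1]
      change -Real.sin a * (1 / (2 * a)) = _
      field_simp
  rcases eq_or_ne z 0 with rfl | hz
  · exact hasDerivAt_of_hasDerivAt_of_ne key CC_cont.continuousAt hc.continuousAt
  · exact key z hz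

lemma CC_contDiff : ContDiff ℝ ∞ CC := by
  refine contDiff_infty.2 fun n => ?_
  induction n with
  | zero => exact contDiff_zero.2 CC_cont
  | succ n ih =>
    refine (contDiff_succ_iff_deriv (n := n)).2 ⟨fun w => (CC_hasDerivAt w).differentiableAt, by simp, ?_⟩
    have : deriv CC = fun z => -(1/2) * Aop 0 CC z := funext fun w => (CC_hasDerivAt w).deriv
    rw [this]
    exact contDiff_const.mul (Aop_contDiff n ih)

lemma CC_bound (n : ℕ) : ∀ x, 0 ≤ x → |iteratedDeriv n CC x| ≤ 1 := by
  induction n with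
  | zero => 
    intro x hx
    simp [CC, hx, Real.abs_cos_le_one]
  | succ n ih =>
    intro x hx
    have : deriv CC = fun z => -(1/2) * Aop 0 CC z := funext fun w => (CC_hasDerivAt w).deriv
    rw [iteratedDeriv_succ', this]
    have h2 : iteratedDeriv n (fun z => -(1/2) * Aop 0 CC z) x = -(1/2) * iteratedDeriv n (Aop 0 CC) x :=
      by
      rw [iteratedDeriv_const_mul_field]
    rw [h2, Aop_iteratedDeriv CC_contDiff, abs_mul]
    have := Aop_bound (k := 0 + 2 * n) (h := iteratedDeriv n CC) (w := x) (M := 1) fun s hs => ih _ (by positivity)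
    rw [abs_neg, abs_of_pos (by norm_num : (0:ℝ) < 1/2)]
    linarith [abs_nonneg (Aop (0 + 2 * n) (iteratedDeriv n CC) x)]

def cc (z : ℝ) : ℝ := CC z * chi z
lemma cc_htg : cc.HasTemperateGrowth :=
  htg_mul_chi CC_contDiff fun n => ⟨0, 1, fun x hx => by simpa using CC_bound n x hx.le⟩
lemma cc_sq (x : ℝ) : cc (x ^ 2) = Real.cos x := by
  rw [cc, chi_one (sq_nonneg x), mul_one, ← sq_abs, CC_sq (abs_nonneg x), Real.cos_abs]

def bmp : ContDiffBump (0:ℝ) := ⟨4, 5, by norm_num, by norm_num⟩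
def ce (z : ℝ) : ℝ := bmp z * Real.exp (-z)
lemma ce_htg : ce.HasTemperateGrowth := by
  refine HasCompactSupport.hasTemperateGrowth ?_ (bmp.contDiff.mul (by fun_prop))
  exact bmp.hasCompactSupport.mul_right
lemma ce_eq {z : ℝ} (h : |z| ≤ Real.pi) : ce z = Real.exp (-z) := by
  rw [ce, bmp.one_of_mem_closedBall, one_mul]
  rw [mem_closedBall_zero_iff, Real.norm_eq_abs]
  exact h.trans Real.pi_le_four

lemma meas_entry (i j : Fin 3) : Measurable (fun k : Mat3 => k i j) :=
  (measurable_pi_apply j).comp (measurable_pi_apply (X := fun _ : Fin 3 => Fin 3 → ℝ) i)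

lemma meas_mv (x : V3) (j : Fin 3) : Measurable (fun k : Mat3 => (k.mulVec x) j) := by
  simp only [Matrix.mulVec, dotProduct]
  exact Finset.measurable_sum _ fun i _ => (meas_entry j i).mul_const _

lemma SO3_ae {μ : Measure Mat3} (hμ : IsHaarSO3 μ) : ∀ᵐ k ∂μ, k ∈ SO3 := hμ.2.1

lemma SO3_entry {k : Mat3} (hk : k ∈ SO3) (i j : Fin 3) : |k i j| ≤ 1 := by
  have h := congrFun (congrFun hk.1 i) i
  rw [Matrix.mul_apply, Matrix.one_apply_eq] at h
  simp only [Matrix.transpose_apply] at h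
  have h2 : k i j * k i j ≤ ∑ l, k i l * k i l :=
    Finset.single_le_sum (f := fun l => k i l * k i l) (fun l _ => mul_self_nonneg _) (Finset.mem_univ j)
  rw [h] at h2
  exact abs_le_one_iff_mul_self_le_one.2 h2

def b3 (x : V3) : ℝ := |x 0| + |x 1| + |x 2|
lemma b3_nonneg (x : V3) : 0 ≤ b3 x := by unfold b3; positivity

lemma SO3_mv {k : Mat3} (hk : k ∈ SO3) (x : V3) (j : Fin 3) : |(k.mulVec x) j| ≤ b3 x := by
  simp only [Matrix.mulVec, dotProduct, Fin.sum_univ_three]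
  refine (abs_add_three _ _ _).trans ?_
  simp only [abs_mul]
  unfold b3
  have h := SO3_entry hk j
  have := mul_le_mul_of_nonneg_right (h 0) (abs_nonneg (x 0))
  have := mul_le_mul_of_nonneg_right (h 1) (abs_nonneg (x 1))
  have := mul_le_mul_of_nonneg_right (h 2) (abs_nonneg (x 2))
  linarith

def R01 (a : ℝ) : Mat3 := !![Real.cos a, -Real.sin a, 0; Real.sin a, Real.cos a, 0; 0, 0, 1]
def R12 (a : ℝ) : Mat3 := !![1, 0, 0; 0, Real.cos a, -Real.sin a; 0, Real.sin a, Real.cos a]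

lemma R01_mem (a : ℝ) : R01 a ∈ SO3 := by
  have h := Real.sin_sq_add_cos_sq a
  constructor
  · ext i j
    fin_cases i <;> fin_cases j <;> simp [R01, Matrix.mul_apply, Fin.sum_univ_three] <;> nlinarith
  · simp [R01, Matrix.det_fin_three]; nlinarith

lemma R12_mem (a : ℝ) : R12 a ∈ SO3 := by
  have h := Real.sin_sq_add_cos_sq a
  constructor
  · ext i j
    fin_cases i <;> fin_cases j <;> simp [R12, Matrix.mul_apply, Fin.sum_univ_three] <;> nlinarith
  · simp [R12, Matrix.det_fin_three]; nlinarith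

lemma haar_inv {μ : Measure Mat3} (hμ : IsHaarSO3 μ) {R : Mat3} (hR : R ∈ SO3) {f : Mat3 → ℂ} (hf : Measurable f) :
    ∫ k, f (R * k) ∂μ = ∫ k, f k ∂μ := by
  have hm : Measurable (fun A : Mat3 => R * A) := by
    refine measurable_pi_lambda _ fun i => measurable_pi_lambda _ fun j => ?_
    simp only [Matrix.mul_apply]
    exact Finset.measurable_sum _ fun l _ => (meas_entry l j).const_mul _
  conv_rhs => rw [← hμ.2.2 R hR]
  rw [integral_map hm.aemeasurable hf.aestronglyMeasurable]

lemma entire_int {μ : Measure Mat3} [IsFiniteMeasure μ] {P Q S : Mat3 → ℂ} (hP : Measurable P) (hQ : Measurable Q)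
    (hS : Measurable S) {M : ℝ} (hM : 0 ≤ M) (bP : ∀ᵐ k ∂μ, ‖P k‖ ≤ M) (bQ : ∀ᵐ k ∂μ, ‖Q k‖ ≤ M) (bS : ∀ᵐ k ∂μ, ‖S k‖ ≤ M) :
    Differentiable ℂ (fun a : ℂ => ∫ k, cexp (P k * cos a + Q k * sin a + S k) ∂μ) := by
  intro a
  obtain ⟨K1, hK1⟩ := (isCompact_closedBall a 1).exists_bound_of_continuousOn Complex.continuous_cos.continuousOn
  obtain ⟨K2, hK2⟩ := (isCompact_closedBall a 1).exists_bound_of_continuousOn Complex.continuous_sin.continuousOn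
  have h10 : 0 ≤ K1 := (norm_nonneg _).trans (hK1 a (by simp))
  have h20 : 0 ≤ K2 := (norm_nonneg _).trans (hK2 a (by simp))
  have hb : ∀ x ∈ Metric.closedBall a 1, ∀ k, ‖P k‖ ≤ M → ‖Q k‖ ≤ M → ‖S k‖ ≤ M →
      ‖cexp (P k * cos x + Q k * sin x + S k)‖ ≤ Real.exp (M * K1 + M * K2 + M) := by
    intro x hx k h1 h2 h3
    refine (Complex.norm_exp_le_exp_norm _).trans (Real.exp_le_exp.2 ?_)
    refine (norm_add₃_le).trans ?_
    rw [norm_mul, norm_mul]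
    have := hK1 x hx
    have := hK2 x hx
    gcongr
  have hmeas : ∀ x, AEStronglyMeasurable (fun k => cexp (P k * cos x + Q k * sin x + S k)) μ := fun x =>
    (Complex.measurable_exp.comp (((hP.mul_const _).add (hQ.mul_const _)).add hS)).aestronglyMeasurable
  refine (hasDerivAt_integral_of_dominated_loc_of_deriv_le (μ := μ) (x₀ := a) (s := Metric.ball a 1)
    (F' := fun x k => cexp (P k * cos x + Q k * sin x + S k) * (P k * (-sin x) + Q k * cos x))
    (bound := fun _ => Real.exp (M * K1 + M * K2 + M) * (M * K2 + M * K1))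
    (Metric.ball_mem_nhds a one_pos) ?_ ?_ ?_ ?_ ?_ ?_).2.differentiableAt
  · exact Filter.Eventually.of_forall hmeas
  · refine Integrable.of_bound (hmeas a) (Real.exp (M * K1 + M * K2 + M)) ?_
    filter_upwards [bP, bQ, bS] with k h1 h2 h3 using hb a (by simp) k h1 h2 h3
  · exact ((hmeas a).mul ((hP.mul_const _).add (hQ.mul_const _)).aestronglyMeasurable)
  · filter_upwards [bP, bQ, bS] with k h1 h2 h3 x hx
    have hx' := Metric.ball_subset_closedBall hx
    rw [norm_mul]
    refine mul_le_mul (hb x hx' k h1 h2 h3) ?_ (norm_nonneg _) (Real.exp_pos _).le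
    refine (norm_add_le _ _).trans ?_
    rw [norm_mul, norm_mul, norm_neg]
    have := hK1 x hx'
    have := hK2 x hx'
    gcongr
  · exact integrable_const _
  · refine Filter.Eventually.of_forall fun k x hx => ?_
    exact ((((Complex.hasDerivAt_cos x).const_mul (P k)).add ((Complex.hasDerivAt_sin x).const_mul (Q k))).add_const (S k)).cexp

lemma entire_const {f : ℂ → ℂ} (hf : Differentiable ℂ f) (h : ∀ a : ℝ, f a = f 0) (a : ℂ) : f a = f 0 := by
  have h1 : AnalyticOnNhd ℂ f Set.univ := fun z _ => hf.analyticAt z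
  have h2 : AnalyticOnNhd ℂ (fun _ : ℂ => f 0) Set.univ := fun z _ => analyticAt_const
  refine congrFun (h1.eq_of_frequently_eq h2 (z₀ := 0) ?_) a
  have ht : Filter.Tendsto (fun n : ℕ => (((1:ℝ) / ((n:ℝ) + 1) : ℝ) : ℂ)) Filter.atTop (𝓝[≠] 0) := by
    refine tendsto_nhdsWithin_iff.2 ⟨?_, Filter.Eventually.of_forall fun n => ?_⟩
    · have := (Complex.continuous_ofReal.tendsto 0).comp (tendsto_one_div_add_atTop_nhds_zero_nat (𝕜 := ℝ))
      simpa [Function.comp_def] using this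
    · have : (1:ℝ) / ((n:ℝ) + 1) ≠ 0 := by positivity
      exact Complex.ofReal_ne_zero.2 this
  exact ht.frequently (Filter.Frequently.of_forall fun n => h _)

lemma exists_angle {c s : ℂ} (h : c ^ 2 + s ^ 2 = 1) : ∃ a, cos a = c ∧ sin a = s := by
  obtain ⟨a, ha⟩ := Complex.cos_surjective c
  have h1 : sin a ^ 2 = s ^ 2 := by
    have := Complex.sin_sq_add_cos_sq a
    rw [ha] at this
    linear_combination this - h
  rcases sq_eq_sq_iff_eq_or_eq_neg.1 h1 with h2 | h2
  · exact ⟨a, ha, h2⟩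
  · exact ⟨-a, by rw [cos_neg, ha], by rw [sin_neg, h2, neg_neg]⟩

def gI (μ : Measure Mat3) (x y : V3) (a1 a2 a3 b1 b2 b3 : ℂ) : ℂ :=
  ∫ k : Mat3, cexp (2 * Real.pi * I * (a1 * (k.mulVec x 0 : ℝ) + a2 * (k.mulVec x 1 : ℝ) + a3 * (k.mulVec x 2 : ℝ) +
    (b1 * (k.mulVec y 0 : ℝ) + b2 * (k.mulVec y 1 : ℝ) + b3 * (k.mulVec y 2 : ℝ)))) ∂μ

lemma meas_lin (x y : V3) (a1 a2 a3 b1 b2 b3 : ℂ) : Measurable fun k : Mat3 => 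
    2 * Real.pi * I * (a1 * (k.mulVec x 0 : ℝ) + a2 * (k.mulVec x 1 : ℝ) + a3 * (k.mulVec x 2 : ℝ) +
    (b1 * (k.mulVec y 0 : ℝ) + b2 * (k.mulVec y 1 : ℝ) + b3 * (k.mulVec y 2 : ℝ))) := by
  have := fun x j => (Complex.measurable_ofReal.comp (meas_mv x j))
  refine Measurable.const_mul ?_ _
  exact ((((this x 0).const_mul _).add ((this x 1).const_mul _)).add ((this x 2).const_mul _)).add
    ((((this y 0).const_mul _).add ((this y 1).const_mul _)).add ((this y 2).const_mul _))

lemma bdd_lin (x y : V3) (a1 a2 a3 b1 b2 b3' : ℂ) : ∃ M : ℝ, 0 ≤ M ∧ ∀ k ∈ SO3, 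
    ‖2 * Real.pi * I * (a1 * (k.mulVec x 0 : ℝ) + a2 * (k.mulVec x 1 : ℝ) + a3 * (k.mulVec x 2 : ℝ) +
    (b1 * (k.mulVec y 0 : ℝ) + b2 * (k.mulVec y 1 : ℝ) + b3' * (k.mulVec y 2 : ℝ)))‖ ≤ M := by
  have hx := b3_nonneg x
  have hy := b3_nonneg y
  refine ⟨‖2 * Real.pi * I‖ * (‖a1‖ * b3 x + ‖a2‖ * b3 x + ‖a3‖ * b3 x + (‖b1‖ * b3 y + ‖b2‖ * b3 y + ‖b3'‖ * b3 y)), by positivity, fun k hk => ?_⟩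
  rw [norm_mul]
  have h : ∀ x j, ‖(((k.mulVec x) j : ℝ) : ℂ)‖ ≤ b3 x := fun x j => by
    rw [Complex.norm_real]; exact SO3_mv hk x j
  refine mul_le_mul_of_nonneg_left ?_ (norm_nonneg _)
  refine (norm_add_le _ _).trans (add_le_add ((norm_add₃_le).trans ?_) ((norm_add₃_le).trans ?_)) <;>
  · simp only [norm_mul]
    gcongr <;> exact h _ _

lemma gI_integrable {μ : Measure Mat3} (hμ : IsHaarSO3 μ) (x y : V3) (a1 a2 a3 b1 b2 b3 : ℂ) :
    Integrable (fun k : Mat3 => cexp (2 * Real.pi * I * (a1 * (k.mulVec x 0 : ℝ) + a2 * (k.mulVec x 1 : ℝ) + a3 * (k.mulVec x 2 : ℝ) +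
    (b1 * (k.mulVec y 0 : ℝ) + b2 * (k.mulVec y 1 : ℝ) + b3 * (k.mulVec y 2 : ℝ))))) μ := by
  have := hμ.1
  obtain ⟨M, hM, h⟩ := bdd_lin x y a1 a2 a3 b1 b2 b3
  refine Integrable.of_bound (Complex.measurable_exp.comp (meas_lin x y a1 a2 a3 b1 b2 b3)).aestronglyMeasurable (Real.exp M) ?_
  filter_upwards [SO3_ae hμ] with k hk
  exact (Complex.norm_exp_le_exp_norm _).trans (Real.exp_le_exp.2 (h k hk))

lemma gI_rot {μ : Measure Mat3} (hμ : IsHaarSO3 μ) (x y : V3) (a1 a2 a3 b1 b2 b3 : ℂ)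
    (p1 p2 p3 p4 p5 p6 q1 q2 q3 q4 q5 q6 s1 s2 s3 s4 s5 s6 : ℂ)
    (h0 : p1 + s1 = a1 ∧ p2 + s2 = a2 ∧ p3 + s3 = a3 ∧ p4 + s4 = b1 ∧ p5 + s5 = b2 ∧ p6 + s6 = b3)
    (h : ∀ a : ℝ, gI μ x y (p1 * cos a + q1 * sin a + s1) (p2 * cos a + q2 * sin a + s2) (p3 * cos a + q3 * sin a + s3) 
      (p4 * cos a + q4 * sin a + s4) (p5 * cos a + q5 * sin a + s5) (p6 * cos a + q6 * sin a + s6) = gI μ x y a1 a2 a3 b1 b2 b3)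
    {c s : ℂ} (hcs : c ^ 2 + s ^ 2 = 1) :
    gI μ x y (p1 * c + q1 * s + s1) (p2 * c + q2 * s + s2) (p3 * c + q3 * s + s3) 
      (p4 * c + q4 * s + s4) (p5 * c + q5 * s + s5) (p6 * c + q6 * s + s6) = gI μ x y a1 a2 a3 b1 b2 b3 := by
  have := hμ.1
  obtain ⟨a, rfl, rfl⟩ := exists_angle hcs
  obtain ⟨M1, hM1, H1⟩ := bdd_lin x y p1 p2 p3 p4 p5 p6
  obtain ⟨M2, hM2, H2⟩ := bdd_lin x y q1 q2 q3 q4 q5 q6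
  obtain ⟨M3, hM3, H3⟩ := bdd_lin x y s1 s2 s3 s4 s5 s6
  have hd := entire_int (μ := μ) (meas_lin x y p1 p2 p3 p4 p5 p6) (meas_lin x y q1 q2 q3 q4 q5 q6) (meas_lin x y s1 s2 s3 s4 s5 s6)
    (M := M1 + M2 + M3) (by positivity)
    (by filter_upwards [SO3_ae hμ] with k hk using (H1 k hk).trans (by linarith))
    (by filter_upwards [SO3_ae hμ] with k hk using (H2 k hk).trans (by linarith))
    (by filter_upwards [SO3_ae hμ] with k hk using (H3 k hk).trans (by linarith))
  have he : ∀ a : ℂ, (∫ k : Mat3, cexp ((2 * Real.pi * I * (p1 * (k.mulVec x 0 : ℝ) + p2 * (k.mulVec x 1 : ℝ) + p3 * (k.mulVec x 2 : ℝ) +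
    (p4 * (k.mulVec y 0 : ℝ) + p5 * (k.mulVec y 1 : ℝ) + p6 * (k.mulVec y 2 : ℝ)))) * cos a + (2 * Real.pi * I * (q1 * (k.mulVec x 0 : ℝ) + q2 * (k.mulVec x 1 : ℝ) + q3 * (k.mulVec x 2 : ℝ) +
    (q4 * (k.mulVec y 0 : ℝ) + q5 * (k.mulVec y 1 : ℝ) + q6 * (k.mulVec y 2 : ℝ)))) * sin a + (2 * Real.pi * I * (s1 * (k.mulVec x 0 : ℝ) + s2 * (k.mulVec x 1 : ℝ) + s3 * (k.mulVec x 2 : ℝ) +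
    (s4 * (k.mulVec y 0 : ℝ) + s5 * (k.mulVec y 1 : ℝ) + s6 * (k.mulVec y 2 : ℝ))))) ∂μ) = gI μ x y (p1 * cos a + q1 * sin a + s1) (p2 * cos a + q2 * sin a + s2) (p3 * cos a + q3 * sin a + s3) 
      (p4 * cos a + q4 * sin a + s4) (p5 * cos a + q5 * sin a + s5) (p6 * cos a + q6 * sin a + s6) := by
    intro a
    unfold gI
    congr 1; ext k; congr 1; ring
  simp only [he] at hd
  have hz : gI μ x y a1 a2 a3 b1 b2 b3 = gI μ x y (p1 * cos 0 + q1 * sin 0 + s1) (p2 * cos 0 + q2 * sin 0 + s2) (p3 * cos 0 + q3 * sin 0 + s3) 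
      (p4 * cos 0 + q4 * sin 0 + s4) (p5 * cos 0 + q5 * sin 0 + s5) (p6 * cos 0 + q6 * sin 0 + s6) := by
    simp [h0]
  rw [hz]
  exact entire_const hd (fun a => by rw [h a, hz]) a

lemma gI_rot01 {μ : Measure Mat3} (hμ : IsHaarSO3 μ) (x y : V3) (a1 a2 a3 b1 b2 b3 : ℂ) {c s : ℂ} (hcs : c ^ 2 + s ^ 2 = 1) :
    gI μ x y (c * a1 + s * a2) (-s * a1 + c * a2) a3 (c * b1 + s * b2) (-s * b1 + c * b2) b3 = gI μ x y a1 a2 a3 b1 b2 b3 := by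
  have := gI_rot hμ x y a1 a2 a3 b1 b2 b3 a1 a2 0 b1 b2 0 a2 (-a1) 0 b2 (-b1) 0 0 0 a3 0 0 b3 (by simp) (fun a => ?_) hcs
  · rw [← this]; congr 1 <;> ring
  · unfold gI
    refine Eq.trans ?_ (haar_inv hμ (R01_mem a) (Complex.measurable_exp.comp (meas_lin x y a1 a2 a3 b1 b2 b3)))
    congr 1; ext k
    simp only [Function.comp, ← Matrix.mulVec_mulVec]
    congr 1
    simp [R01, Matrix.mulVec, dotProduct, Fin.sum_univ_three]
    ring

lemma gI_rot12 {μ : Measure Mat3} (hμ : IsHaarSO3 μ) (x y : V3) (a1 a2 a3 b1 b2 b3 : ℂ) {c s : ℂ} (hcs : c ^ 2 + s ^ 2 = 1) :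
    gI μ x y a1 (c * a2 + s * a3) (-s * a2 + c * a3) b1 (c * b2 + s * b3) (-s * b2 + c * b3) = gI μ x y a1 a2 a3 b1 b2 b3 := by
  have := gI_rot hμ x y a1 a2 a3 b1 b2 b3 0 a2 a3 0 b2 b3 0 a3 (-a2) 0 b3 (-b2) a1 0 0 b1 0 0 (by simp) (fun a => ?_) hcs
  · rw [← this]; congr 1 <;> ring
  · unfold gI
    refine Eq.trans ?_ (haar_inv hμ (R12_mem a) (Complex.measurable_exp.comp (meas_lin x y a1 a2 a3 b1 b2 b3)))
    congr 1; ext k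
    simp only [Function.comp, ← Matrix.mulVec_mulVec]
    congr 1
    simp [R12, Matrix.mulVec, dotProduct, Fin.sum_univ_three]
    ring

lemma gI_main {μ : Measure Mat3} (hμ : IsHaarSO3 μ) (x y : V3) {z1 z2 r lam ep q e : ℝ} (hl : 0 < lam) (hq : 0 < q)
    (hz : 0 < z1 ^ 2 + z2 ^ 2) (hq2 : q ^ 2 = lam ^ 2 + ep ^ 2) (he : e ^ 2 = z1 ^ 2 + z2 ^ 2 + r ^ 2 - (lam * r / q) ^ 2) :
    gI μ x y e 0 ((lam * r / q : ℝ)) 0 (I * ep) q = gI μ x y z1 z2 r 0 0 lam := by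
  have hlC : (lam : ℂ) ≠ 0 := by exact_mod_cast hl.ne'
  have hqC : (q : ℂ) ≠ 0 := by exact_mod_cast hq.ne'
  have hzC : (z1 : ℂ) ^ 2 + (z2 : ℂ) ^ 2 ≠ 0 := by exact_mod_cast hz.ne'
  have hq2C : (q : ℂ) ^ 2 = lam ^ 2 + ep ^ 2 := by exact_mod_cast hq2
  have heC : (e : ℂ) ^ 2 = z1 ^ 2 + z2 ^ 2 + r ^ 2 - (lam * r / q) ^ 2 := by exact_mod_cast he
  have hI := Complex.I_sq
  have h1 : ((q : ℂ) / lam) ^ 2 + (-(I * ep) / lam) ^ 2 = 1 := by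
    field_simp
    rw [hI]; linear_combination hq2C
  rw [← gI_rot12 hμ x y _ _ _ _ _ _ h1]
  set a2 : ℂ := -(I * ep * r / q) with ha2
  have ha : (e : ℂ) ^ 2 + a2 ^ 2 = z1 ^ 2 + z2 ^ 2 := by
    rw [heC, ha2]
    field_simp
    rw [hI]
    linear_combination (r:ℂ)^2 * hq2C
  have h2 : (((e : ℂ) * z1 + a2 * z2) / (z1 ^ 2 + z2 ^ 2)) ^ 2 + ((a2 * z1 - e * z2) / (z1 ^ 2 + z2 ^ 2)) ^ 2 = 1 := by
    field_simp
    linear_combination (((z1 : ℂ) ^ 2 + (z2 : ℂ) ^ 2)) * ha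
  have e1 : (q : ℂ) / lam * 0 + -(I * ep) / lam * ((lam * r / q : ℝ) : ℂ) = a2 := by
    rw [ha2]; push_cast; field_simp; ring
  have e2 : -(-(I * ep) / lam) * 0 + (q : ℂ) / lam * ((lam * r / q : ℝ) : ℂ) = r := by
    push_cast; field_simp; ring
  have e3 : (q : ℂ) / lam * (I * ep) + -(I * ep) / lam * q = 0 := by
    field_simp; ring
  have e4 : -(-(I * ep) / lam) * (I * ep) + (q : ℂ) / lam * q = lam := by
    field_simp; rw [hI]; linear_combination hq2C
  rw [e1, e2, e3, e4, ← gI_rot01 hμ x y _ _ _ _ _ _ h2]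
  have e5 : ((e : ℂ) * z1 + a2 * z2) / (z1 ^ 2 + z2 ^ 2) * e + ((a2 * z1 - e * z2) / (z1 ^ 2 + z2 ^ 2)) * a2 = z1 := by
    field_simp
    linear_combination (z1:ℂ) * ha
  have e6 : -((a2 * z1 - e * z2) / (z1 ^ 2 + z2 ^ 2)) * e + ((e : ℂ) * z1 + a2 * z2) / (z1 ^ 2 + z2 ^ 2) * a2 = z2 := by
    field_simp
    linear_combination (z2:ℂ) * ha
  rw [e5, e6]
  simp

/-- the averaged kernel identity -/
lemma kernel_avg {μ : Measure Mat3} (hμ : IsHaarSO3 μ) (x y : V3) {z1 z2 r lam ep q e : ℝ} (hl : 0 < lam) (hq : 0 < q)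
    (hz : 0 < z1 ^ 2 + z2 ^ 2) (hq2 : q ^ 2 = lam ^ 2 + ep ^ 2) (he : e ^ 2 = z1 ^ 2 + z2 ^ 2 + r ^ 2 - (lam * r / q) ^ 2) :
    ∫ k : Mat3, cexp (I * ((2 * Real.pi * (q * k.mulVec y 2 + lam * r / q * k.mulVec x 2) : ℝ))) * 
      (Real.exp (-(2 * Real.pi * ep * k.mulVec y 1)) : ℝ) * (Real.cos (2 * Real.pi * k.mulVec x 0 * e) : ℝ) ∂μ
      = gI μ x y z1 z2 r 0 0 lam := by
  have h1 := gI_main hμ x y hl hq hz hq2 he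
  have h2 := gI_main hμ x y hl hq hz hq2 (e := -e) (r := r) (by rw [neg_sq]; exact he)
  have : gI μ x y z1 z2 r 0 0 lam = (1/2) * (gI μ x y e 0 ((lam * r / q : ℝ)) 0 (I * ep) q + gI μ x y (-e : ℝ) 0 ((lam * r / q : ℝ)) 0 (I * ep) q) := by
    rw [h1, h2]; ring
  rw [this]
  unfold gI
  rw [← integral_add (gI_integrable hμ _ _ _ _ _ _ _ _) (gI_integrable hμ _ _ _ _ _ _ _ _), ← integral_const_mul]
  congr 1; ext k
  rw [Complex.ofReal_exp, Complex.ofReal_cos, Complex.cos]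
  have hI := Complex.I_sq
  set u := k.mulVec x
  set v := k.mulVec y
  have e1 : (2 * Real.pi * I * ((e:ℂ) * (u 0 : ℝ) + 0 * (u 1 : ℝ) + ((lam * r / q : ℝ) : ℂ) * (u 2 : ℝ) +
    (0 * (v 0 : ℝ) + I * ep * (v 1 : ℝ) + q * (v 2 : ℝ)))) = I * ((2 * Real.pi * (q * v 2 + lam * r / q * u 2) : ℝ))
      + ((-(2 * Real.pi * ep * v 1) : ℝ) : ℂ) + ((2 * Real.pi * u 0 * e : ℝ) : ℂ) * I := by
    push_cast; linear_combination (2 * (Real.pi : ℂ) * ep * v 1) * hI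
  have e2 : (2 * Real.pi * I * (((-e : ℝ):ℂ) * (u 0 : ℝ) + 0 * (u 1 : ℝ) + ((lam * r / q : ℝ) : ℂ) * (u 2 : ℝ) +
    (0 * (v 0 : ℝ) + I * ep * (v 1 : ℝ) + q * (v 2 : ℝ)))) = I * ((2 * Real.pi * (q * v 2 + lam * r / q * u 2) : ℝ))
      + ((-(2 * Real.pi * ep * v 1) : ℝ) : ℂ) + -((2 * Real.pi * u 0 * e : ℝ) : ℂ) * I := by
    push_cast; linear_combination (2 * (Real.pi : ℂ) * ep * v 1) * hI
  rw [e1, e2, Complex.exp_add, Complex.exp_add, Complex.exp_add, Complex.exp_add]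
  ring

section tens
variable {V W : Type} [NormedAddCommGroup V] [NormedSpace ℝ V] [NormedAddCommGroup W] [NormedSpace ℝ W]

lemma iter_comp_fst_le (L : V × W →L[ℝ] V) (hL : ‖L‖ ≤ 1) (A : 𝓢(V, ℂ)) (i : ℕ) (p : V × W) :
    ‖iteratedFDeriv ℝ i (fun p => A (L p)) p‖ ≤ ‖iteratedFDeriv ℝ i A (L p)‖ := by
  have := L.iteratedFDeriv_comp_right (f := A) (A.smooth ⊤) p (i := i) (mod_cast le_top)
  have h2 : (fun p => A (L p)) = A ∘ L := rfl
  rw [h2, this]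
  refine (ContinuousMultilinearMap.norm_compContinuousLinearMap_le _ _).trans ?_
  have : ∏ _i : Fin i, ‖L‖ ≤ 1 := Finset.prod_le_one (fun _ _ => norm_nonneg _) fun _ _ => hL
  exact mul_le_of_le_one_right (norm_nonneg _) this

lemma iter_comp_snd_le (L : V × W →L[ℝ] W) (hL : ‖L‖ ≤ 1) (A : 𝓢(W, ℂ)) (i : ℕ) (p : V × W) :
    ‖iteratedFDeriv ℝ i (fun p => A (L p)) p‖ ≤ ‖iteratedFDeriv ℝ i A (L p)‖ := by
  have := L.iteratedFDeriv_comp_right (f := A) (A.smooth ⊤) p (i := i) (mod_cast le_top)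
  have h2 : (fun p => A (L p)) = A ∘ L := rfl
  rw [h2, this]
  refine (ContinuousMultilinearMap.norm_compContinuousLinearMap_le _ _).trans ?_
  have : ∏ _i : Fin i, ‖L‖ ≤ 1 := Finset.prod_le_one (fun _ _ => norm_nonneg _) fun _ _ => hL
  exact mul_le_of_le_one_right (norm_nonneg _) this

lemma tens (T : 𝓢(W, ℂ)) : ∃ L : 𝓢(V, ℂ) →L[ℝ] 𝓢(V × W, ℂ), ∀ A v w, L A (v, w) = A v * T w := by
  refine ⟨SchwartzMap.mkCLM (fun A p => A p.1 * T p.2) (fun A B p => by simp [add_mul])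
    (fun a A p => by simp [mul_assoc]) (fun A => ?_) ?_, fun A v w => rfl⟩
  · exact ((A.smooth ⊤).comp contDiff_fst).mul ((T.smooth ⊤).comp contDiff_snd)
  · rintro ⟨k, n⟩
    refine ⟨Finset.Iic (k, n), ∑ i ∈ Finset.range (n + 1), (n.choose i : ℝ) *
      (SchwartzMap.seminorm ℝ 0 (n - i) T + SchwartzMap.seminorm ℝ k (n - i) T), by positivity, fun A p => ?_⟩
    have h1 := norm_iteratedFDeriv_mul_le (𝕜 := ℝ) (f := fun p : V × W => A p.1) (g := fun p : V × W => T p.2) (N := ∞)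
      ((A.smooth ⊤).comp contDiff_fst) ((T.smooth ⊤).comp contDiff_snd) p (n := n) (mod_cast le_top)
    have hA : ∀ j i, j ≤ k → i ≤ n → ‖p.1‖ ^ j * ‖iteratedFDeriv ℝ i A p.1‖ ≤ (Finset.Iic (k, n)).sup (schwartzSeminormFamily ℝ V ℂ) A := by
      intro j i hj hi
      refine (SchwartzMap.le_seminorm ℝ j i A p.1).trans ?_
      exact Seminorm.le_def.1 (Finset.le_sup (f := schwartzSeminormFamily ℝ V ℂ) (b := (j, i)) (by simpa using ⟨hj, hi⟩)) A
    have hp : ‖p‖ ^ k ≤ ‖p.1‖ ^ k + ‖p.2‖ ^ k := by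
      rw [Prod.norm_def]
      rcases max_choice ‖p.1‖ ‖p.2‖ with h | h <;> rw [h]
      · linarith [pow_nonneg (norm_nonneg p.2) k]
      · linarith [pow_nonneg (norm_nonneg p.1) k]
    set S := (Finset.Iic (k, n)).sup (schwartzSeminormFamily ℝ V ℂ) A
    refine (mul_le_mul_of_nonneg_left h1 (by positivity)).trans ?_
    rw [Finset.mul_sum, Finset.sum_mul]
    refine Finset.sum_le_sum fun i hi => ?_
    have hi' : i ≤ n := by simp at hi; omega
    have a1 := iter_comp_fst_le (ContinuousLinearMap.fst ℝ V W) (ContinuousLinearMap.norm_fst_le ..) A i p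
    have a2 := iter_comp_snd_le (ContinuousLinearMap.snd ℝ V W) (ContinuousLinearMap.norm_snd_le ..) T (n - i) p
    simp only [ContinuousLinearMap.coe_fst', ContinuousLinearMap.coe_snd'] at a1 a2
    set X := ‖iteratedFDeriv ℝ i A p.1‖
    set Y := ‖iteratedFDeriv ℝ (n - i) T p.2‖
    have b1 := hA k i le_rfl hi'
    have b2 := hA 0 i (Nat.zero_le _) hi'
    have c1 := SchwartzMap.le_seminorm ℝ k (n - i) T p.2
    have c2 := SchwartzMap.le_seminorm ℝ 0 (n - i) T p.2
    rw [pow_zero, one_mul] at b2 c2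
    have hX : 0 ≤ X := norm_nonneg _
    have hY : 0 ≤ Y := norm_nonneg _
    calc _ ≤ (‖p.1‖ ^ k + ‖p.2‖ ^ k) * ((n.choose i : ℝ) * X * Y) := by gcongr
      _ = (n.choose i : ℝ) * ((‖p.1‖ ^ k * X) * Y + X * (‖p.2‖ ^ k * Y)) := by ring
      _ ≤ (n.choose i : ℝ) * (S * SchwartzMap.seminorm ℝ 0 (n - i) T + S * SchwartzMap.seminorm ℝ k (n - i) T) := by
        gcongr
      _ = _ := by ring
end tens

abbrev V6 := EuclideanSpace ℝ (Fin 3 ⊕ Fin 3)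
abbrev W3 := ℝ × ℝ × ℝ

def e6 : V6 ≃L[ℝ] V3 × V3 :=
  (EuclideanSpace.equiv (Fin 3 ⊕ Fin 3) ℝ).trans (ContinuousLinearEquiv.sumPiEquivProdPi ℝ (Fin 3) (Fin 3) (fun _ => ℝ))

lemma e6_fst (N : V6) (j : Fin 3) : (e6 N).1 j = N (Sum.inl j) := rfl
lemma e6_snd (N : V6) (j : Fin 3) : (e6 N).2 j = N (Sum.inr j) := rfl

lemma e6_mp : MeasurePreserving (⇑e6) volume volume :=
  (volume_measurePreserving_sumPiEquivProdPi (fun _ : Fin 3 ⊕ Fin 3 => ℝ)).comp (PiLp.volume_preserving_ofLp (Fin 3 ⊕ Fin 3))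

lemma e6_inner (M N : V6) : inner ℝ M N = (∑ j, (e6 M).1 j * (e6 N).1 j) + ∑ j, (e6 M).2 j * (e6 N).2 j := by
  rw [PiLp.inner_apply, Fintype.sum_sum_type]
  simp [e6_fst, e6_snd, mul_comm]

lemma e6_integral (g : V3 × V3 → ℂ) : ∫ p, g p = ∫ N, g (e6 N) :=
  (e6_mp.integral_comp e6.toHomeomorph.measurableEmbedding g).symm

def actp (k : Mat3) (p : V3 × V3) : V3 × V3 := (k.mulVec p.1, k.mulVec p.2)

lemma SO3_dot {k : Mat3} (hk : k ∈ SO3) (x y : V3) : ∑ j, (k.mulVec x) j * (k.mulVec y) j = ∑ j, x j * y j := by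
  have h : k.transpose * k = 1 := mul_eq_one_comm.1 hk.1
  change (k.mulVec x) ⬝ᵥ (k.mulVec y) = x ⬝ᵥ y
  rw [Matrix.dotProduct_mulVec, Matrix.vecMul_mulVec, h, Matrix.vecMul_one]

def actL (k : Mat3) : V6 →ₗ[ℝ] V6 where
  toFun N := e6.symm (actp k (e6 N))
  map_add' M N := by
    rw [← map_add e6.symm]
    simp [actp, Matrix.mulVec_add]
  map_smul' c N := by
    simp only [actp, map_smul, Prod.smul_fst, Prod.smul_snd, Matrix.mulVec_smul, RingHom.id_apply]
    rw [← map_smul]; rfl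

lemma actL_inner {k : Mat3} (hk : k ∈ SO3) (M N : V6) : inner ℝ (actL k M) (actL k N) = inner ℝ M N := by
  rw [e6_inner, e6_inner]
  simp [actL, actp, SO3_dot hk]

def actI {k : Mat3} (hk : k ∈ SO3) : V6 ≃ₗᵢ[ℝ] V6 :=
  ((actL k).isometryOfInner (actL_inner hk)).toLinearIsometryEquiv rfl

lemma actI_apply {k : Mat3} (hk : k ∈ SO3) (N : V6) : e6 (actI hk N) = actp k (e6 N) := by
  change e6 (e6.symm _) = _
  simp

lemma actI_inner {k : Mat3} (hk : k ∈ SO3) (M N : V6) : inner ℝ (actI hk M) (actI hk N) = inner ℝ M N :=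
  (actI hk).inner_map_map M N

lemma actI_integral {k : Mat3} (hk : k ∈ SO3) (g : V6 → ℂ) : ∫ N, g (actI hk N) = ∫ N, g N :=
  (actI hk).measurePreserving.integral_comp (actI hk).toHomeomorph.measurableEmbedding g

lemma meas_actp : Measurable (fun q : Mat3 × (V3 × V3) => actp q.1 q.2) := by
  unfold actp
  refine Measurable.prodMk (measurable_pi_lambda _ fun j => ?_) (measurable_pi_lambda _ fun j => ?_)
  · simp only [Matrix.mulVec, dotProduct]
    refine Finset.measurable_sum _ fun i _ => ((meas_entry j i).comp measurable_fst).mul ?_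
    exact (measurable_pi_apply i).comp (measurable_fst.comp measurable_snd)
  · simp only [Matrix.mulVec, dotProduct]
    refine Finset.measurable_sum _ fun i _ => ((meas_entry j i).comp measurable_fst).mul ?_
    exact (measurable_pi_apply i).comp (measurable_snd.comp measurable_snd)

lemma avg {μ : Measure Mat3} (hμ : IsHaarSO3 μ) {H : V6 → ℂ} (hH : Integrable H)
    (hinv : ∀ k (hk : k ∈ SO3) N, H (actI hk N) = H N) {K : V3 × V3 → ℂ} (hK : Measurable K) {C : ℝ} (hC : ∀ p, ‖K p‖ ≤ C) :
    ∫ N, H N * K (e6 N) = ∫ N, H N * ∫ k, K (actp k (e6 N)) ∂μ := by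
  have := hμ.1
  have hm : Measurable (fun q : V6 × Mat3 => K (actp q.2 (e6 q.1))) :=
    hK.comp (meas_actp.comp (measurable_snd.prodMk (e6.continuous.measurable.comp measurable_fst)))
  have hint : Integrable (fun q : V6 × Mat3 => H q.1 * K (actp q.2 (e6 q.1))) (volume.prod μ) := by
    refine Integrable.mul_bdd (c := C) (hH.comp_fst μ) hm.aestronglyMeasurable ?_
    exact Filter.Eventually.of_forall fun q => hC _
  calc ∫ N, H N * K (e6 N) = ∫ k, (∫ N, H N * K (e6 N)) ∂μ := by simp
    _ = ∫ k, (∫ N, H N * K (actp k (e6 N))) ∂μ := by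
      refine integral_congr_ae ?_
      filter_upwards [SO3_ae hμ] with k hk
      rw [← actI_integral hk]
      simp only [hinv k hk, actI_apply]
    _ = ∫ N, ∫ k, H N * K (actp k (e6 N)) ∂μ := (integral_integral_swap hint).symm
    _ = _ := by simp only [integral_const_mul]

lemma BLc {V W : Type} [NormedAddCommGroup V] [InnerProductSpace ℝ V] [FiniteDimensional ℝ V] [MeasurableSpace V] [BorelSpace V]
    [NormedAddCommGroup W] [NormedSpace ℝ W] [FiniteDimensional ℝ W] (c : ℝ) (hc : c ≠ 0) :
    ∃ L : 𝓢(V × W, ℂ) →L[ℝ] 𝓢(V × W, ℂ), ∀ A n w, L A (n, w) =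
      ∫ v, A (v, w) * Complex.exp (-(I * (inner ℝ n (c • v) : ℝ))) := by
  refine BL (W := W) (volume : Measure V) (stdOrthonormalBasis ℝ V) (th := fun p => c • p.1) (om := fun _ _ => c⁻¹)
    ((c • ContinuousLinearMap.fst ℝ V W).hasTemperateGrowth) (fun _ => Function.HasTemperateGrowth.const _) ?_
  intro i p
  have : fderiv ℝ (fun p : V × W => c • p.1) p = c • ContinuousLinearMap.fst ℝ V W :=
    (c • ContinuousLinearMap.fst ℝ V W).fderiv
  rw [this]
  simp [smul_smul, hc]

def epN (N : V6) : ℝ := (1 + ‖N‖ ^ 2) ^ (-1 : ℝ)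
def KK (p : V6 × W3) : ℂ :=
  cexp (I * ((2 * Real.pi * (kap (p.2.2.1 * (1 + ‖p.1‖ ^ 2) ^ 2) * pp (p.2.2.1 * (1 + ‖p.1‖ ^ 2) ^ 2) * epN p.1 * p.1 (Sum.inr 2)
    + p.2.2.2 * ((1 + ‖p.1‖ ^ 2) * pp (p.2.2.1 * (1 + ‖p.1‖ ^ 2) ^ 2)) * p.1 (Sum.inl 2)) : ℝ)))
  * (ce (2 * Real.pi * epN p.1 * p.1 (Sum.inr 1)) : ℝ)
  * (cc ((2 * Real.pi * p.1 (Sum.inl 0)) ^ 2 * (p.2.1 - (p.2.2.2 * ((1 + ‖p.1‖ ^ 2) * pp (p.2.2.1 * (1 + ‖p.1‖ ^ 2) ^ 2))) ^ 2)) : ℝ)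

lemma htg_coord (j : Fin 3 ⊕ Fin 3) : (fun p : V6 × W3 => p.1 j).HasTemperateGrowth :=
  (EuclideanSpace.proj (𝕜 := ℝ) j ∘L ContinuousLinearMap.fst ℝ V6 W3).hasTemperateGrowth
lemma htg_nsq : (fun p : V6 × W3 => ‖p.1‖ ^ 2).HasTemperateGrowth :=
  (Function.hasTemperateGrowth_norm_sq (H := V6)).comp (ContinuousLinearMap.fst ℝ V6 W3).hasTemperateGrowth
lemma htg_ep : (fun p : V6 × W3 => epN p.1).HasTemperateGrowth :=
  (Function.hasTemperateGrowth_one_add_norm_sq_rpow V6 (-1)).comp (ContinuousLinearMap.fst ℝ V6 W3).hasTemperateGrowth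
lemma htg_x1 : (fun p : V6 × W3 => p.2.1).HasTemperateGrowth :=
  (ContinuousLinearMap.fst ℝ ℝ (ℝ × ℝ) ∘L ContinuousLinearMap.snd ℝ V6 W3).hasTemperateGrowth
lemma htg_x2 : (fun p : V6 × W3 => p.2.2.1).HasTemperateGrowth :=
  (ContinuousLinearMap.fst ℝ ℝ ℝ ∘L ContinuousLinearMap.snd ℝ ℝ (ℝ × ℝ) ∘L ContinuousLinearMap.snd ℝ V6 W3).hasTemperateGrowth
lemma htg_x3 : (fun p : V6 × W3 => p.2.2.2).HasTemperateGrowth :=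
  (ContinuousLinearMap.snd ℝ ℝ ℝ ∘L ContinuousLinearMap.snd ℝ ℝ (ℝ × ℝ) ∘L ContinuousLinearMap.snd ℝ V6 W3).hasTemperateGrowth
lemma htg_re {E : Type} [NormedAddCommGroup E] [NormedSpace ℝ E] {g : E → ℝ} (hg : g.HasTemperateGrowth) :
    (fun x => ((g x : ℝ) : ℂ)).HasTemperateGrowth := htg_ofReal hg

lemma KK_htg : KK.HasTemperateGrowth := by
  have hD : (fun p : V6 × W3 => 1 + ‖p.1‖ ^ 2).HasTemperateGrowth := (Function.HasTemperateGrowth.const (1:ℝ)).add htg_nsq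
  have hz : (fun p : V6 × W3 => p.2.2.1 * (1 + ‖p.1‖ ^ 2) ^ 2).HasTemperateGrowth := htg_x2.mul (hD.pow 2)
  have hk := kap_htg.comp hz
  have hp := pp_htg.comp hz
  have hiq := hD.mul hp
  have h2 := htg_x3.mul hiq
  have hc : ∀ c : ℝ, (fun _ : V6 × W3 => c).HasTemperateGrowth := fun c => Function.HasTemperateGrowth.const c
  have h1 := htg_phase ((hc (2 * Real.pi)).mul ((((hk.mul hp).mul htg_ep).mul (htg_coord (Sum.inr 2))).add
    (h2.mul (htg_coord (Sum.inl 2)))))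
  have h3 := htg_re (ce_htg.comp (((hc (2 * Real.pi)).mul htg_ep).mul (htg_coord (Sum.inr 1))))
  have h4 := htg_re (cc_htg.comp ((((hc (2 * Real.pi)).mul (htg_coord (Sum.inl 0))).pow 2).mul (htg_x1.sub (h2.pow 2))))
  exact (h1.mul h3).mul h4

lemma KK_eq (N : V6) (z1 z2 r lam : ℝ) : ∃ q e : ℝ, 0 < q ∧ q ^ 2 = lam ^ 2 + epN N ^ 2 ∧
    e ^ 2 = z1 ^ 2 + z2 ^ 2 + r ^ 2 - (lam * r / q) ^ 2 ∧ ∀ N' : V6, ‖N'‖ = ‖N‖ →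
    KK (N', (z1 ^ 2 + z2 ^ 2 + r ^ 2, lam ^ 2, lam * r)) = 
      cexp (I * ((2 * Real.pi * (q * (e6 N').2 2 + lam * r / q * (e6 N').1 2) : ℝ))) * 
      (Real.exp (-(2 * Real.pi * epN N * (e6 N').2 1)) : ℝ) * (Real.cos (2 * Real.pi * (e6 N').1 0 * e) : ℝ) := by
  set D := 1 + ‖N‖ ^ 2 with hDdef
  have hD : 0 < D := by positivity
  have hep : epN N = D⁻¹ := Real.rpow_neg_one _
  set z := lam ^ 2 * D ^ 2 with hzdef
  have hz : 0 ≤ z := by positivity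
  have hkz : kap z = 1 + z := kap_pos hz
  have hpz := pp_sq z
  have hpp := pp_pos z
  have hk0 : 0 < kap z := by rw [hkz]; positivity
  set q := kap z * pp z * epN N with hqdef
  have hq : 0 < q := by rw [hqdef, hep]; positivity
  have hqi : D * pp z = 1 / q := by
    rw [eq_div_iff hq.ne', hqdef, hep]
    field_simp
    linear_combination hpz
  have hq2 : q ^ 2 = lam ^ 2 + epN N ^ 2 := by
    have : q ^ 2 = kap z * (pp z ^ 2 * kap z) * epN N ^ 2 := by rw [hqdef]; ring
    rw [this, hpz, hkz, hep, hzdef]; field_simp; ring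
  have hnn : 0 ≤ z1 ^ 2 + z2 ^ 2 + r ^ 2 - (lam * r / q) ^ 2 := by
    have : (lam * r / q) ^ 2 ≤ r ^ 2 := by
      rw [div_pow, div_le_iff₀ (by positivity), hq2]
      nlinarith [sq_nonneg (r * epN N)]
    nlinarith [sq_nonneg z1, sq_nonneg z2]
  refine ⟨q, Real.sqrt (z1 ^ 2 + z2 ^ 2 + r ^ 2 - (lam * r / q) ^ 2), hq, hq2, Real.sq_sqrt hnn, fun N' hN' => ?_⟩
  have he' : epN N' = epN N := by simp [epN, hN']
  have hce : ce (2 * Real.pi * epN N * N' (Sum.inr 1)) = Real.exp (-(2 * Real.pi * epN N * N' (Sum.inr 1))) := by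
    apply ce_eq
    have h1 : |N' (Sum.inr 1)| ≤ ‖N‖ := by rw [← hN']; exact PiLp.norm_apply_le N' _
    rw [hep, abs_mul, abs_of_pos (by positivity), mul_assoc, mul_comm 2, mul_assoc]
    have h2 : D⁻¹ * |N' (Sum.inr 1)| * 2 ≤ 1 := by
      rw [mul_assoc, inv_mul_le_iff₀ hD, hDdef]
      nlinarith [sq_nonneg (‖N‖ - 1)]
    nlinarith [Real.pi_pos]
  unfold KK
  simp only [hN', he', ← hDdef, ← hzdef, hqi]
  rw [hce]
  have e1 : lam * r * (1 / q) = lam * r / q := by ring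
  rw [e1]
  have e2 : (2 * Real.pi * N' (Sum.inl 0)) ^ 2 * (z1 ^ 2 + z2 ^ 2 + r ^ 2 - (lam * r / q) ^ 2) =
     (2 * Real.pi * N' (Sum.inl 0) * Real.sqrt (z1 ^ 2 + z2 ^ 2 + r ^ 2 - (lam * r / q) ^ 2)) ^ 2 := by
    rw [mul_pow _ (Real.sqrt _), Real.sq_sqrt hnn]
  rw [e2, cc_sq]
  simp only [e6_fst, e6_snd]
  rfl

lemma KK_bound (N : V6) (z1 z2 r lam : ℝ) : ‖KK (N, (z1 ^ 2 + z2 ^ 2 + r ^ 2, lam ^ 2, lam * r))‖ ≤ Real.exp Real.pi := by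
  obtain ⟨q, e, hq, hq2, he, h⟩ := KK_eq N z1 z2 r lam
  rw [h N rfl, norm_mul, norm_mul, mul_comm I, Complex.norm_exp_ofReal_mul_I, one_mul, Complex.norm_real, Complex.norm_real,
    Real.norm_of_nonneg (Real.exp_pos _).le]
  refine (mul_le_of_le_one_right (Real.exp_pos _).le (Real.abs_cos_le_one _)).trans (Real.exp_le_exp.2 ?_)
  have hD : 0 < 1 + ‖N‖ ^ 2 := by positivity
  have hep : epN N = (1 + ‖N‖ ^ 2)⁻¹ := Real.rpow_neg_one _
  have h1 : |N (Sum.inr 1)| ≤ ‖N‖ := PiLp.norm_apply_le N _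
  have h3 := neg_abs_le (N (Sum.inr 1))
  rw [hep, e6_snd]
  have h2 : (1 + ‖N‖ ^ 2)⁻¹ * (-(N (Sum.inr 1)) * 2) ≤ 1 := by
    rw [inv_mul_le_iff₀ hD]
    nlinarith [sq_nonneg (‖N‖ - 1)]
  nlinarith [Real.pi_pos]

def M0 (z1 z2 r lam : ℝ) : V6 := e6.symm (![z1, z2, r], ![0, 0, lam])
def gramM (M : V6) : W3 := (∑ j, (e6 M).1 j ^ 2, ∑ j, (e6 M).2 j ^ 2, ∑ j, (e6 M).1 j * (e6 M).2 j)

lemma gram_M0 (z1 z2 r lam : ℝ) : gramM (M0 z1 z2 r lam) = (z1 ^ 2 + z2 ^ 2 + r ^ 2, lam ^ 2, lam * r) := by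
  simp [gramM, M0, Fin.sum_univ_three, mul_comm]

lemma gram_act {k : Mat3} (hk : k ∈ SO3) (M : V6) : gramM (actI hk M) = gramM M := by
  simp only [gramM, actI_apply, actp, pow_two, SO3_dot hk]

lemma M0_inner (z1 z2 r lam : ℝ) (N : V6) : inner ℝ (M0 z1 z2 r lam) N =
    z1 * (e6 N).1 0 + z2 * (e6 N).1 1 + r * (e6 N).1 2 + lam * (e6 N).2 2 := by
  rw [e6_inner]; simp [M0, Fin.sum_univ_three]

/-- averaged form: H invariant -/
lemma H_kernel {μ : Measure Mat3} (hμ : IsHaarSO3 μ) {H : V6 → ℂ} (hH : Integrable H)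
    (hinv : ∀ k (hk : k ∈ SO3) N, H (actI hk N) = H N) {z1 z2 r lam : ℝ} (hl : 0 < lam) (hz : 0 < z1 ^ 2 + z2 ^ 2) :
    ∫ N, H N * KK (N, (z1 ^ 2 + z2 ^ 2 + r ^ 2, lam ^ 2, lam * r)) =
    ∫ N, H N * cexp (2 * Real.pi * I * (inner ℝ (M0 z1 z2 r lam) N : ℝ)) := by
  have hKc : Continuous (fun p : V3 × V3 => KK (e6.symm p, (z1 ^ 2 + z2 ^ 2 + r ^ 2, lam ^ 2, lam * r))) :=
    KK_htg.1.continuous.comp (e6.symm.continuous.prodMk continuous_const)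
  have a1 := avg hμ hH hinv (K := fun p => KK (e6.symm p, (z1 ^ 2 + z2 ^ 2 + r ^ 2, lam ^ 2, lam * r))) hKc.measurable
    (fun p => KK_bound _ z1 z2 r lam)
  have hEc : Continuous (fun p : V3 × V3 => cexp (2 * Real.pi * I * (inner ℝ (M0 z1 z2 r lam) (e6.symm p) : ℝ))) := by
    have : Continuous (fun p : V3 × V3 => inner ℝ (M0 z1 z2 r lam) (e6.symm p)) := continuous_const.inner e6.symm.continuous
    fun_prop
  have a2 := avg hμ hH hinv (K := fun p => cexp (2 * Real.pi * I * (inner ℝ (M0 z1 z2 r lam) (e6.symm p) : ℝ))) hEc.measurable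
    (C := 1) (fun p => by
      have : 2 * Real.pi * I * (inner ℝ (M0 z1 z2 r lam) (e6.symm p) : ℝ) = ((2 * Real.pi * inner ℝ (M0 z1 z2 r lam) (e6.symm p) : ℝ) : ℂ) * I := by
        push_cast; ring
      rw [this, Complex.norm_exp_ofReal_mul_I])
  simp only [ContinuousLinearEquiv.symm_apply_apply] at a1 a2
  rw [a1, a2]
  congr 1; ext N; congr 1
  obtain ⟨q, e, hq, hq2, he, h⟩ := KK_eq N z1 z2 r lam
  have h2 := kernel_avg hμ (e6 N).1 (e6 N).2 hl hq hz hq2 he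
  trans gI μ (e6 N).1 (e6 N).2 z1 z2 r 0 0 lam
  · rw [← h2]
    refine integral_congr_ae ?_
    filter_upwards [SO3_ae hμ] with k hk
    rw [← actI_apply hk, ContinuousLinearEquiv.symm_apply_apply, h _ ((actI hk).norm_map N), actI_apply]
    rfl
  · unfold gI
    congr 1; ext k; congr 1
    rw [M0_inner]
    simp [actp]

open scoped FourierTransform

lemma exists_theta : ∃ T : 𝓢(W3, ℂ), T 0 = 1 := by
  let b : ContDiffBump (0 : W3) := ⟨1, 2, by norm_num, by norm_num⟩
  have hc : HasCompactSupport (fun x : W3 => ((b x : ℝ) : ℂ)) := b.hasCompactSupport.comp_left (g := fun t : ℝ => (t : ℂ)) (by simp)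
  have hd : ContDiff ℝ ∞ (fun x : W3 => ((b x : ℝ) : ℂ)) := Complex.ofRealCLM.contDiff.comp b.contDiff
  refine ⟨hc.toSchwartzMap hd, ?_⟩
  have : b 0 = 1 := b.one_of_mem_closedBall (by simp [b])
  simp [this]

lemma eq_of_pos {f g : ℝ → ℂ} (hf : Continuous f) (hg : Continuous g) (h : ∀ x, 0 < x → f x = g x) : f 0 = g 0 := by
  have h1 : Set.EqOn f g (closure (Set.Ioi 0)) := Set.EqOn.closure (fun x hx => h x hx) hf hg
  rw [closure_Ioi] at h1
  exact h1 Set.self_mem_Ici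

lemma gramM_htg : gramM.HasTemperateGrowth := by
  have h : ∀ j, (fun p : V6 => p j).HasTemperateGrowth := fun j => (EuclideanSpace.proj (𝕜 := ℝ) j).hasTemperateGrowth
  have a1 : (fun M : V6 => ∑ j : Fin 3, (e6 M).1 j ^ 2).HasTemperateGrowth :=
    Function.HasTemperateGrowth.sum (fun j _ => (h (Sum.inl j)).pow 2)
  have a2 : (fun M : V6 => ∑ j : Fin 3, (e6 M).2 j ^ 2).HasTemperateGrowth :=
    Function.HasTemperateGrowth.sum (fun j _ => (h (Sum.inr j)).pow 2)
  have a3 : (fun M : V6 => ∑ j : Fin 3, (e6 M).1 j * (e6 M).2 j).HasTemperateGrowth :=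
    Function.HasTemperateGrowth.sum (fun j _ => (h (Sum.inl j)).mul (h (Sum.inr j)))
  have e1 : (fun M => gramM M) = fun M : V6 => (ContinuousLinearMap.inl ℝ ℝ (ℝ × ℝ)) (∑ j, (e6 M).1 j ^ 2) +
     ((ContinuousLinearMap.inr ℝ ℝ (ℝ × ℝ)) ((ContinuousLinearMap.inl ℝ ℝ ℝ) (∑ j, (e6 M).2 j ^ 2)) +
     (ContinuousLinearMap.inr ℝ ℝ (ℝ × ℝ)) ((ContinuousLinearMap.inr ℝ ℝ ℝ) (∑ j, (e6 M).1 j * (e6 M).2 j))) := by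
    ext M <;> simp [gramM, Prod.fst_sum, Prod.snd_sum]
  show (fun M => gramM M).HasTemperateGrowth
  rw [e1]
  exact ((ContinuousLinearMap.hasTemperateGrowth _).comp a1).add
    (((ContinuousLinearMap.hasTemperateGrowth _).comp ((ContinuousLinearMap.hasTemperateGrowth _).comp a2)).add
    ((ContinuousLinearMap.hasTemperateGrowth _).comp ((ContinuousLinearMap.hasTemperateGrowth _).comp a3)))

def g3 (p : V6 × W3) : V6 × W3 := (p.1, gramM p.1 - p.2)

lemma g3_htg : g3.HasTemperateGrowth := by
  have e1 : (fun p => g3 p) = fun p : V6 × W3 => (ContinuousLinearMap.inl ℝ V6 W3) (ContinuousLinearMap.fst ℝ V6 W3 p) +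
    (ContinuousLinearMap.inr ℝ V6 W3) (gramM (ContinuousLinearMap.fst ℝ V6 W3 p) - ContinuousLinearMap.snd ℝ V6 W3 p) := by
    ext p <;> simp [g3]
  show (fun p => g3 p).HasTemperateGrowth
  rw [e1]
  exact ((ContinuousLinearMap.hasTemperateGrowth _).comp (ContinuousLinearMap.hasTemperateGrowth _)).add
    ((ContinuousLinearMap.hasTemperateGrowth _).comp
     ((gramM_htg.comp (ContinuousLinearMap.hasTemperateGrowth _)).sub (ContinuousLinearMap.hasTemperateGrowth _)))

lemma g3_upper : ∃ (k : ℕ) (C : ℝ), ∀ p, ‖p‖ ≤ C * (1 + ‖g3 p‖) ^ k := by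
  obtain ⟨k, C, hC⟩ := gramM_htg.2 0
  refine ⟨k + 1, 1 + max C 0, fun p => ?_⟩
  have h0 := hC p.1
  rw [norm_iteratedFDeriv_zero] at h0
  have h1 : ‖p.1‖ ≤ ‖g3 p‖ := norm_fst_le (g3 p)
  have h2 : ‖gramM p.1 - p.2‖ ≤ ‖g3 p‖ := norm_snd_le (g3 p)
  have h3 : ‖p.2‖ ≤ ‖gramM p.1‖ + ‖gramM p.1 - p.2‖ := by
    have := norm_sub_le (gramM p.1) (gramM p.1 - p.2)
    simpa using this
  set a := ‖g3 p‖
  have ha : 0 ≤ a := norm_nonneg _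
  have h4 : ‖gramM p.1‖ ≤ max C 0 * (1 + a) ^ (k + 1) := by
    refine h0.trans (mul_le_mul (le_max_left _ _) ?_ (by positivity) (le_max_right _ _))
    calc (1 + ‖p.1‖) ^ k ≤ (1 + a) ^ k := by gcongr
      _ ≤ (1 + a) ^ (k + 1) := pow_le_pow_right₀ (by linarith) (by omega)
  have h5 : a ≤ (1 + a) ^ (k + 1) := by
    calc a ≤ (1 + a) ^ 1 := by linarith
      _ ≤ (1 + a) ^ (k + 1) := pow_le_pow_right₀ (by linarith) (by omega)
  have h6 : 0 ≤ max C 0 * (1 + a) ^ (k + 1) := by positivity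
  rw [Prod.norm_def, max_le_iff]
  constructor <;> nlinarith

def sliceCLM {V W : Type} [NormedAddCommGroup V] [NormedSpace ℝ V] [NormedAddCommGroup W] [NormedSpace ℝ W] (w : W) :
    𝓢(V × W, ℂ) →L[ℝ] 𝓢(V, ℂ) :=
  SchwartzMap.compCLM ℝ (g := fun v : V => (v, w))
    (by
      have e1 : (fun v : V => (v, w)) = fun v => (ContinuousLinearMap.inl ℝ V W) v + (0, w) := by
        ext v <;> simp
      rw [e1]
      exact (ContinuousLinearMap.hasTemperateGrowth _).add (Function.HasTemperateGrowth.const _))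
    ⟨1, 1, fun v => by
      have := norm_fst_le (v, w)
      simp only [pow_one, one_mul] at *
      linarith⟩

@[simp] lemma sliceCLM_apply {V W : Type} [NormedAddCommGroup V] [NormedSpace ℝ V] [NormedAddCommGroup W] [NormedSpace ℝ W]
   (w : W) (A : 𝓢(V × W, ℂ)) (v : V) : sliceCLM w A v = A (v, w) := rfl

def scal (s : ℝ) (hs : 0 < s) {V W : Type} [NormedAddCommGroup V] [NormedSpace ℝ V] [NormedAddCommGroup W] [NormedSpace ℝ W] :
    𝓢(V × W, ℂ) →L[ℝ] 𝓢(W, ℂ) :=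
  SchwartzMap.compCLM ℝ (g := fun w : W => ((0 : V), s • w))
    (by
      have e1 : (fun w : W => ((0 : V), s • w)) = fun w => (s • ContinuousLinearMap.inr ℝ V W) w := by
        ext v <;> simp
      rw [e1]
      exact (s • ContinuousLinearMap.inr ℝ V W).hasTemperateGrowth)
    ⟨1, s⁻¹, fun w => by
      have := norm_snd_le ((0 : V), s • w)
      simp only [pow_one, norm_smul, Real.norm_of_nonneg hs.le] at *
      rw [← div_eq_inv_mul, le_div_iff₀ hs]
      linarith⟩

@[simp] lemma scal_apply (s : ℝ) (hs : 0 < s) {V W : Type} [NormedAddCommGroup V] [NormedSpace ℝ V] [NormedAddCommGroup W] [NormedSpace ℝ W]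
   (A : 𝓢(V × W, ℂ)) (w : W) : scal s hs A w = A (0, s • w) := rfl

/-- Fourier inversion in the form produced by `BLc`. -/
lemma inv_slice {V : Type} [NormedAddCommGroup V] [InnerProductSpace ℝ V] [FiniteDimensional ℝ V] [MeasurableSpace V] [BorelSpace V]
    (φ : 𝓢(V, ℂ)) : ∃ ψ : 𝓢(V, ℂ), (∀ N, ψ N = ∫ M, φ M * cexp (-(I * (inner ℝ N ((2 * Real.pi) • M) : ℝ)))) ∧
      ∀ M, φ M = ∫ N, ψ N * cexp (2 * Real.pi * I * (inner ℝ M N : ℝ)) := by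
  refine ⟨𝓕 φ, fun N => ?_, fun M => ?_⟩
  · rw [SchwartzMap.fourier_coe, Real.fourier_eq']
    congr 1; ext v
    rw [smul_eq_mul, mul_comm, real_inner_comm, inner_smul_right, real_inner_comm]
    congr 2
    push_cast; ring
  · conv_lhs => rw [← FourierTransform.fourierInv_fourier_eq (F := 𝓢(V, ℂ)) φ]
    rw [SchwartzMap.fourierInv_coe, Real.fourierInv_eq']
    congr 1; ext v
    rw [smul_eq_mul, mul_comm, real_inner_comm]
    congr 2
    push_cast; ring

theorem S2 {μ : Measure Mat3} (hμ : IsHaarSO3 μ) : ∃ U : 𝓢(V3 × V3, ℂ) →L[ℝ] 𝓢(W3, ℂ), ∀ F : 𝓢(V3 × V3, ℂ), Inv3 ⇑F →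
    ∀ z1 z2 r lam : ℝ, 0 ≤ lam → U F (z1 ^ 2 + z2 ^ 2 + r ^ 2, lam ^ 2, lam * r) =
      ∫ p, F p * cexp (I * ((z1 * p.1 0 + z2 * p.1 1 + r * p.1 2 + lam * p.2 2 : ℝ) : ℂ)) := by
  have hpi := Real.pi_pos
  obtain ⟨T, hT⟩ := exists_theta
  obtain ⟨L1, hL1⟩ := tens (V := V6) T
  obtain ⟨L2, hL2⟩ := BLc (V := V6) (W := W3) (-(2 * Real.pi)) (neg_ne_zero.2 (by positivity))
  obtain ⟨L4, hL4⟩ := BLc (V := V6) (W := W3) (2 * Real.pi) (by positivity)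
  obtain ⟨L6, hL6⟩ := BLc (V := V6) (W := W3) 1 one_ne_zero
  have hs : 0 < ((2 * Real.pi) ^ 2)⁻¹ := by positivity
  refine ⟨scal _ hs ∘L L6 ∘L mulS KK_htg ∘L L4 ∘L SchwartzMap.compCLM ℝ g3_htg g3_upper ∘L L2 ∘L L1 ∘L
    SchwartzMap.compCLMOfContinuousLinearEquiv ℝ e6, fun F hF => ?_⟩
  simp only [ContinuousLinearMap.comp_apply, scal_apply]
  set F6 := SchwartzMap.compCLMOfContinuousLinearEquiv ℝ e6 F with hF6
  have hF6a : ∀ N, F6 N = F (e6 N) := fun N => rfl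
  have hF6i : ∀ k (hk : k ∈ SO3) N, F6 (actI hk N) = F6 N := fun k hk N => by
    rw [hF6a, actI_apply, hF6a]; exact hF k hk _ _
  set A2 := L2 (L1 F6) with hA2
  have hA2v : ∀ M G, A2 (M, G) = A2 (M, 0) * T G := by
    intro M G
    rw [hA2, hL2, hL2, ← integral_mul_const]
    congr 1; ext v
    rw [hL1, hL1, hT]; ring
  have hA2i : ∀ k (hk : k ∈ SO3) M, A2 (actI hk M, 0) = A2 (M, 0) := by
    intro k hk M
    rw [hA2, hL2, hL2, ← actI_integral hk]
    congr 1; ext v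
    rw [hL1, hL1, hF6i, ← LinearIsometryEquiv.map_smul, actI_inner]
  set Φ := SchwartzMap.compCLM ℝ g3_htg g3_upper A2 with hΦ
  have hΦv : ∀ M G, Φ (M, G) = A2 (M, 0) * T (gramM M - G) := fun M G => hA2v _ _
  have hmain : ∀ z1 z2 r lam : ℝ, 0 ≤ lam → L6 (mulS KK_htg (L4 Φ)) (0, (z1 ^ 2 + z2 ^ 2 + r ^ 2, lam ^ 2, lam * r)) =
      A2 (M0 z1 z2 r lam, 0) := by
    have hgen : ∀ z1 z2 r lam : ℝ, 0 < lam → 0 < z1 ^ 2 + z2 ^ 2 → 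
      L6 (mulS KK_htg (L4 Φ)) (0, (z1 ^ 2 + z2 ^ 2 + r ^ 2, lam ^ 2, lam * r)) = A2 (M0 z1 z2 r lam, 0) := by
      intro z1 z2 r lam hl hz
      set G : W3 := (z1 ^ 2 + z2 ^ 2 + r ^ 2, lam ^ 2, lam * r) with hG
      obtain ⟨ψ, h1, h2⟩ := inv_slice (sliceCLM G Φ)
      have hψ : ∀ N, L4 Φ (N, G) = ψ N := fun N => by rw [hL4, h1]; rfl
      have hψi : ∀ k (hk : k ∈ SO3) N, ψ (actI hk N) = ψ N := by
        intro k hk N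
        rw [h1, h1, ← actI_integral hk]
        congr 1; ext M
        rw [sliceCLM_apply, sliceCLM_apply, hΦv, hΦv, hA2i, gram_act, ← LinearIsometryEquiv.map_smul, actI_inner]
      have h3 := H_kernel hμ ψ.integrable hψi (z1 := z1) (z2 := z2) (r := r) hl hz
      rw [← h2, sliceCLM_apply, hΦv, gram_M0, ← hG, sub_self, hT, mul_one] at h3
      rw [← h3, hL6]
      congr 1; ext N
      rw [mulS_apply, hψ]
      simp
    intro z1 z2 r lam hl
    set σ : ℝ := if 0 ≤ z1 then 1 else -1 with hσ
    have hM0 : Continuous (fun t : ℝ => A2 (M0 (z1 + σ * t) z2 r (lam + t), 0)) := by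
      refine A2.continuous.comp (Continuous.prodMk ?_ continuous_const)
      refine e6.symm.continuous.comp (Continuous.prodMk ?_ ?_)
      · refine continuous_pi fun j => ?_
        fin_cases j <;> simp <;> fun_prop
      · refine continuous_pi fun j => ?_
        fin_cases j <;> simp <;> fun_prop
    have hcl : Continuous (fun t : ℝ => L6 (mulS KK_htg (L4 Φ)) (0, ((z1 + σ * t) ^ 2 + z2 ^ 2 + r ^ 2, (lam + t) ^ 2, (lam + t) * r))) := by
      refine (L6 (mulS KK_htg (L4 Φ))).continuous.comp ?_
      fun_prop
    have := eq_of_pos hcl hM0 (fun t ht => hgen _ _ _ _ (by linarith) (by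
      have : z1 + σ * t ≠ 0 := by
        rw [hσ]; split_ifs with h
        · linarith
        · push Not at h; linarith
      positivity))
    simpa using this
  intro z1 z2 r lam hl
  have h := hmain (z1 / (2 * Real.pi)) (z2 / (2 * Real.pi)) (r / (2 * Real.pi)) (lam / (2 * Real.pi)) (by positivity)
  have e1 : ((2 * Real.pi) ^ 2)⁻¹ • ((z1 ^ 2 + z2 ^ 2 + r ^ 2, lam ^ 2, lam * r) : W3) =
    ((z1 / (2 * Real.pi)) ^ 2 + (z2 / (2 * Real.pi)) ^ 2 + (r / (2 * Real.pi)) ^ 2, (lam / (2 * Real.pi)) ^ 2, (lam / (2 * Real.pi)) * (r / (2 * Real.pi))) := by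
    simp only [Prod.smul_mk, smul_eq_mul]
    refine Prod.ext ?_ (Prod.ext ?_ ?_) <;> simp only <;> field_simp
  rw [e1, h, hA2, hL2, e6_integral]
  congr 1; ext N
  rw [hL1, hT, mul_one, hF6a]
  congr 2
  rw [inner_smul_right, M0_inner, ← mul_neg, ← Complex.ofReal_neg]
  congr 2
  field_simp

def Tt (t : ℝ) : ℝ := -(2 * Real.pi * t)
def thS (p : ℝ × (ℝ × ℝ)) : ℝ := Tt p.1 * Aop 0 mm (p.2.1 * Tt p.1 ^ 2)
def laS (p : ℝ × (ℝ × ℝ)) : ℝ := Tt p.1 ^ 3 * Aop 2 mm (p.2.1 * Tt p.1 ^ 2)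

lemma htg_Tt : (fun p : ℝ × (ℝ × ℝ) => Tt p.1).HasTemperateGrowth := by
  have : (fun p : ℝ × (ℝ × ℝ) => Tt p.1) = fun p => ((-(2 * Real.pi)) • ContinuousLinearMap.fst ℝ ℝ (ℝ × ℝ)) p := by
    ext p; simp [Tt]
  rw [this]; exact ContinuousLinearMap.hasTemperateGrowth _
lemma htg_w1 : (fun p : ℝ × (ℝ × ℝ) => p.2.1).HasTemperateGrowth :=
  (ContinuousLinearMap.fst ℝ ℝ ℝ ∘L ContinuousLinearMap.snd ℝ ℝ (ℝ × ℝ)).hasTemperateGrowth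
lemma htg_w2 : (fun p : ℝ × (ℝ × ℝ) => p.2.2).HasTemperateGrowth :=
  (ContinuousLinearMap.snd ℝ ℝ ℝ ∘L ContinuousLinearMap.snd ℝ ℝ (ℝ × ℝ)).hasTemperateGrowth
lemma htg_wT : (fun p : ℝ × (ℝ × ℝ) => p.2.1 * Tt p.1 ^ 2).HasTemperateGrowth := htg_w1.mul (htg_Tt.pow 2)
lemma htg_thS : thS.HasTemperateGrowth := htg_Tt.mul ((Aop_htg mm_htg).comp htg_wT)
lemma htg_laS : laS.HasTemperateGrowth := (htg_Tt.pow 3).mul ((Aop_htg mm_htg).comp htg_wT)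

lemma Aop_sub (k : ℕ) (h : ℝ → ℝ) (x T : ℝ) : T ^ (k + 1) * Aop k h (x * T ^ 2) = ∫ s in (0:ℝ)..T, s ^ k * h (x * s ^ 2) := by
  have := intervalIntegral.smul_integral_comp_mul_left (a := 0) (b := 1) (fun s : ℝ => s ^ k * h (x * s ^ 2)) T
  rw [mul_zero, mul_one] at this
  rw [← this, Aop, pow_succ, mul_comm _ T, mul_assoc, smul_eq_mul, ← intervalIntegral.integral_const_mul]
  congr 2; ext s
  rw [mul_pow, mul_pow, mul_assoc x]; ring

lemma thS_eq (t : ℝ) (w : ℝ × ℝ) : thS (t, w) = ∫ s in (0:ℝ)..(Tt t), mm (w.1 * s ^ 2) := by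
  have := Aop_sub 0 mm w.1 (Tt t)
  simpa [thS] using this
lemma laS_eq (t : ℝ) (w : ℝ × ℝ) : laS (t, w) = ∫ s in (0:ℝ)..(Tt t), s ^ 2 * mm (w.1 * s ^ 2) := by
  have := Aop_sub 2 mm w.1 (Tt t)
  simpa [laS] using this

lemma thS_deriv (t : ℝ) (w : ℝ × ℝ) : HasDerivAt (fun t => thS (t, w)) (-(2 * Real.pi) * mm (w.1 * Tt t ^ 2)) t := by
  have h1 : Continuous (fun s : ℝ => mm (w.1 * s ^ 2)) := by
    have := mm_htg.1.continuous
    fun_prop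
  have h2 : HasDerivAt (fun T : ℝ => ∫ s in (0:ℝ)..T, mm (w.1 * s ^ 2)) (mm (w.1 * Tt t ^ 2)) (Tt t) :=
    intervalIntegral.integral_hasDerivAt_right (h1.intervalIntegrable _ _) h1.stronglyMeasurable.stronglyMeasurableAtFilter
      h1.continuousAt
  have h3 : HasDerivAt Tt (-(2 * Real.pi)) t := by
    have := ((hasDerivAt_id t).const_mul (2 * Real.pi)).neg
    rw [mul_one] at this
    exact this
  have h4 := h2.comp t h3
  rw [mul_comm]
  refine h4.congr_of_eventuallyEq (Filter.Eventually.of_forall fun s => ?_)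
  exact thS_eq s w

theorem S3 : ∃ Y : 𝓢(W3, ℂ) →L[ℝ] 𝓢(W3, ℂ), ∀ (u : 𝓢(W3, ℂ)) (w : ℝ × ℝ), ∃ ψ : 𝓢(ℝ, ℂ),
    (∀ s : ℝ, u (s, w) = ∫ t, ψ t * cexp (-(I * ((s * Tt t : ℝ) : ℂ)))) ∧
    ∀ x1 : ℝ, Y u (x1, w) = ∫ t, ψ t * (pp (w.1 * Tt t ^ 2) : ℝ) *
      cexp (-(I * ((x1 * thS (t, w) + w.2 ^ 2 * laS (t, w) : ℝ) : ℂ))) := by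
  have hpi := Real.pi_pos
  obtain ⟨L1, hL1⟩ := BLc (V := ℝ) (W := ℝ × ℝ) (2 * Real.pi) (by positivity)
  have hk : (fun p : ℝ × (ℝ × ℝ) => (-(2 * Real.pi))⁻¹ * kap (p.2.1 * Tt p.1 ^ 2)).HasTemperateGrowth :=
    (Function.HasTemperateGrowth.const _).mul (kap_htg.comp htg_wT)
  obtain ⟨L3, hL3⟩ := BL (W := ℝ × ℝ) (volume : Measure ℝ) (stdOrthonormalBasis ℝ ℝ) htg_thS 
    (om := fun _ p => (-(2 * Real.pi))⁻¹ * kap (p.2.1 * Tt p.1 ^ 2)) (fun _ => hk) (by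
      intro i p
      set b : ℝ := stdOrthonormalBasis ℝ ℝ i
      have h1 : HasFDerivAt thS (fderiv ℝ thS p) p := (htg_thS.1.differentiable (by simp)).differentiableAt.hasFDerivAt
      have h2 : HasDerivAt (fun t : ℝ => (t, p.2)) ((1 : ℝ), (0 : ℝ × ℝ)) p.1 := (hasDerivAt_id _).prodMk (hasDerivAt_const _ _)
      have h3 := (HasFDerivAt.comp_hasDerivAt p.1 (f := fun t : ℝ => (t, p.2)) h1 h2).unique (thS_deriv p.1 p.2)
      have h4 : ((b, 0) : ℝ × (ℝ × ℝ)) = b • (1, 0) := by simp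
      rw [h4, map_smul, h3]
      have := mm_kap (p.2.1 * Tt p.1 ^ 2)
      simp only [smul_eq_mul]
      field_simp
      linear_combination b * this)
  have hmul : (fun p : ℝ × (ℝ × ℝ) => ((pp (p.2.1 * Tt p.1 ^ 2) : ℝ) : ℂ) * cexp (I * ((-(p.2.2 ^ 2 * laS p) : ℝ) : ℂ))).HasTemperateGrowth :=
    (htg_ofReal (pp_htg.comp htg_wT)).mul (htg_phase ((htg_w2.pow 2).mul htg_laS).neg)
  refine ⟨L3 ∘L mulS hmul ∘L L1, fun u w => ?_⟩
  obtain ⟨ψ, h1, h2⟩ := inv_slice (sliceCLM w u)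
  have hψ : ∀ t, L1 u (t, w) = ψ t := fun t => by rw [hL1, h1]; rfl
  refine ⟨ψ, fun s => ?_, fun x1 => ?_⟩
  · rw [← sliceCLM_apply w u s, h2]
    congr 1; ext t; congr 2
    simp [Tt]; ring
  · simp only [ContinuousLinearMap.comp_apply]
    rw [hL3]
    congr 1; ext t
    rw [mulS_apply, hψ, mul_assoc, mul_assoc, mul_assoc, ← Complex.exp_add]
    congr 3
    simp; ring

lemma lag_eq (l : ℕ) (u : ℝ) : lag l u = ∑ k ∈ Finset.range (l + 1),
    (l.choose k : ℝ) * ((-u) ^ k / k.factorial) * Real.exp (-(u / 2)) := by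
  have hf : (fun v : ℝ => v ^ l * Real.exp (-v)) = (fun v : ℝ => v ^ l) * (fun v : ℝ => Real.exp (-1 * v)) := by
    ext v; simp
  unfold lag
  rw [← iteratedDeriv_eq_iterate, hf, iteratedDeriv_mul (by fun_prop) (by fun_prop), Finset.mul_sum,
    ← Finset.sum_range_reflect]
  refine Finset.sum_congr rfl fun k hk => ?_
  have hkl : k ≤ l := by simpa [Nat.lt_succ_iff] using hk
  have e1 : l + 1 - 1 - k = l - k := by omega
  have e2 : l - (l - k) = k := by omega
  rw [e1, e2, iteratedDeriv_pow, iteratedDeriv_exp_const_mul, Nat.choose_symm hkl, e2]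
  have e3 := Nat.factorial_mul_descFactorial (Nat.sub_le l k)
  rw [e2] at e3
  have e4 : (k.factorial : ℝ) * (l.descFactorial (l - k) : ℝ) = l.factorial := by exact_mod_cast e3
  have h1 : (k.factorial : ℝ) ≠ 0 := by positivity
  have h2 : (l.factorial : ℝ) ≠ 0 := by positivity
  have e5 : Real.exp (-1 * u) = Real.exp (-(u / 2)) * Real.exp (-(u / 2)) := by rw [← Real.exp_add]; congr 1; ring
  have e6 : Real.exp (u / 2) * Real.exp (-(u / 2)) = 1 := by rw [← Real.exp_add]; simp
  have e7 : (-u) ^ k = (-1) ^ k * u ^ k := by rw [← mul_pow]; simp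
  simp only [e5, e7]
  field_simp
  linear_combination ((l.choose k : ℝ) * u ^ k * (k.factorial : ℝ) * (l.descFactorial (l - k) : ℝ)) * e6 +
    ((l.choose k : ℝ) * u ^ k) * e4

lemma lag_bound (l : ℕ) (u : ℝ) (hu : 0 ≤ u) : |lag l u| ≤ ∑ k ∈ Finset.range (l + 1), (l.choose k : ℝ) * 2 ^ k := by
  rw [lag_eq]
  refine (Finset.abs_sum_le_sum_abs _ _).trans (Finset.sum_le_sum fun k _ => ?_)
  rw [mul_assoc, abs_mul, Nat.abs_cast]
  refine mul_le_mul_of_nonneg_left ?_ (by positivity)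
  rw [abs_mul, abs_div, abs_pow, abs_neg, abs_of_nonneg hu, Nat.abs_cast, abs_of_pos (Real.exp_pos _)]
  have h := Real.pow_div_factorial_le_exp (u / 2) (by positivity) k
  rw [Real.exp_neg, mul_inv_le_iff₀ (Real.exp_pos _)]
  calc u ^ k / k.factorial = 2 ^ k * ((u / 2) ^ k / k.factorial) := by rw [div_pow]; field_simp
    _ ≤ _ := by gcongr

lemma lag_cont (l : ℕ) : Continuous (lag l) := by
  have : lag l = fun u => ∑ k ∈ Finset.range (l + 1),
    (l.choose k : ℝ) * ((-u) ^ k / k.factorial) * Real.exp (-(u / 2)) := by ext u; exact lag_eq l u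
  rw [this]; fun_prop

lemma one_add_ne (x : ℝ) : (1 + I * x : ℂ) ≠ 0 := by
  intro h
  have := congrArg Complex.re h
  simp at this

lemma binom_sum (l : ℕ) (x : ℝ) : ∑ k ∈ Finset.range (l + 1), (l.choose k : ℂ) * ((-2 * I * x) ^ k / (1 + I * x) ^ (k + 1)) =
    (1 - I * x) ^ l / (1 + I * x) ^ (l + 1) := by
  have h := one_add_ne x
  have e : (1 - I * x : ℂ) / (1 + I * x) = -2 * I * x / (1 + I * x) + 1 := by field_simp; ring
  rw [pow_succ _ l, ← div_div, ← div_pow, e, add_pow, Finset.sum_div]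
  refine Finset.sum_congr rfl fun k _ => ?_
  rw [div_pow, pow_succ, one_pow]; field_simp

lemma cayley (l : ℕ) (x : ℝ) : (1 - I * x) ^ l / (1 + I * x) ^ (l + 1) = (pp (x ^ 2) : ℝ) * cexp (-(I * (((2 * l + 1) * Real.arctan x : ℝ) : ℂ))) := by
  have hP := pp_sq (x ^ 2)
  rw [kap_pos (sq_nonneg x)] at hP
  have hP0 := pp_pos (x ^ 2)
  set P := pp (x ^ 2)
  have hs : 1 / √(1 + x ^ 2) = P := by
    rw [div_eq_iff (by positivity)]
    have h1 : (P * √(1 + x ^ 2)) ^ 2 = 1 := by rw [mul_pow, Real.sq_sqrt (by positivity)]; exact hP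
    have h2 : 0 ≤ P * √(1 + x ^ 2) := by positivity
    nlinarith
  have hE : cexp (-(I * (Real.arctan x : ℝ))) = P * (1 - I * x) := by
    have : -(I * (Real.arctan x : ℝ)) = ((-Real.arctan x : ℝ) : ℂ) * I := by push_cast; ring
    rw [this, Complex.exp_mul_I, ← Complex.ofReal_cos, ← Complex.ofReal_sin, Real.cos_neg, Real.sin_neg, Real.cos_arctan, Real.sin_arctan,
      div_eq_mul_one_div x, hs]
    push_cast; ring
  have e1 : -(I * (((2 * l + 1) * Real.arctan x : ℝ) : ℂ)) = ((2 * l + 1 : ℕ) : ℂ) * (-(I * (Real.arctan x : ℝ))) := by push_cast; ring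
  rw [e1, Complex.exp_nat_mul, hE, div_eq_iff (pow_ne_zero _ (one_add_ne x))]
  have h3 : (P : ℂ) * (P * ((1 - I * x) * (1 + I * x))) = 1 := by
    have : (P : ℂ) ^ 2 * (1 + x ^ 2) = 1 := by exact_mod_cast hP
    linear_combination this - (P:ℂ) ^ 2 * x ^ 2 * I_sq
  calc (1 - I * x : ℂ) ^ l = (1 - I * x) ^ l * ((P : ℂ) * (P * ((1 - I * x) * (1 + I * x)))) ^ (l + 1) := by rw [h3, one_pow, mul_one]
    _ = _ := by
      generalize (1 - I * x : ℂ) = a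
      generalize (1 + I * x : ℂ) = b
      ring

lemma thS_val {lam : ℝ} (hl : 0 < lam) (t b : ℝ) : lam * thS (t, (lam ^ 2, b)) = Real.arctan (lam * Tt t) := by
  rw [thS_eq, ← smul_eq_mul]
  have h := intervalIntegral.smul_integral_comp_mul_left (a := 0) (b := Tt t) (fun s : ℝ => (1 + s ^ 2)⁻¹) lam
  rw [integral_inv_one_add_sq, mul_zero, Real.arctan_zero, sub_zero] at h
  rw [← h]
  congr 2; ext s
  have := mm_kap (lam ^ 2 * s ^ 2)
  rw [kap_pos (by positivity)] at this
  rw [mul_pow]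
  exact eq_inv_of_mul_eq_one_left this

lemma laS_val {lam : ℝ} (hl : 0 < lam) (t b : ℝ) : lam ^ 2 * laS (t, (lam ^ 2, b)) = Tt t - thS (t, (lam ^ 2, b)) := by
  rw [thS_eq, laS_eq, ← intervalIntegral.integral_const_mul]
  have h1 : Continuous (fun s : ℝ => mm (lam ^ 2 * s ^ 2)) := by
    have := mm_htg.1.continuous
    fun_prop
  generalize Tt t = T
  refine Eq.trans ?_ (congrArg (fun a => a - ∫ s in (0:ℝ)..T, mm (lam ^ 2 * s ^ 2)) (show ∫ s in (0:ℝ)..T, (1:ℝ) = T by simp))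
  simp only
  rw [← intervalIntegral.integral_sub (by simp) (h1.intervalIntegrable _ _)]
  congr 1; ext s
  have := mm_kap (lam ^ 2 * s ^ 2)
  rw [kap_pos (by positivity)] at this
  linarith

lemma phase_val {lam : ℝ} (hl : 0 < lam) (t r : ℝ) (l : ℕ) : (lam * (2 * l + 1) + r ^ 2) * thS (t, (lam ^ 2, lam * r)) +
    (lam * r) ^ 2 * laS (t, (lam ^ 2, lam * r)) = (2 * l + 1) * Real.arctan (lam * Tt t) + r ^ 2 * Tt t := by
  have h1 := thS_val hl t (lam * r)
  have h2 := laS_val hl t (lam * r)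
  linear_combination (2 * l + 1) * h1 + r ^ 2 * h2

/-- value of the oscillating integrand on the regular part -/
lemma integrand_val {lam : ℝ} (hl : 0 < lam) (t r : ℝ) (l : ℕ) : ((pp (lam ^ 2 * Tt t ^ 2) : ℝ) : ℂ) *
      cexp (-(I * (((lam * (2 * l + 1) + r ^ 2) * thS (t, (lam ^ 2, lam * r)) + (lam * r) ^ 2 * laS (t, (lam ^ 2, lam * r)) : ℝ) : ℂ))) =
    cexp (-(I * ((r ^ 2 * Tt t : ℝ) : ℂ))) * ∑ k ∈ Finset.range (l + 1), (l.choose k : ℂ) * ((-2 * I * ((lam * Tt t : ℝ) : ℂ)) ^ k / (1 + I * ((lam * Tt t : ℝ) : ℂ)) ^ (k + 1)) := by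
  rw [phase_val hl, binom_sum, cayley, mul_pow, mul_comm (cexp _), mul_assoc, ← Complex.exp_add]
  congr 2
  push_cast; ring

lemma thS_zero (t b : ℝ) : thS (t, (0, b)) = Tt t := by
  have h := mm_kap 0
  rw [kap_pos le_rfl, add_zero, mul_one] at h
  rw [thS_eq]; simp [h]
lemma pp_zero : pp 0 = 1 := by simp [pp, kap]

abbrev E2 := EuclideanSpace ℝ (Fin 2)

lemma swapG {α : Type} [MeasurableSpace α] {ν : Measure α} [SFinite ν] {g : E2 → ℂ} {G : α → ℂ} (hg : Integrable g)
    (hG : Integrable G ν) {th : E2 × α → ℝ} (hth : Measurable th) :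
    ∫ v, g v * ∫ p, G p * cexp (I * th (v, p)) ∂ν = ∫ p, G p * (∫ v, g v * cexp (I * th (v, p))) ∂ν := by
  have h1 : Integrable (fun z : E2 × α => g z.1 * G z.2 * cexp (I * th z)) (volume.prod ν) := by
    refine Integrable.mul_bdd (c := 1) (hg.mul_prod hG) ?_ ?_
    · exact (Complex.measurable_exp.comp ((Complex.measurable_ofReal.comp hth).const_mul I)).aestronglyMeasurable
    · refine Filter.Eventually.of_forall fun z => ?_
      rw [mul_comm, Complex.norm_exp_ofReal_mul_I]
  simp only [← integral_const_mul]
  have h2 := integral_integral_swap (f := fun v p => g v * G p * cexp (I * th (v, p))) h1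
  refine Eq.trans ?_ (h2.trans ?_)
  · congr 1; ext v; congr 1; ext p; ring
  · congr 1; ext p; congr 1; ext v; ring

lemma P_zero {G : V3 × V3 → ℂ} {ψ : ℝ → ℂ} (hG : Integrable G) (hψ : Integrable ψ)
    (h : ∀ z1 z2 : ℝ, ∫ t, ψ t * cexp (-(I * (((z1 ^ 2 + z2 ^ 2) * Tt t : ℝ) : ℂ))) =
      ∫ p, G p * cexp (I * ((z1 * p.1 0 + z2 * p.1 1 : ℝ) : ℂ))) {c : ℝ} (hc : 0 < c) :
    ∫ p, G p * cexp (-(c * (p.1 0 ^ 2 + p.1 1 ^ 2) : ℝ)) = ∫ t, ψ t * (1 / (1 + 4 * I * c * Tt t)) := by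
  set b : ℝ := 1 / (4 * c) with hb
  have hb0 : 0 < b := by positivity
  have hcc : (c : ℂ) ≠ 0 := by exact_mod_cast hc.ne'
  have hpi : (Real.pi : ℂ) ≠ 0 := by exact_mod_cast Real.pi_ne_zero
  have hbc : (b : ℂ) = 1 / (4 * c) := by rw [hb]; push_cast; rfl
  have hg : Integrable (fun v : E2 => cexp (-(b : ℂ) * ‖v‖ ^ 2)) := by
    have := GaussianFourier.integrable_cexp_neg_mul_sq_norm_add (V := E2) (b := b) (by simpa using hb0) 0 0
    simpa using this
  have hm1 : Measurable (fun z : E2 × (V3 × V3) => z.1 0 * z.2.1 0 + z.1 1 * z.2.1 1) := by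
    have : Continuous (fun z : E2 × (V3 × V3) => z.1 0 * z.2.1 0 + z.1 1 * z.2.1 1) := by fun_prop
    exact this.measurable
  have hm2 : Measurable (fun z : E2 × ℝ => -((z.1 0 ^ 2 + z.1 1 ^ 2) * Tt z.2)) := by
    have : Continuous (fun z : E2 × ℝ => -((z.1 0 ^ 2 + z.1 1 ^ 2) * Tt z.2)) := by unfold Tt; fun_prop
    exact this.measurable
  have s1 := swapG (ν := volume) hg hG hm1
  have s2 := swapG (ν := volume) hg hψ hm2
  have e0 : ∀ v : E2, (v 0 ^ 2 + v 1 ^ 2 : ℝ) = ‖v‖ ^ 2 := fun v => by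
    rw [EuclideanSpace.norm_sq_eq]; simp
  have s3 : ∀ v : E2, ∫ p, G p * cexp (I * ((v 0 * p.1 0 + v 1 * p.1 1 : ℝ) : ℂ)) = 
    ∫ t, ψ t * cexp (I * ((-((v 0 ^ 2 + v 1 ^ 2) * Tt t) : ℝ) : ℂ)) := fun v => by
    rw [← h]
    congr 1; ext t; congr 2
    push_cast; ring
  simp only [s3] at s1
  rw [s1] at s2
  have i1 : ∀ p : V3 × V3, ∫ v : E2, cexp (-(b : ℂ) * ‖v‖ ^ 2) * cexp (I * ((v 0 * p.1 0 + v 1 * p.1 1 : ℝ) : ℂ)) =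
      4 * Real.pi * c * cexp (-(c * (p.1 0 ^ 2 + p.1 1 ^ 2) : ℝ)) := fun p => by
    have := GaussianFourier.integral_cexp_neg_mul_sq_norm_add (V := E2) (b := b) (by simpa using hb0) I (!₂[p.1 0, p.1 1])
    simp only [← Complex.exp_add]
    have h1 : ∀ v : E2, inner ℝ (!₂[p.1 0, p.1 1] : E2) v = v 0 * p.1 0 + v 1 * p.1 1 := fun v => by
      simp [PiLp.inner_apply]
    simp only [h1] at this
    rw [this, hbc]
    congr 1
    · simp; field_simp
    · congr 1
      rw [← Complex.ofReal_pow, ← e0, I_sq]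
      simp
      field_simp
      ring
  have i2 : ∀ t : ℝ, ∫ v : E2, cexp (-(b : ℂ) * ‖v‖ ^ 2) * cexp (I * ((-((v 0 ^ 2 + v 1 ^ 2) * Tt t) : ℝ) : ℂ)) =
      4 * Real.pi * c * (1 / (1 + 4 * I * c * Tt t)) := fun t => by
    have := GaussianFourier.integral_cexp_neg_mul_sq_norm (V := E2) (b := b + I * Tt t) (by simpa using hb0)
    simp only [← Complex.exp_add, e0]
    have h1 : (1 + 4 * I * c * Tt t : ℂ) ≠ 0 := by
      have := one_add_ne (4 * c * Tt t)
      push_cast at this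
      convert this using 2; ring
    have h2 : (b + I * Tt t : ℂ) = (1 + 4 * I * c * Tt t) / (4 * c) := by rw [hbc]; field_simp
    refine Eq.trans ?_ (this.trans ?_)
    · congr 1; ext v; congr 1; push_cast; ring
    · rw [h2]; simp; field_simp
  simp only [i1, i2] at s2
  have k1 : (4 * Real.pi * c : ℂ) ≠ 0 := by simp [hcc, hpi]
  have s4 : (4 * Real.pi * c : ℂ) * ∫ p, G p * cexp (-(c * (p.1 0 ^ 2 + p.1 1 ^ 2) : ℝ)) =
     (4 * Real.pi * c : ℂ) * ∫ t, ψ t * (1 / (1 + 4 * I * c * Tt t)) := by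
    rw [← integral_const_mul, ← integral_const_mul]
    refine Eq.trans ?_ (s2.trans ?_)
    · congr 1; ext p; ring
    · congr 1; ext p; ring
  exact mul_left_cancel₀ k1 s4

lemma dint {α : Type} [MeasurableSpace α] {ν : Measure α} {K : ℕ → ℝ → α → ℂ} {B : ℕ → α → ℝ}
    (hm : ∀ k c, AEStronglyMeasurable (K k c) ν) (hB : ∀ k, Integrable (B k) ν)
    (hK : ∀ k c a, 0 < c → ‖K k c a‖ ≤ B k a) (hd : ∀ k c a, 0 < c → HasDerivAt (fun c => K k c a) (-K (k + 1) c a) c)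
    (k : ℕ) {c : ℝ} (hc : 0 < c) : HasDerivAt (fun c => ∫ a, K k c a ∂ν) (-∫ a, K (k + 1) c a ∂ν) c := by
  have := hasDerivAt_integral_of_dominated_loc_of_deriv_le (μ := ν) (F := K k) (F' := fun c a => -K (k + 1) c a)
    (bound := B (k + 1)) (x₀ := c) (Ioi_mem_nhds hc) (Filter.Eventually.of_forall fun c => hm k c)
    ((hB k).mono' (hm k c) (Filter.Eventually.of_forall fun a => hK k c a hc)) (hm (k + 1) c).neg
    (Filter.Eventually.of_forall fun a x hx => by rw [norm_neg]; exact hK _ _ _ hx) (hB (k + 1))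
    (Filter.Eventually.of_forall fun a x hx => hd k x a hx)
  rw [integral_neg] at this
  exact this.2

lemma P_succ {α β : Type} [MeasurableSpace α] {ν : Measure α} {K : ℕ → ℝ → α → ℂ} {B : ℕ → α → ℝ}
    [MeasurableSpace β] {ν' : Measure β} {K' : ℕ → ℝ → β → ℂ} {B' : ℕ → β → ℝ}
    (hm : ∀ k c, AEStronglyMeasurable (K k c) ν) (hB : ∀ k, Integrable (B k) ν)
    (hK : ∀ k c a, 0 < c → ‖K k c a‖ ≤ B k a) (hd : ∀ k c a, 0 < c → HasDerivAt (fun c => K k c a) (-K (k + 1) c a) c)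
    (hm' : ∀ k c, AEStronglyMeasurable (K' k c) ν') (hB' : ∀ k, Integrable (B' k) ν')
    (hK' : ∀ k c a, 0 < c → ‖K' k c a‖ ≤ B' k a) (hd' : ∀ k c a, 0 < c → HasDerivAt (fun c => K' k c a) (-K' (k + 1) c a) c)
    (h0 : ∀ c, 0 < c → ∫ a, K 0 c a ∂ν = ∫ a, K' 0 c a ∂ν') (k : ℕ) :
    ∀ c, 0 < c → ∫ a, K k c a ∂ν = ∫ a, K' k c a ∂ν' := by
  induction k with
  | zero => exact h0
  | succ k ih =>
    intro c hc
    have h1 := dint hm hB hK hd k hc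
    have h2 := dint hm' hB' hK' hd' k hc
    have h3 : (fun c => ∫ a, K k c a ∂ν) =ᶠ[𝓝 c] fun c => ∫ a, K' k c a ∂ν' := by
      filter_upwards [Ioi_mem_nhds hc] with x hx using ih x hx
    exact neg_injective ((h1.congr_of_eventuallyEq h3.symm).unique h2)

def rh (p : V3 × V3) : ℝ := p.1 0 ^ 2 + p.1 1 ^ 2
lemma rh_nonneg (p : V3 × V3) : 0 ≤ rh p := by unfold rh; positivity
lemma rh_cont : Continuous rh := by unfold rh; fun_prop
lemma rh_htg : rh.HasTemperateGrowth := by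
  have h : ∀ j : Fin 3, (fun p : V3 × V3 => p.1 j).HasTemperateGrowth := fun j =>
    ((ContinuousLinearMap.proj (R := ℝ) (φ := fun _ : Fin 3 => ℝ) j).comp (ContinuousLinearMap.fst ℝ V3 V3)).hasTemperateGrowth
  exact ((h 0).pow 2).add ((h 1).pow 2)

lemma den_norm (x : ℝ) : 1 ≤ ‖(1 + 4 * I * x : ℂ)‖ := by
  have := Complex.abs_re_le_norm (1 + 4 * I * x : ℂ)
  simpa using this

lemma den_ne (x : ℝ) : (1 + 4 * I * x : ℂ) ≠ 0 := by
  intro h; have := den_norm x; rw [h] at this; norm_num at this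

lemma F_int (F : 𝓢(V3 × V3, ℂ)) : Integrable ⇑F :=
  (e6_mp.integrable_comp_emb e6.toHomeomorph.measurableEmbedding).1
    (SchwartzMap.compCLMOfContinuousLinearEquiv ℝ e6 F).integrable

lemma Pk (F : 𝓢(V3 × V3, ℂ)) (ψ : 𝓢(ℝ, ℂ)) {e : V3 × V3 → ℂ} {e' : ℝ → ℂ} (he : Continuous e) (he' : Continuous e')
    (hn : ∀ p, ‖e p‖ = 1) (hn' : ∀ t, ‖e' t‖ = 1)
    (h : ∀ z1 z2 : ℝ, ∫ t, ψ t * e' t * cexp (-(I * (((z1 ^ 2 + z2 ^ 2) * Tt t : ℝ) : ℂ))) =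
      ∫ p, F p * e p * cexp (I * ((z1 * p.1 0 + z2 * p.1 1 : ℝ) : ℂ))) {c : ℝ} (hc : 0 < c) (k : ℕ) :
    Integrable (fun p => F p * e p * (rh p : ℂ) ^ k * cexp (((-(c * rh p) : ℝ) : ℂ))) ∧
    Integrable (fun t => ψ t * e' t * k.factorial * ((4 * I * Tt t) ^ k / (1 + 4 * I * ((c * Tt t : ℝ) : ℂ)) ^ (k + 1))) ∧
    ∫ p, F p * e p * (rh p : ℂ) ^ k * cexp (((-(c * rh p) : ℝ) : ℂ)) =
    ∫ t, ψ t * e' t * k.factorial * ((4 * I * Tt t) ^ k / (1 + 4 * I * ((c * Tt t : ℝ) : ℂ)) ^ (k + 1)) := by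
  let K : ℕ → ℝ → V3 × V3 → ℂ := fun k c p => F p * e p * (rh p : ℂ) ^ k * cexp (((-(c * rh p) : ℝ) : ℂ))
  let K' : ℕ → ℝ → ℝ → ℂ := fun k c t => ψ t * e' t * k.factorial * ((4 * I * Tt t) ^ k / (1 + 4 * I * ((c * Tt t : ℝ) : ℂ)) ^ (k + 1))
  let B : ℕ → V3 × V3 → ℝ := fun k p => ‖F p * (rh p : ℂ) ^ k‖
  let B' : ℕ → ℝ → ℝ := fun k t => ‖ψ t * (4 * I * Tt t) ^ k‖ * k.factorial
  have hTc : Continuous Tt := by unfold Tt; fun_prop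
  have hTh : Tt.HasTemperateGrowth := by
    exact htg_Tt.comp (ContinuousLinearMap.hasTemperateGrowth (ContinuousLinearMap.inl ℝ ℝ (ℝ × ℝ)))
  have hm : ∀ k c, AEStronglyMeasurable (K k c) volume := fun k c => by
    have : Continuous (K k c) := by
      have := rh_cont; have := F.continuous
      simp only [K]; fun_prop
    exact this.aestronglyMeasurable
  have hm' : ∀ k c, AEStronglyMeasurable (K' k c) volume := fun k c => by
    have : Continuous (K' k c) := by
      have := ψ.continuous
      simp only [K']
      refine Continuous.mul (by fun_prop) (Continuous.div (by fun_prop) (by fun_prop) fun t => pow_ne_zero _ (den_ne _))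
    exact this.aestronglyMeasurable
  have hB : ∀ k, Integrable (B k) := fun k => by
    have := F_int (mulS ((htg_ofReal rh_htg).pow k) F)
    exact this.norm
  have hB' : ∀ k, Integrable (B' k) := fun k => by
    have := (mulS (((Function.HasTemperateGrowth.const (4 * I)).mul (htg_ofReal hTh)).pow k) ψ).integrable (μ := volume)
    exact this.norm.mul_const _
  have hK : ∀ k c a, 0 < c → ‖K k c a‖ ≤ B k a := fun k c a hc => by
    simp only [K, B, norm_mul, hn, mul_one, Complex.norm_exp_ofReal]
    refine mul_le_of_le_one_right (by positivity) (Real.exp_le_one_iff.2 ?_)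
    have := mul_nonneg hc.le (rh_nonneg a)
    linarith
  have hK' : ∀ k c a, 0 < c → ‖K' k c a‖ ≤ B' k a := fun k c a hc => by
    have h1 : ‖K' k c a‖ = B' k a * ‖((1 + 4 * I * ((c * Tt a : ℝ) : ℂ)) ^ (k + 1))‖⁻¹ := by
      simp only [K', B', norm_mul, norm_div, hn', mul_one, Complex.norm_natCast]
      ring
    rw [h1]
    refine mul_le_of_le_one_right (by positivity) (inv_le_one_of_one_le₀ ?_)
    rw [norm_pow]
    exact one_le_pow₀ (den_norm _)
  have hd : ∀ k c a, 0 < c → HasDerivAt (fun c => K k c a) (-K (k + 1) c a) c := fun k c a _ => by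
    have h1 : HasDerivAt (fun c : ℝ => ((-(c * rh a) : ℝ) : ℂ)) ((-(1 * rh a) : ℝ) : ℂ) c :=
      ((hasDerivAt_id c).mul_const (rh a)).neg.ofReal_comp
    refine (h1.cexp.const_mul (F a * e a * (rh a : ℂ) ^ k)).congr_deriv ?_
    simp only [K]; push_cast; ring
  have hd' : ∀ k c a, 0 < c → HasDerivAt (fun c => K' k c a) (-K' (k + 1) c a) c := fun k c a _ => by
    have h1 : HasDerivAt (fun c : ℝ => ((c * Tt a : ℝ) : ℂ)) ((1 * Tt a : ℝ) : ℂ) c :=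
      ((hasDerivAt_id c).mul_const (Tt a)).ofReal_comp
    have h2 := ((h1.const_mul (4 * I)).const_add 1).pow (k + 1)
    have h3 := (h2.inv (pow_ne_zero _ (den_ne _))).const_mul (ψ a * e' a * k.factorial * (4 * I * Tt a) ^ k)
    have hne := den_ne (c * Tt a)
    refine (h3.congr_deriv ?_).congr_of_eventuallyEq (Filter.Eventually.of_forall fun x => ?_)
    · simp only [K', Nat.factorial_succ]
      push_cast at hne ⊢
      simp only [one_mul, Pi.pow_apply]
      push_cast
      generalize (1 + 4 * I * ((c : ℂ) * (Tt a : ℂ))) = D at hne ⊢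
      rw [pow_succ (4 * I * (Tt a : ℂ)) k]
      field_simp
      ring
    · simp only [K']; push_cast; simp [div_eq_mul_inv]; ring
  have h0 : ∀ c, 0 < c → ∫ a, K 0 c a = ∫ a, K' 0 c a := fun c hc => by
    have iF : Integrable (fun p => F p * e p) := Integrable.mul_bdd (c := 1) (F_int F) he.aestronglyMeasurable
      (Filter.Eventually.of_forall fun p => (hn p).le)
    have iψ : Integrable (fun t => ψ t * e' t) := Integrable.mul_bdd (c := 1) ψ.integrable he'.aestronglyMeasurable
      (Filter.Eventually.of_forall fun p => (hn' p).le)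
    refine Eq.trans ?_ ((P_zero iF iψ h hc).trans ?_)
    · simp only [K, rh]; congr 1; ext p; push_cast; ring
    · simp only [K']; congr 1; ext p; push_cast; simp; left; ring
  exact ⟨(hB k).mono' (hm k c) (Filter.Eventually.of_forall fun a => hK k c a hc),
    (hB' k).mono' (hm' k c) (Filter.Eventually.of_forall fun a => hK' k c a hc),
    P_succ hm hB hK hd hm' hB' hK' hd' h0 k c hc⟩

def Kq (lam : ℝ) (l : ℕ) (r : ℝ) (p : V3 × V3) : ℂ :=
  cexp (I * ((lam * p.2 2 : ℝ) : ℂ)) * (lag l (lam / 2 * rh p) : ℝ) * cexp (I * ((r * p.1 2 : ℝ) : ℂ))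

lemma reg_eq (F : 𝓢(V3 × V3, ℂ)) (ψ : 𝓢(ℝ, ℂ)) {lam r : ℝ} (l : ℕ) (hl : 0 < lam)
    (h : ∀ z1 z2 : ℝ, ∫ t, ψ t * cexp (-(I * (((z1 ^ 2 + z2 ^ 2 + r ^ 2) * Tt t : ℝ) : ℂ))) =
      ∫ p, F p * cexp (I * ((z1 * p.1 0 + z2 * p.1 1 + r * p.1 2 + lam * p.2 2 : ℝ) : ℂ))) :
    ∫ t, ψ t * (pp (lam ^ 2 * Tt t ^ 2) : ℝ) * cexp (-(I * (((lam * (2 * l + 1) + r ^ 2) * thS (t, (lam ^ 2, lam * r)) +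
      (lam * r) ^ 2 * laS (t, (lam ^ 2, lam * r)) : ℝ) : ℂ))) = ∫ p, F p * Kq lam l r p := by
  have hTc : Continuous Tt := by unfold Tt; fun_prop
  have key := Pk F ψ (e := fun p => cexp (I * ((r * p.1 2 + lam * p.2 2 : ℝ) : ℂ)))
    (e' := fun t => cexp (-(I * ((r ^ 2 * Tt t : ℝ) : ℂ)))) (by fun_prop) (by fun_prop)
    (fun p => by rw [mul_comm, Complex.norm_exp_ofReal_mul_I])
    (fun t => by rw [← mul_neg, ← Complex.ofReal_neg, mul_comm, Complex.norm_exp_ofReal_mul_I])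
    (fun z1 z2 => by
      refine Eq.trans ?_ ((h z1 z2).trans ?_)
      · congr 1; ext t; rw [mul_assoc, ← Complex.exp_add]; congr 2; push_cast; ring
      · congr 1; ext t; rw [mul_assoc, ← Complex.exp_add]; congr 2; push_cast; ring) (c := lam / 4) (by positivity)
  have e1 : ∀ t, ψ t * (pp (lam ^ 2 * Tt t ^ 2) : ℝ) * cexp (-(I * (((lam * (2 * l + 1) + r ^ 2) * thS (t, (lam ^ 2, lam * r)) +
      (lam * r) ^ 2 * laS (t, (lam ^ 2, lam * r)) : ℝ) : ℂ))) = ∑ k ∈ Finset.range (l + 1),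
      ((l.choose k : ℂ) * ((-(lam / 2)) ^ k / k.factorial)) * (ψ t * cexp (-(I * ((r ^ 2 * Tt t : ℝ) : ℂ))) * k.factorial *
        ((4 * I * Tt t) ^ k / (1 + 4 * I * ((lam / 4 * Tt t : ℝ) : ℂ)) ^ (k + 1))) := fun t => by
    rw [mul_assoc, integrand_val hl, ← mul_assoc, Finset.mul_sum]
    refine Finset.sum_congr rfl fun k _ => ?_
    have hk : (k.factorial : ℂ) ≠ 0 := by exact_mod_cast k.factorial_ne_zero
    have a1 : (-2 * I * ((lam * Tt t : ℝ) : ℂ)) ^ k = (-(lam / 2)) ^ k * (4 * I * Tt t) ^ k := by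
      rw [← mul_pow]; congr 1; push_cast; ring
    have a2 : (1 + I * ((lam * Tt t : ℝ) : ℂ)) = 1 + 4 * I * ((lam / 4 * Tt t : ℝ) : ℂ) := by push_cast; ring
    rw [a1, a2]
    have := den_ne (lam / 4 * Tt t)
    field_simp
  have e2 : ∀ p, F p * Kq lam l r p = ∑ k ∈ Finset.range (l + 1),
      ((l.choose k : ℂ) * ((-(lam / 2)) ^ k / k.factorial)) * (F p * cexp (I * ((r * p.1 2 + lam * p.2 2 : ℝ) : ℂ)) *
        (rh p : ℂ) ^ k * cexp (((-(lam / 4 * rh p) : ℝ) : ℂ))) := fun p => by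
    have a0 : F p * Kq lam l r p = (F p * cexp (I * ((r * p.1 2 + lam * p.2 2 : ℝ) : ℂ))) * (lag l (lam / 2 * rh p) : ℝ) := by
      unfold Kq
      have : cexp (I * ((r * p.1 2 + lam * p.2 2 : ℝ) : ℂ)) = cexp (I * ((lam * p.2 2 : ℝ) : ℂ)) * cexp (I * ((r * p.1 2 : ℝ) : ℂ)) := by
        rw [← Complex.exp_add]; congr 1; push_cast; ring
      rw [this]; ring
    rw [a0, lag_eq, Complex.ofReal_sum, Finset.mul_sum]
    refine Finset.sum_congr rfl fun k _ => ?_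
    have a1 : cexp (((-(lam / 4 * rh p) : ℝ) : ℂ)) = (Real.exp (-(lam / 2 * rh p / 2)) : ℝ) := by
      rw [Complex.ofReal_exp]; congr 2; ring
    have a2 : ((((-(lam / 2 * rh p)) ^ k : ℝ)) : ℂ) = (-(lam / 2)) ^ k * (rh p : ℂ) ^ k := by
      rw [← mul_pow]; push_cast; congr 1; ring
    rw [a1, Complex.ofReal_mul, Complex.ofReal_mul, Complex.ofReal_div, a2]
    push_cast
    ring
  simp only [e1, e2]
  rw [integral_finsetSum _ fun k _ => (key k).2.1.const_mul _, integral_finsetSum _ fun k _ => (key k).1.const_mul _]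
  refine Finset.sum_congr rfl fun k _ => ?_
  rw [integral_const_mul, integral_const_mul]
  congr 1
  exact (key k).2.2.symm

lemma avg3 {μ : Measure Mat3} (hμ : IsHaarSO3 μ) (F : 𝓢(V3 × V3, ℂ)) (hF : Inv3 ⇑F) {K : V3 × V3 → ℂ} (hK : Measurable K)
    {C : ℝ} (hC : ∀ p, ‖K p‖ ≤ C) : ∫ p, F p * K p = ∫ p, F p * ∫ k, K (actp k p) ∂μ := by
  rw [e6_integral, e6_integral]
  refine avg hμ (H := fun N => F (e6 N)) (SchwartzMap.compCLMOfContinuousLinearEquiv ℝ e6 F).integrable (fun k hk N => ?_) hK hC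
  show F (e6 (actI hk N)) = F (e6 N)
  rw [actI_apply]; exact hF k hk _ _

lemma Kq_meas (lam : ℝ) (l : ℕ) (r : ℝ) : Measurable (Kq lam l r) := by
  have : Continuous (Kq lam l r) := by
    have := lag_cont l; have := rh_cont
    unfold Kq; fun_prop
  exact this.measurable

lemma Kq_bound {lam : ℝ} (hl : 0 < lam) (l : ℕ) (r : ℝ) (p : V3 × V3) :
    ‖Kq lam l r p‖ ≤ ∑ k ∈ Finset.range (l + 1), (l.choose k : ℝ) * 2 ^ k := by
  unfold Kq
  rw [norm_mul, norm_mul, mul_comm I, mul_comm I, Complex.norm_exp_ofReal_mul_I, Complex.norm_exp_ofReal_mul_I, one_mul, mul_one,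
    Complex.norm_real]
  exact lag_bound l _ (mul_nonneg (by positivity) (rh_nonneg p))

lemma reg_avg {μ : Measure Mat3} (hμ : IsHaarSO3 μ) (F : 𝓢(V3 × V3, ℂ)) (hF : Inv3 ⇑F) {lam : ℝ} (hl : 0 < lam) (l : ℕ) (r : ℝ) :
    ∫ p, F p * Kq lam l r p = ∫ p, F p * (starRingEnd ℂ) (sph μ lam l r p.1 p.2) := by
  rw [avg3 hμ F hF (Kq_meas lam l r) (Kq_bound hl l r)]
  congr 1; ext p; congr 1
  rw [sph, ← integral_conj]
  congr 1; ext k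
  simp only [Kq, rh, actp, map_mul, ← Complex.exp_conj, Complex.conj_ofReal, map_neg, Complex.conj_I]
  congr 2
  · congr 1; push_cast; ring
  · push_cast; ring

lemma SO3_mul {A B : Mat3} (hA : A ∈ SO3) (hB : B ∈ SO3) : A * B ∈ SO3 := by
  refine ⟨?_, by rw [Matrix.det_mul, hA.2, hB.2, one_mul]⟩
  rw [Matrix.transpose_mul, Matrix.mul_assoc, ← Matrix.mul_assoc B, hB.1, Matrix.one_mul, hA.1]

lemma dpar {μ : Measure Mat3} (hμ : IsHaarSO3 μ) {g g' : ℝ → Mat3 → ℂ} (hg : ∀ s, Measurable (g s)) (hg' : ∀ s, Measurable (g' s))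
    {C : ℝ} (hC : ∀ s, ∀ k ∈ SO3, ‖g s k‖ ≤ C) (hC' : ∀ s, ∀ k ∈ SO3, ‖g' s k‖ ≤ C)
    (hd : ∀ s k, HasDerivAt (fun s => g s k) (g' s k) s) (s : ℝ) :
    HasDerivAt (fun s => ∫ k, g s k ∂μ) (∫ k, g' s k ∂μ) s := by
  have := hμ.1
  refine (hasDerivAt_integral_of_dominated_loc_of_deriv_le (μ := μ) (F := g) (F' := g') (bound := fun _ => C) (x₀ := s)
    Filter.univ_mem (Filter.Eventually.of_forall fun s => (hg s).aestronglyMeasurable) ?_ (hg' s).aestronglyMeasurable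
    ?_ (integrable_const C) (Filter.Eventually.of_forall fun k x _ => hd x k)).2
  · refine Integrable.of_bound (hg s).aestronglyMeasurable C ?_
    filter_upwards [SO3_ae hμ] with k hk using hC s k hk
  · filter_upwards [SO3_ae hμ] with k hk x _ using hC' x k hk

/-- moments of the zonal exponential -/
def mom (μ : Measure Mat3) (x : V3) (n : ℕ) (s : ℝ) : ℂ :=
  ∫ k, (((k.mulVec x) 2 : ℝ) : ℂ) ^ n * cexp (I * ((s * (k.mulVec x) 2 : ℝ) : ℂ)) ∂μ

def ei (s : ℝ) : ℂ := cexp (I * (s : ℂ))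
lemma ei_norm (s : ℝ) : ‖ei s‖ = 1 := by rw [ei, mul_comm, Complex.norm_exp_ofReal_mul_I]
lemma ei_cont : Continuous ei := by unfold ei; fun_prop
lemma ei_deriv {f : ℝ → ℝ} {f' s : ℝ} (h : HasDerivAt f f' s) : HasDerivAt (fun s => ei (f s)) (I * f' * ei (f s)) s := by
  refine ((h.ofReal_comp.const_mul I).cexp).congr_deriv ?_
  unfold ei; ring

lemma mom_deriv {μ : Measure Mat3} (hμ : IsHaarSO3 μ) (x : V3) (n : ℕ) (s : ℝ) :
    HasDerivAt (mom μ x n) (I * mom μ x (n + 1) s) s := by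
  have hm : ∀ (n : ℕ) s, Measurable fun k : Mat3 => (((k.mulVec x) 2 : ℝ) : ℂ) ^ n * ei (s * (k.mulVec x) 2) := fun n s =>
    ((Complex.measurable_ofReal.comp (meas_mv x 2)).pow_const n).mul (ei_cont.measurable.comp ((meas_mv x 2).const_mul s))
  have hb : ∀ (n : ℕ) s, ∀ k ∈ SO3, ‖(((k.mulVec x) 2 : ℝ) : ℂ) ^ n * ei (s * (k.mulVec x) 2)‖ ≤ b3 x ^ n := fun n s k hk => by
    rw [norm_mul, ei_norm, mul_one, norm_pow, Complex.norm_real]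
    exact pow_le_pow_left₀ (norm_nonneg _) (SO3_mv hk x 2) n
  have h0 := b3_nonneg x
  have := dpar hμ (g := fun s k => (((k.mulVec x) 2 : ℝ) : ℂ) ^ n * ei (s * (k.mulVec x) 2))
    (g' := fun s k => I * ((((k.mulVec x) 2 : ℝ) : ℂ) ^ (n + 1) * ei (s * (k.mulVec x) 2))) (hm n) (fun s => (hm (n + 1) s).const_mul I)
    (C := b3 x ^ n + b3 x ^ (n + 1)) (fun s k hk => (hb n s k hk).trans (by linarith [pow_nonneg h0 (n + 1)]))
    (fun s k hk => by rw [norm_mul, Complex.norm_I, one_mul]; exact (hb (n + 1) s k hk).trans (by linarith [pow_nonneg h0 n]))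
    (fun s k => by
      refine ((ei_deriv ((hasDerivAt_id s).mul_const ((k.mulVec x) 2))).const_mul _).congr_deriv ?_
      simp; ring) s
  rw [integral_const_mul] at this
  exact this

lemma mom_rot {μ : Measure Mat3} (hμ : IsHaarSO3 μ) (x : V3) (s : ℝ) :
    mom μ x 1 s = I * s * ∫ k, (((k.mulVec x) 1 : ℝ) : ℂ) ^ 2 * ei (s * (k.mulVec x) 2) ∂μ := by
  have := hμ.1
  have h0 := b3_nonneg x
  let c1 : ℝ → Mat3 → ℝ := fun a k => Real.cos a * (k.mulVec x) 1 - Real.sin a * (k.mulVec x) 2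
  let c2 : ℝ → Mat3 → ℝ := fun a k => Real.sin a * (k.mulVec x) 1 + Real.cos a * (k.mulVec x) 2
  have m1 : ∀ a, Measurable (c1 a) := fun a => ((meas_mv x 1).const_mul _).sub ((meas_mv x 2).const_mul _)
  have m2 : ∀ a, Measurable (c2 a) := fun a => ((meas_mv x 1).const_mul _).add ((meas_mv x 2).const_mul _)
  have r1 : ∀ a k, ((R12 a * k).mulVec x) 1 = c1 a k := fun a k => by
    rw [← Matrix.mulVec_mulVec]; simp [R12, Matrix.mulVec, dotProduct, Fin.sum_univ_three, c1]; ring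
  have r2 : ∀ a k, ((R12 a * k).mulVec x) 2 = c2 a k := fun a k => by
    rw [← Matrix.mulVec_mulVec]; simp [R12, Matrix.mulVec, dotProduct, Fin.sum_univ_three, c2]
  have n1 : ∀ a, ∀ k ∈ SO3, |c1 a k| ≤ b3 x := fun a k hk => by
    rw [← r1]; exact SO3_mv (SO3_mul (R12_mem a) hk) x 1
  have n2 : ∀ a, ∀ k ∈ SO3, |c2 a k| ≤ b3 x := fun a k hk => by
    rw [← r2]; exact SO3_mv (SO3_mul (R12_mem a) hk) x 2
  have hf : Measurable fun k : Mat3 => (((k.mulVec x) 1 : ℝ) : ℂ) * ei (s * (k.mulVec x) 2) :=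
    (Complex.measurable_ofReal.comp (meas_mv x 1)).mul (ei_cont.measurable.comp ((meas_mv x 2).const_mul s))
  have hJ : ∀ a, ∫ k, (c1 a k : ℂ) * ei (s * c2 a k) ∂μ = ∫ k, (((k.mulVec x) 1 : ℝ) : ℂ) * ei (s * (k.mulVec x) 2) ∂μ := fun a => by
    rw [← haar_inv hμ (R12_mem a) hf]
    simp only [r1, r2]
  have hD := dpar hμ (g := fun a k => (c1 a k : ℂ) * ei (s * c2 a k))
    (g' := fun a k => -((c2 a k : ℂ) * ei (s * c2 a k)) + I * s * ((c1 a k : ℂ) ^ 2 * ei (s * c2 a k)))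
    (C := b3 x + |s| * b3 x ^ 2)
    (fun a => (Complex.measurable_ofReal.comp (m1 a)).mul (ei_cont.measurable.comp ((m2 a).const_mul s)))
    (fun a => ((Complex.measurable_ofReal.comp (m2 a)).mul (ei_cont.measurable.comp ((m2 a).const_mul s))).neg.add
      ((((Complex.measurable_ofReal.comp (m1 a)).pow_const 2).mul (ei_cont.measurable.comp ((m2 a).const_mul s))).const_mul _))
    (fun a k hk => by
      rw [norm_mul, ei_norm, mul_one, Complex.norm_real]
      refine (n1 a k hk).trans ?_
      have : 0 ≤ |s| * b3 x ^ 2 := by positivity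
      linarith)
    (fun a k hk => by
      refine (norm_add_le _ _).trans ?_
      rw [norm_neg, norm_mul, ei_norm, mul_one, norm_mul, norm_mul, norm_mul, ei_norm, mul_one, norm_pow, Complex.norm_real, Complex.norm_I, one_mul,
        Complex.norm_real, Complex.norm_real]
      exact add_le_add (n2 a k hk) (mul_le_mul_of_nonneg_left (pow_le_pow_left₀ (norm_nonneg _) (n1 a k hk) 2) (abs_nonneg _)))
    (fun a k => by
      have d1 : HasDerivAt (fun a => c1 a k) (-c2 a k) a := by
        refine (((Real.hasDerivAt_cos a).mul_const _).sub ((Real.hasDerivAt_sin a).mul_const _)).congr_deriv ?_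
        simp only [c2]; ring
      have d2 : HasDerivAt (fun a => c2 a k) (c1 a k) a := by
        refine (((Real.hasDerivAt_sin a).mul_const _).add ((Real.hasDerivAt_cos a).mul_const _)).congr_deriv ?_
        simp only [c1]; ring
      refine (d1.ofReal_comp.mul (ei_deriv (d2.const_mul s))).congr_deriv ?_
      push_cast; ring) 0
  simp only [hJ] at hD
  have h2 := hD.unique (hasDerivAt_const 0 _)
  simp only [c1, c2, Real.cos_zero, Real.sin_zero, one_mul, zero_mul, sub_zero, zero_add] at h2
  have i1 : Integrable (fun k : Mat3 => (((k.mulVec x) 2 : ℝ) : ℂ) * ei (s * (k.mulVec x) 2)) μ := by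
    refine Integrable.of_bound ((Complex.measurable_ofReal.comp (meas_mv x 2)).mul (ei_cont.measurable.comp ((meas_mv x 2).const_mul s))).aestronglyMeasurable (b3 x) ?_
    filter_upwards [SO3_ae hμ] with k hk
    rw [norm_mul, ei_norm, mul_one, Complex.norm_real]; exact SO3_mv hk x 2
  have i2 : Integrable (fun k : Mat3 => (((k.mulVec x) 1 : ℝ) : ℂ) ^ 2 * ei (s * (k.mulVec x) 2)) μ := by
    refine Integrable.of_bound (((Complex.measurable_ofReal.comp (meas_mv x 1)).pow_const 2).mul (ei_cont.measurable.comp ((meas_mv x 2).const_mul s))).aestronglyMeasurable (b3 x ^ 2) ?_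
    filter_upwards [SO3_ae hμ] with k hk
    rw [norm_mul, ei_norm, mul_one, norm_pow, Complex.norm_real]; exact pow_le_pow_left₀ (norm_nonneg _) (SO3_mv hk x 1) 2
  have i3 : Integrable (fun k : Mat3 => -((((k.mulVec x) 2 : ℝ) : ℂ) * ei (s * (k.mulVec x) 2))) μ := i1.neg
  rw [integral_add i3 (i2.const_mul _), integral_neg, integral_const_mul] at h2
  have h3 : mom μ x 1 s = ∫ k, (((k.mulVec x) 2 : ℝ) : ℂ) * ei (s * (k.mulVec x) 2) ∂μ := by
    simp only [mom, pow_one, ei]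
  rw [h3]
  linear_combination -h2

lemma mom_eq {μ : Measure Mat3} (hμ : IsHaarSO3 μ) (x : V3) (s : ℝ) :
    2 * mom μ x 1 s = I * s * ((nrm3 x : ℂ) ^ 2 * mom μ x 0 s - mom μ x 2 s) := by
  have := hμ.1
  have i2 : ∀ j, Integrable (fun k : Mat3 => (((k.mulVec x) j : ℝ) : ℂ) ^ 2 * ei (s * (k.mulVec x) 2)) μ := fun j => by
    refine Integrable.of_bound (((Complex.measurable_ofReal.comp (meas_mv x j)).pow_const 2).mul (ei_cont.measurable.comp ((meas_mv x 2).const_mul s))).aestronglyMeasurable (b3 x ^ 2) ?_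
    filter_upwards [SO3_ae hμ] with k hk
    rw [norm_mul, ei_norm, mul_one, norm_pow, Complex.norm_real]; exact pow_le_pow_left₀ (norm_nonneg _) (SO3_mv hk x j) 2
  have hf : Measurable fun k : Mat3 => (((k.mulVec x) 0 : ℝ) : ℂ) ^ 2 * ei (s * (k.mulVec x) 2) :=
    ((Complex.measurable_ofReal.comp (meas_mv x 0)).pow_const 2).mul (ei_cont.measurable.comp ((meas_mv x 2).const_mul s))
  have h1 := haar_inv hμ (R01_mem (Real.pi / 2)) hf
  have r0 : ∀ k, ((R01 (Real.pi / 2) * k).mulVec x) 0 = -(k.mulVec x) 1 := fun k => by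
    rw [← Matrix.mulVec_mulVec]; simp [R01, Matrix.mulVec, dotProduct, Fin.sum_univ_three]
  have r2 : ∀ k, ((R01 (Real.pi / 2) * k).mulVec x) 2 = (k.mulVec x) 2 := fun k => by
    rw [← Matrix.mulVec_mulVec]; simp [R01, Matrix.mulVec, dotProduct, Fin.sum_univ_three]
  simp only [r0, r2, Complex.ofReal_neg, neg_sq] at h1
  have h2 : (nrm3 x : ℂ) ^ 2 * mom μ x 0 s = (∫ k, (((k.mulVec x) 0 : ℝ) : ℂ) ^ 2 * ei (s * (k.mulVec x) 2) ∂μ) +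
      (∫ k, (((k.mulVec x) 1 : ℝ) : ℂ) ^ 2 * ei (s * (k.mulVec x) 2) ∂μ) + mom μ x 2 s := by
    have e2 : mom μ x 2 s = ∫ k, (((k.mulVec x) 2 : ℝ) : ℂ) ^ 2 * ei (s * (k.mulVec x) 2) ∂μ := rfl
    have i3 : Integrable (fun k : Mat3 => (((k.mulVec x) 0 : ℝ) : ℂ) ^ 2 * ei (s * (k.mulVec x) 2) +
      (((k.mulVec x) 1 : ℝ) : ℂ) ^ 2 * ei (s * (k.mulVec x) 2)) μ := (i2 0).add (i2 1)
    rw [e2, ← integral_add (i2 0) (i2 1), ← integral_add i3 (i2 2), mom, ← integral_const_mul]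
    refine integral_congr_ae ?_
    filter_upwards [SO3_ae hμ] with k hk
    have h3 := SO3_dot hk x x
    simp only [Fin.sum_univ_three] at h3
    have h4 : nrm3 x ^ 2 = (k.mulVec x) 0 ^ 2 + (k.mulVec x) 1 ^ 2 + (k.mulVec x) 2 ^ 2 := by
      rw [nrm3, Real.sq_sqrt (by positivity)]; linarith
    rw [← Complex.ofReal_pow, h4]
    simp only [ei, Pi.add_apply]
    push_cast; ring
  rw [mom_rot hμ, h2, h1]; ring

lemma sinc_int {μ : Measure Mat3} (hμ : IsHaarSO3 μ) (x : V3) (s : ℝ) :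
    (nrm3 x : ℂ) * (s * mom μ x 0 s) = (Real.sin (nrm3 x * s) : ℝ) := by
  have := hμ.1
  set ρ := nrm3 x with hρ
  have dA := mom_deriv hμ x 0
  have dB := mom_deriv hμ x 1
  have ds : ∀ s : ℝ, HasDerivAt (fun s : ℝ => (s : ℂ)) 1 s := fun s => (hasDerivAt_id s).ofReal_comp
  let h : ℝ → ℂ := fun s => s * mom μ x 0 s
  let h' : ℝ → ℂ := fun s => mom μ x 0 s + I * (s * mom μ x 1 s)
  have dh : ∀ s, HasDerivAt h (h' s) s := fun s => by
    refine ((ds s).mul (dA s)).congr_deriv ?_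
    simp only [h']; ring
  have dh' : ∀ s, HasDerivAt h' (-(ρ : ℂ) ^ 2 * h s) s := fun s => by
    refine ((dA s).add (((ds s).mul (dB s)).const_mul I)).congr_deriv ?_
    have := mom_eq hμ x s
    simp only [h]
    linear_combination I * this + s * (ρ ^ 2 * mom μ x 0 s - mom μ x 2 s + mom μ x 2 s) * I_sq
  have dc : ∀ s, HasDerivAt (fun s => ((Real.cos (ρ * s) : ℝ) : ℂ)) (-(ρ * (Real.sin (ρ * s) : ℝ))) s := fun s => by
    refine (((hasDerivAt_id s).const_mul ρ).cos.ofReal_comp).congr_deriv ?_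
    push_cast; simp; ring
  have dn : ∀ s, HasDerivAt (fun s => ((Real.sin (ρ * s) : ℝ) : ℂ)) (ρ * (Real.cos (ρ * s) : ℝ)) s := fun s => by
    refine (((hasDerivAt_id s).const_mul ρ).sin.ofReal_comp).congr_deriv ?_
    push_cast; simp; ring
  have hp : ∀ s, HasDerivAt (fun s => h' s * (Real.cos (ρ * s) : ℝ) + ρ * (h s * (Real.sin (ρ * s) : ℝ))) 0 s := fun s => by
    refine (((dh' s).mul (dc s)).add (((dh s).mul (dn s)).const_mul (ρ : ℂ))).congr_deriv ?_
    ring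
  have hq : ∀ s, HasDerivAt (fun s => h' s * (Real.sin (ρ * s) : ℝ) - ρ * (h s * (Real.cos (ρ * s) : ℝ))) 0 s := fun s => by
    refine (((dh' s).mul (dn s)).sub (((dh s).mul (dc s)).const_mul (ρ : ℂ))).congr_deriv ?_
    ring
  have p0 := is_const_of_deriv_eq_zero (fun s => (hp s).differentiableAt) (fun s => (hp s).deriv) s 0
  have q0 := is_const_of_deriv_eq_zero (fun s => (hq s).differentiableAt) (fun s => (hq s).deriv) s 0
  have m0 : mom μ x 0 0 = 1 := by simp [mom]
  simp [h, h', m0] at p0 q0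
  have hsc : (Complex.sin (ρ * s)) ^ 2 + (Complex.cos (ρ * s)) ^ 2 = 1 := Complex.sin_sq_add_cos_sq _
  push_cast
  linear_combination Complex.sin (ρ * s) * p0 - Complex.cos (ρ * s) * q0 - ρ * (s * mom μ x 0 s) * hsc

lemma sing_avg {μ : Measure Mat3} (hμ : IsHaarSO3 μ) (F : 𝓢(V3 × V3, ℂ)) (hF : Inv3 ⇑F) (R : ℝ) :
    ∫ p, F p * cexp (I * ((R * p.1 2 : ℝ) : ℂ)) = ∫ p, F p * (sph0 R p.1 : ℂ) := by
  have := hμ.1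
  have hm : Continuous fun p : V3 × V3 => cexp (I * ((R * p.1 2 : ℝ) : ℂ)) := by fun_prop
  rw [avg3 hμ F hF hm.measurable (C := 1) (fun p => (ei_norm _).le)]
  congr 1; ext p; congr 1
  have h1 : ∫ k, cexp (I * ((R * (actp k p).1 2 : ℝ) : ℂ)) ∂μ = mom μ p.1 0 R := by
    simp [mom, actp]
  rw [h1]
  have h2 := sinc_int hμ p.1 R
  unfold sph0
  split_ifs with h
  · rcases mul_eq_zero.1 h with h | h
    · simp [mom, h]
    · have : ∀ᵐ k ∂μ, (((k.mulVec p.1) 2 : ℝ) : ℂ) ^ 0 * cexp (I * ((R * (k.mulVec p.1) 2 : ℝ) : ℂ)) = 1 := by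
        filter_upwards [SO3_ae hμ] with k hk
        have h3 := SO3_dot hk p.1 p.1
        simp only [Fin.sum_univ_three] at h3
        have h4 : nrm3 p.1 ^ 2 = (k.mulVec p.1) 0 ^ 2 + (k.mulVec p.1) 1 ^ 2 + (k.mulVec p.1) 2 ^ 2 := by
          rw [nrm3, Real.sq_sqrt (by positivity)]; linarith
        have h5 : (k.mulVec p.1) 2 = 0 := by
          rw [h] at h4
          nlinarith [sq_nonneg ((k.mulVec p.1) 0), sq_nonneg ((k.mulVec p.1) 1), sq_nonneg ((k.mulVec p.1) 2)]
        simp [h5]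
      rw [mom, integral_congr_ae this]; simp
  · have h3 : ((R * nrm3 p.1 : ℝ) : ℂ) ≠ 0 := by exact_mod_cast h
    rw [Complex.ofReal_div, eq_div_iff h3, mul_comm R, ← h2]
    push_cast; ring

theorem main_CLM {μ : Measure Mat3} (hμ : IsHaarSO3 μ) : ∃ D : 𝓢(V3 × V3, ℂ) →L[ℝ] 𝓢(W3, ℂ), ∀ F : 𝓢(V3 × V3, ℂ), Inv3 ⇑F →
    (∀ lam > (0:ℝ), ∀ l : ℕ, ∀ r : ℝ, D F (lam * (2 * l + 1) + r ^ 2, lam ^ 2, lam * r)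
              = ∫ p : V3 × V3, F p * (starRingEnd ℂ) (sph μ lam l r p.1 p.2)) ∧
    (∀ R ≥ (0:ℝ), D F (R ^ 2, 0, 0) = ∫ p : V3 × V3, F p * (sph0 R p.1 : ℂ)) := by
  obtain ⟨U, hU⟩ := S2 hμ
  obtain ⟨Y, hY⟩ := S3
  refine ⟨Y ∘L U, fun F hF => ⟨fun lam hl l r => ?_, fun R _ => ?_⟩⟩
  · obtain ⟨ψ, h1, h2⟩ := hY (U F) (lam ^ 2, lam * r)
    rw [ContinuousLinearMap.comp_apply, h2, ← reg_avg hμ F hF hl]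
    refine reg_eq F ψ l hl fun z1 z2 => ?_
    rw [← h1, hU F hF _ _ _ _ hl.le]
  · obtain ⟨ψ, h1, h2⟩ := hY (U F) (0, 0)
    rw [ContinuousLinearMap.comp_apply, h2, ← sing_avg hμ F hF]
    have h3 := hU F hF 0 0 R 0 le_rfl
    have h4 := h1 (R ^ 2)
    simp only [thS_zero, zero_mul, pp_zero, mul_one, Complex.ofReal_one, ne_eq, OfNat.ofNat_ne_zero, not_false_eq_true, zero_pow, add_zero, zero_add] at h3 h4 ⊢
    rw [← h4, h3]

theorem final_part {μ : Measure Mat3} (hμ : IsHaarSO3 μ) :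
    ∀ a : ℕ, ∃ C : ℝ, 0 < C ∧ ∃ a' : ℕ,
      ∀ F : SchwartzMap (V3 × V3) ℂ, Inv3 ⇑F →
        ∃ f : SchwartzMap (ℝ × ℝ × ℝ) ℂ,
          (∀ lam > (0:ℝ), ∀ l : ℕ, ∀ r : ℝ,
            f (lam * (2 * l + 1) + r ^ 2, lam ^ 2, lam * r)
              = ∫ p : V3 × V3, F p * (starRingEnd ℂ) (sph μ lam l r p.1 p.2)) ∧
          (∀ R ≥ (0:ℝ), f (R ^ 2, 0, 0) = ∫ p : V3 × V3, F p * (sph0 R p.1 : ℂ)) ∧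
          SN a f ≤ C * SN a' F := by
  obtain ⟨D, hD⟩ := main_CLM hμ
  intro a
  have hb : SBu (E' := W3) (X := Unit) (fun A _ => (Finset.Iic (a, a)).sup (schwartzSeminormFamily ℝ W3 ℂ) A) :=
    ⟨Finset.Iic (a, a), 1, zero_le_one, fun A _ => by rw [one_mul]⟩
  obtain ⟨s, C, hC, h⟩ := hb.comp D
  obtain ⟨a', ha'⟩ : ∃ a', s ⊆ Finset.Iic (a', a') := by
    refine ⟨s.sup (fun p => max p.1 p.2), fun p hp => Finset.mem_Iic.2 ?_⟩
    have := Finset.le_sup (f := fun p : ℕ × ℕ => max p.1 p.2) hp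
    exact ⟨(le_max_left _ _).trans this, (le_max_right _ _).trans this⟩
  refine ⟨C + 1, by linarith, a', fun F hF => ⟨D F, (hD F hF).1, (hD F hF).2, ?_⟩⟩
  have h1 : s.sup (schwartzSeminormFamily ℝ (V3 × V3) ℂ) F ≤ SN a' F := Seminorm.le_def.1 (Finset.sup_mono ha') F
  have h2 : 0 ≤ SN a' F := apply_nonneg _ _
  calc SN a (D F) ≤ C * s.sup (schwartzSeminormFamily ℝ (V3 × V3) ℂ) F := h F ()
    _ ≤ C * SN a' F := mul_le_mul_of_nonneg_left h1 hC
    _ ≤ _ := by linarith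

end Aux

/-- Continuity of the Gelfand transform from `𝒮(N_{3,2})^{SO(3)}` into `𝒮(Σ)`:
Schwartz extensions can be chosen with seminorm control. -/
theorem statement1 (μ : Measure Mat3) (hμ : IsHaarSO3 μ) :
    ∀ a : ℕ, ∃ C : ℝ, 0 < C ∧ ∃ a' : ℕ,
      ∀ F : SchwartzMap (V3 × V3) ℂ, Inv3 ⇑F →
        ∃ f : SchwartzMap (ℝ × ℝ × ℝ) ℂ,
          (∀ lam > (0:ℝ), ∀ l : ℕ, ∀ r : ℝ,
            f (lam * (2 * l + 1) + r ^ 2, lam ^ 2, lam * r)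
              = ∫ p : V3 × V3, F p * (starRingEnd ℂ) (sph μ lam l r p.1 p.2)) ∧
          (∀ R ≥ (0:ℝ), f (R ^ 2, 0, 0) = ∫ p : V3 × V3, F p * (sph0 R p.1 : ℂ)) ∧
          SN a f ≤ C * SN a' F := by
  exact final_part hμ
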